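/- arXiv:2603.06261 — 2 statements merged into one kernel-verified Lean document; each statement's English description precedes it below -/
import Mathlib

section
/- Assume α > 2 − 2/k and let a > 0. Then as n → ∞, P(C_n > (1+a) · m_n^{(k)}) = Θ((n · P(W > c_a(n)))^{k−2}); that is, there exist constants 0 < c ≤ C and n_0 such that for all n ≥ n_0, c·(n P(W > c_a(n)))^{k−2} ≤ P(C_n > (1+a) m_n^{(k)}) ≤ C·(n P(W > c_a(n)))^{k−2}. -/
open MeasureTheory Filter Set

noncomputable section

/-- `f_n(h_1,…,h_k) = ∏_{1≤i<j≤k} min(h_i h_j/(μ n), 1)`. -/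
def fDef (μ : ℝ) (n k : ℕ) (x : Fin k → ℝ) : ℝ :=
  ∏ p ∈ Finset.univ.filter (fun p : Fin k × Fin k => p.1 < p.2),
    min (x p.1 * x p.2 / (μ * n)) 1

/-- Expected `k`-clique count `m_n^{(k)}`. -/
def mExp (ν : Measure ℝ) (μ : ℝ) (k n : ℕ) : ℝ :=
  (n.choose k : ℝ) *
    ∫ x in Set.univ.pi (fun _ : Fin k => Set.Ici (1 : ℝ)),
      fDef μ n k x ∂(Measure.pi fun _ : Fin k => ν)

/-- The weight vector `(x, y, c, …, c)`. -/
def hubVec (k : ℕ) (x y c : ℝ) : Fin k → ℝ :=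
  fun i => if i.val = 0 then x else if i.val = 1 then y else c

/-- `∫∫ f_n(x, y, c, …, c) dF(x) dF(y)`. -/
def twoInt (ν : Measure ℝ) (μ : ℝ) (k n : ℕ) (c : ℝ) : ℝ :=
  ∫ x in Set.Ici (1 : ℝ), ∫ y in Set.Ici (1 : ℝ),
    fDef μ n k (hubVec k x y c) ∂ν ∂ν

/-- `c_a(n)`, the smallest hub size creating an expected excess of `a m_n^{(k)}` cliques. -/
def cA (ν : Measure ℝ) (μ : ℝ) (k : ℕ) (a : ℝ) (n : ℕ) : ℝ :=
  sInf {c : ℝ | 0 < c ∧ a * mExp ν μ k n < (n.choose 2 : ℝ) * twoInt ν μ k n c}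

/-- `C_n = Σ_{1≤i_1<⋯<i_k≤n} f_n(W_{i_1},…,W_{i_k})`, the conditional expectation given
the weights of the number of `k`-cliques. -/
def Cful (μ : ℝ) (k n : ℕ) (w : Fin n → ℝ) : ℝ :=
  ∑ S ∈ Finset.powersetCard k (Finset.univ : Finset (Fin n)),
    ∏ p ∈ Finset.univ.filter (fun p : Fin n × Fin n => p.1 ∈ S ∧ p.2 ∈ S ∧ p.1 < p.2),
      min (w p.1 * w p.2 / (μ * n)) 1


set_option linter.unusedVariables false

/-! ## Combinatorics of pair products -/

/-- Product of `v` over the pairs of a finite set. -/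
def pp {ι : Type*} [LinearOrder ι] [Fintype ι] (v : ι → ι → ℝ) (S : Finset ι) : ℝ :=
  ∏ p ∈ Finset.univ.filter (fun p : ι × ι => p.1 ∈ S ∧ p.2 ∈ S ∧ p.1 < p.2), v p.1 p.2

section comb

variable {ι : Type*} [LinearOrder ι] [Fintype ι]

lemma pp_nonneg (v : ι → ι → ℝ) (hv0 : ∀ i j, 0 ≤ v i j) (S : Finset ι) : 0 ≤ pp v S :=
  Finset.prod_nonneg fun _ _ => hv0 _ _

lemma pp_mono (v : ι → ι → ℝ) (hv0 : ∀ i j, 0 ≤ v i j) (hv1 : ∀ i j, v i j ≤ 1)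
    {A S : Finset ι} (h : A ⊆ S) : pp v S ≤ pp v A := by
  apply Finset.prod_le_prod_of_subset_of_le_one
  · intro p hp
    simp only [Finset.mem_filter, Finset.mem_univ, true_and] at hp ⊢
    exact ⟨h hp.1, h hp.2.1, hp.2.2⟩
  · intro i _; exact hv0 _ _
  · intro i _ _; exact hv1 _ _

lemma pp_le_one (v : ι → ι → ℝ) (hv0 : ∀ i j, 0 ≤ v i j) (hv1 : ∀ i j, v i j ≤ 1)
    (S : Finset ι) : pp v S ≤ 1 :=
  Finset.prod_le_one (fun _ _ => hv0 _ _) (fun _ _ => hv1 _ _)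

lemma pp_empty (v : ι → ι → ℝ) : pp v ∅ = 1 := by simp [pp]

lemma pp_insert (v : ι → ι → ℝ) (hs : ∀ i j, v i j = v j i) {a : ι} {S : Finset ι} (ha : a ∉ S) :
    pp v (insert a S) = (∏ i ∈ S, v a i) * pp v S := by
  classical
  have e : Finset.univ.filter (fun p : ι × ι => p.1 ∈ insert a S ∧ p.2 ∈ insert a S ∧ p.1 < p.2)
      = S.image (fun i => if a < i then (a, i) else (i, a)) ∪
        Finset.univ.filter (fun p : ι × ι => p.1 ∈ S ∧ p.2 ∈ S ∧ p.1 < p.2) := by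
    ext ⟨x, y⟩
    simp only [Finset.mem_filter, Finset.mem_univ, true_and, Finset.mem_insert, Finset.mem_union,
      Finset.mem_image]
    constructor
    · rintro ⟨rfl | hx, rfl | hy, hlt⟩
      · exact absurd hlt (lt_irrefl _)
      · left; exact ⟨y, hy, by simp [hlt]⟩
      · left; exact ⟨x, hx, by simp [hlt.le]⟩
      · right; exact ⟨hx, hy, hlt⟩
    · rintro (⟨i, hi, h⟩ | ⟨hx, hy, hlt⟩)
      · have hne : i ≠ a := fun h => ha (h ▸ hi)
        split_ifs at h with h1
        · simp only [Prod.mk.injEq] at h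
          obtain ⟨rfl, rfl⟩ := h
          exact ⟨Or.inl rfl, Or.inr hi, h1⟩
        · simp only [Prod.mk.injEq] at h
          obtain ⟨rfl, rfl⟩ := h
          exact ⟨Or.inr hi, Or.inl rfl, lt_of_le_of_ne (not_lt.1 h1) hne⟩
      · exact ⟨Or.inr hx, Or.inr hy, hlt⟩
  rw [pp, e, Finset.prod_union, Finset.prod_image, pp]
  · congr 1
    apply Finset.prod_congr rfl
    intro i hi
    split_ifs
    · rfl
    · exact hs _ _
  · intro i hi j hj h
    have hne : i ≠ a := fun h => ha (h ▸ hi)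
    have hne' : j ≠ a := fun h => ha (h ▸ hj)
    dsimp only at h
    split_ifs at h <;> simp_all
  · rw [Finset.disjoint_left]
    rintro ⟨x, y⟩ h1 h2
    simp only [Finset.mem_filter, Finset.mem_univ, true_and, Finset.mem_image] at h1 h2
    obtain ⟨i, hi, h⟩ := h1
    split_ifs at h
    · simp only [Prod.mk.injEq] at h
      exact ha (h.1 ▸ h2.1)
    · simp only [Prod.mk.injEq] at h
      exact ha (h.2 ▸ h2.2.1)

lemma pp_triple (v : ι → ι → ℝ) (hs : ∀ i j, v i j = v j i) {a b c : ι} (hab : a ≠ b)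
    (hac : a ≠ c) (hbc : b ≠ c) : pp v {a, b, c} = v a b * v a c * v b c := by
  rw [pp_insert v hs (by simp [hab, hac]), pp_insert v hs (by simp [hbc]),
    ← insert_empty_eq c, pp_insert v hs (by simp), pp_empty]
  simp [Finset.prod_insert, hbc]

lemma pp_map {κ : Type*} [LinearOrder κ] [Fintype κ] (v : ι → ι → ℝ)
    (hs : ∀ i j, v i j = v j i) (e : κ → ι) (he : Function.Injective e) (S : Finset κ) :
    pp (fun i j => v (e i) (e j)) S = pp v (S.image e) := by
  classical
  induction S using Finset.induction_on with
  | empty => simp [pp_empty]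
  | insert a S ha ih =>
    have : e a ∉ S.image e := by
      simp only [Finset.mem_image, not_exists, not_and]
      intro x hx h
      exact ha (he h ▸ hx)
    rw [Finset.image_insert, pp_insert _ hs this, pp_insert _ (fun i j => hs _ _) ha, ih,
      Finset.prod_image (fun x _ y _ h => he h)]

/-- elementary symmetric function bound -/
lemma esymm_le {ι : Type*} [LinearOrder ι] (x : ι → ℝ) (hx : ∀ i, 0 ≤ x i) (U : Finset ι) (j : ℕ) :
    ∑ B ∈ Finset.powersetCard j U, ∏ i ∈ B, x i ≤ (∑ i ∈ U, x i) ^ j := by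
  classical
  induction U using Finset.induction_on generalizing j with
  | empty =>
    cases j with
    | zero => simp
    | succ j => rw [Finset.powersetCard_eq_empty.2 (by simp)]; simp
  | insert a U ha ih =>
    cases j with
    | zero => simp
    | succ j =>
      rw [Finset.powersetCard_succ_insert ha, Finset.sum_union, Finset.sum_image,
        Finset.sum_insert ha]
      · have e : ∑ B ∈ Finset.powersetCard j U, ∏ i ∈ insert a B, x i
            = x a * ∑ B ∈ Finset.powersetCard j U, ∏ i ∈ B, x i := by
          rw [Finset.mul_sum]
          apply Finset.sum_congr rfl
          intro B hB
          rw [Finset.prod_insert]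
          intro h; exact ha ((Finset.mem_powersetCard.1 hB).1 h)
        rw [e]
        have h1 := ih (j + 1)
        have h2 := ih j
        have hX : 0 ≤ ∑ i ∈ U, x i := Finset.sum_nonneg fun i _ => hx i
        calc _ ≤ (∑ i ∈ U, x i) ^ (j + 1) + x a * (∑ i ∈ U, x i) ^ j :=
              add_le_add h1 (mul_le_mul_of_nonneg_left h2 (hx a))
          _ = (∑ i ∈ U, x i) ^ j * (x a + ∑ i ∈ U, x i) := by ring
          _ ≤ (x a + ∑ i ∈ U, x i) ^ j * (x a + ∑ i ∈ U, x i) := by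
              apply mul_le_mul_of_nonneg_right
              · exact pow_le_pow_left₀ hX (by linarith [hx a]) _
              · linarith [hx a]
          _ = _ := by ring
      · intro B hB B' hB' h
        have h1 : a ∉ B := fun h => ha ((Finset.mem_powersetCard.1 hB).1 h)
        have h2 : a ∉ B' := fun h => ha ((Finset.mem_powersetCard.1 hB').1 h)
        rw [← Finset.erase_insert h1, ← Finset.erase_insert h2]
        rw [h]
      · rw [Finset.disjoint_left]
        intro B hB h
        obtain ⟨B', _, rfl⟩ := Finset.mem_image.1 h
        exact ha ((Finset.mem_powersetCard.1 hB).1 (Finset.mem_insert_self _ _))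

/-- sum over sets with prescribed hub part -/
lemma fiber_sum_le (F : Finset ι → ℝ) (x : ι → ℝ) (hx : ∀ i, 0 ≤ x i) (c : ℝ) (hc : 0 ≤ c)
    (H A : Finset ι) (k : ℕ)
    (h : ∀ S : Finset ι, S.card = k → S ∩ H = A → F S ≤ c * ∏ i ∈ S \ H, x i) :
    ∑ S ∈ (Finset.powersetCard k (Finset.univ : Finset ι)).filter (fun S => S ∩ H = A), F S ≤
      c * (∑ i ∈ Hᶜ, x i) ^ (k - A.card) := by
  classical
  calc _ ≤ ∑ S ∈ (Finset.powersetCard k (Finset.univ : Finset ι)).filter (fun S => S ∩ H = A),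
        c * ∏ i ∈ S \ H, x i := by
        apply Finset.sum_le_sum
        intro S hS
        simp only [Finset.mem_filter, Finset.mem_powersetCard] at hS
        exact h S hS.1.2 hS.2
    _ = c * ∑ B ∈ ((Finset.powersetCard k (Finset.univ : Finset ι)).filter
          (fun S => S ∩ H = A)).image (fun S => S \ H), ∏ i ∈ B, x i := by
        rw [Finset.sum_image, Finset.mul_sum]
        intro S hS S' hS' h
        simp only [Finset.coe_filter, Finset.mem_powersetCard, Set.mem_ofPred_eq] at hS hS'
        dsimp only at h
        rw [← Finset.sdiff_union_inter S H, ← Finset.sdiff_union_inter S' H, h, hS.2, hS'.2]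
    _ ≤ c * ∑ B ∈ Finset.powersetCard (k - A.card) Hᶜ, ∏ i ∈ B, x i := by
        apply mul_le_mul_of_nonneg_left _ hc
        apply Finset.sum_le_sum_of_subset_of_nonneg
        · intro B hB
          simp only [Finset.mem_image, Finset.mem_filter, Finset.mem_powersetCard] at hB
          obtain ⟨S, ⟨⟨_, hS⟩, hA⟩, rfl⟩ := hB
          rw [Finset.mem_powersetCard]
          constructor
          · intro i hi; simp only [Finset.mem_sdiff] at hi; simpa using hi.2
          · have := Finset.card_sdiff_add_card_inter S H
            rw [hA, hS] at this
            omega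
        · intro B _ _
          exact Finset.prod_nonneg fun i _ => hx i
    _ ≤ _ := mul_le_mul_of_nonneg_left (esymm_le x hx _ _) hc

/-- From sets to tuples. -/
lemma sum_sets_le_tuples (k : ℕ) (U : Finset ι) (F : Finset ι → ℝ) (F' : (Fin k → ι) → ℝ)
    (hF' : ∀ e, 0 ≤ F' e)
    (h : ∀ e : Fin k → ι, Function.Injective e → (∀ i, e i ∈ U) →
      F (Finset.univ.image e) ≤ F' e) :
    (k.factorial : ℝ) * ∑ S ∈ Finset.powersetCard k U, F S ≤ ∑ e : Fin k → ι, F' e := by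
  classical
  let P := Finset.powersetCard k U
  let emb : P × Equiv.Perm (Fin k) → (Fin k → ι) := fun q i =>
    q.1.1.orderEmbOfFin (Finset.mem_powersetCard.1 q.1.2).2 (q.2 i)
  have himg : ∀ q, Finset.univ.image (emb q) = q.1.1 := by
    intro q
    have : emb q = (q.1.1.orderEmbOfFin (Finset.mem_powersetCard.1 q.1.2).2) ∘ q.2 := rfl
    rw [this, ← Finset.image_image, Finset.image_univ_of_surjective q.2.surjective,
      Finset.image_orderEmbOfFin_univ]
  have hinj : Function.Injective emb := by
    intro q q' hqq
    have h1 : q.1 = q'.1 := by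
      apply Subtype.ext
      rw [← himg q, ← himg q', hqq]
    obtain ⟨S, σ⟩ := q
    obtain ⟨S', σ'⟩ := q'
    dsimp only at h1
    subst h1
    congr 1
    ext i
    have := congrFun hqq i
    simp only [emb] at this
    rw [(Finset.orderEmbOfFin _ _).injective this]
  calc (k.factorial : ℝ) * ∑ S ∈ P, F S = ∑ q : P × Equiv.Perm (Fin k), F q.1.1 := by
        rw [Fintype.sum_prod_type]
        simp only [Finset.sum_const, Finset.card_univ, Fintype.card_perm, Fintype.card_fin,
          nsmul_eq_mul, ← Finset.mul_sum]
        rw [Finset.sum_coe_sort P F]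
    _ ≤ ∑ q : P × Equiv.Perm (Fin k), F' (emb q) := by
        apply Finset.sum_le_sum
        intro q _
        rw [← himg q]
        apply h
        · intro i j hij
          exact q.2.injective ((Finset.orderEmbOfFin _ _).injective hij)
        · intro i
          apply (Finset.mem_powersetCard.1 q.1.2).1
          exact Finset.orderEmbOfFin_mem _ _ _
    _ = ∑ e ∈ Finset.univ.image emb, F' e := by
        rw [Finset.sum_image]
        intro a _ b _ hab
        exact hinj hab
    _ ≤ _ := Finset.sum_le_sum_of_subset_of_nonneg (Finset.subset_univ _) fun e _ _ => hF' e

end comb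

/-! ## The product bound -/

/-- `u ^ s` for `u ≤ 1`, `u ^ r` for `u > 1`. -/
def gf (r s u : ℝ) : ℝ := if u ≤ 1 then u ^ s else u ^ r

lemma gf_nonneg (r s : ℝ) {u : ℝ} (hu : 0 ≤ u) : 0 ≤ gf r s u := by
  unfold gf; split_ifs <;> positivity

lemma gf_ge_one {r s u : ℝ} (hr : 0 ≤ r) (hu : 1 ≤ u) : 1 ≤ gf r s u := by
  unfold gf
  split_ifs with h
  · have : u = 1 := le_antisymm h hu
    simp [this]
  · exact Real.one_le_rpow hu hr

lemma gf_mono_exp {r r' s s' u : ℝ} (hu : 0 < u) (hr : r' ≤ r) (hs : s ≤ s') :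
    gf r' s' u ≤ gf r s u := by
  unfold gf
  split_ifs with h
  · exact Real.rpow_le_rpow_of_exponent_ge hu h hs
  · exact Real.rpow_le_rpow_of_exponent_le (not_le.1 h).le hr

lemma gf_out {r s η ε u : ℝ} (hu : 0 < u) (hη : 0 ≤ η) (hε : 0 < ε) (hε1 : ε ≤ 1)
    (h : u ≤ ε ∨ 1 / ε < u) : gf (r - η) (s + η) u ≤ ε ^ η * gf r s u := by
  unfold gf
  rcases h with h | h
  · rw [if_pos (h.trans hε1), if_pos (h.trans hε1), Real.rpow_add hu, mul_comm]
    exact mul_le_mul_of_nonneg_right (Real.rpow_le_rpow hu.le h hη) (by positivity)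
  · have h1 : 1 < u := lt_of_le_of_lt (by rw [le_div_iff₀ hε]; linarith) h
    rw [if_neg (not_le.2 h1), if_neg (not_le.2 h1), Real.rpow_sub hu, div_eq_mul_inv, mul_comm]
    apply mul_le_mul_of_nonneg_right _ (by positivity)
    rw [← Real.inv_rpow hu.le]
    apply Real.rpow_le_rpow (by positivity) _ hη
    rw [inv_le_comm₀ hu hε]
    rw [one_div] at h
    exact h.le

lemma min_one_le_rpow {x θ : ℝ} (hx : 0 < x) (h0 : 0 ≤ θ) (h1 : θ ≤ 1) : min x 1 ≤ x ^ θ := by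
  rcases le_total x 1 with h | h
  · rw [min_eq_left h]
    calc x = x ^ (1 : ℝ) := (Real.rpow_one x).symm
      _ ≤ x ^ θ := Real.rpow_le_rpow_of_exponent_ge hx h h1
  · rw [min_eq_right h]
    exact Real.one_le_rpow h h0

lemma triple_ord {r s x y z : ℝ} (hs1 : 1 ≤ s) (hs2 : s ≤ 2) (hr1 : s / 2 ≤ r)
    (hr2 : 2 * (s - 1) ≤ r) (hz : 0 < z) (hzy : z ≤ y) (hyx : y ≤ x) :
    min (x * y) 1 * min (x * z) 1 * min (y * z) 1 ≤ gf r s x * gf r s y * gf r s z := by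
  have hy : 0 < y := hz.trans_le hzy
  have hx : 0 < x := hy.trans_le hyx
  have hr0 : 0 ≤ r := by linarith
  have m0 : ∀ a b : ℝ, 0 < a → 0 < b → 0 ≤ min (a * b) 1 := fun a b ha hb => by positivity
  rcases le_or_gt x 1 with h1 | h1
  · have hy1 := hyx.trans h1
    have hz1 := hzy.trans hy1
    have key : ∀ u : ℝ, 0 < u → u ≤ 1 → u ^ 2 ≤ gf r s u := by
      intro u hu hu1
      unfold gf
      rw [if_pos hu1, ← Real.rpow_natCast]
      exact Real.rpow_le_rpow_of_exponent_ge hu hu1 (by exact_mod_cast hs2)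
    calc _ ≤ (x * y) * (x * z) * (y * z) := by
          gcongr <;> first | exact min_le_left _ _ | positivity
      _ = x ^ 2 * y ^ 2 * z ^ 2 := by ring
      _ ≤ _ := by
          have := gf_nonneg r s hx.le
          have := gf_nonneg r s hy.le
          have := gf_nonneg r s hz.le
          gcongr <;> first | exact key _ (by assumption) (by assumption) | assumption
  rcases le_or_gt y 1 with h2 | h2
  · have hz1 := hzy.trans h2
    calc _ ≤ (x * y) ^ (s - 1) * (x * z) ^ (s - 1) * (y * z) := by
          gcongr
          · exact min_one_le_rpow (by positivity) (by linarith) (by linarith)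
          · exact min_one_le_rpow (by positivity) (by linarith) (by linarith)
          · exact min_le_left _ _
      _ = x ^ (2 * (s - 1)) * y ^ s * z ^ s := by
          have e1 : y ^ s = y ^ (s - 1) * y := by
            rw [Real.rpow_sub_one hy.ne']; field_simp
          have e2 : z ^ s = z ^ (s - 1) * z := by
            rw [Real.rpow_sub_one hz.ne']; field_simp
          have e3 : x ^ (2 * (s - 1)) = x ^ (s - 1) * x ^ (s - 1) := by
            rw [← Real.rpow_add hx]; ring_nf
          rw [Real.mul_rpow hx.le hy.le, Real.mul_rpow hx.le hz.le, e1, e2, e3]; ring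
      _ ≤ _ := by
          unfold gf
          rw [if_neg (not_le.2 h1), if_pos h2, if_pos hz1]
          gcongr
          exact h1.le
  rcases le_or_gt z 1 with h3 | h3
  · calc _ ≤ 1 * (x * z) ^ (s / 2) * (y * z) ^ (s / 2) := by
          gcongr
          · exact min_le_right _ _
          · exact min_one_le_rpow (by positivity) (by linarith) (by linarith)
          · exact min_one_le_rpow (by positivity) (by linarith) (by linarith)
      _ = x ^ (s / 2) * y ^ (s / 2) * z ^ s := by
          have e3 : z ^ s = z ^ (s / 2) * z ^ (s / 2) := by
            rw [← Real.rpow_add hz]; ring_nf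
          rw [Real.mul_rpow hx.le hz.le, Real.mul_rpow hy.le hz.le, e3]; ring
      _ ≤ _ := by
          unfold gf
          rw [if_neg (not_le.2 h1), if_neg (not_le.2 h2), if_pos h3]
          gcongr
          · exact h1.le
          · exact h2.le
  · calc _ ≤ 1 * 1 * (1 : ℝ) := by gcongr <;> exact min_le_right _ _
      _ ≤ _ := by
          have a1 : 1 ≤ gf r s x := gf_ge_one hr0 h1.le
          have a2 : 1 ≤ gf r s y := gf_ge_one hr0 h2.le
          have a3 : 1 ≤ gf r s z := gf_ge_one hr0 h3.le
          gcongr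

lemma triple_bound {r s x y z : ℝ} (hs1 : 1 ≤ s) (hs2 : s ≤ 2) (hr1 : s / 2 ≤ r)
    (hr2 : 2 * (s - 1) ≤ r) (hx : 0 < x) (hy : 0 < y) (hz : 0 < z) :
    min (x * y) 1 * min (x * z) 1 * min (y * z) 1 ≤ gf r s x * gf r s y * gf r s z := by
  have T := fun (a b c : ℝ) => @triple_ord r s a b c hs1 hs2 hr1 hr2
  rcases le_total x y with h1 | h1 <;> rcases le_total y z with h2 | h2 <;>
    rcases le_total x z with h3 | h3
  · have := T z y x hx h1 h2
    rw [mul_comm z y, mul_comm z x, mul_comm y x] at this; linarith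
  · have := T z y x hx h1 h2
    rw [mul_comm z y, mul_comm z x, mul_comm y x] at this; linarith
  · have := T y z x hx h3 h2
    rw [mul_comm z x, mul_comm y x] at this; linarith
  · have := T y x z hz h3 h1
    rw [mul_comm y x] at this; linarith
  · have := T z x y hy h1 h3
    rw [mul_comm z x, mul_comm z y] at this; linarith
  · have := T x z y hy h2 h3
    rw [mul_comm z y] at this; linarith
  · have := T x y z hz h2 h1
    linarith
  · have := T x y z hz h2 h1
    linarith

lemma pp_le_prod {ι : Type*} [LinearOrder ι] [Fintype ι] {r s : ℝ} (hs1 : 1 ≤ s) (hs2 : s ≤ 2)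
    (hr1 : s / 2 ≤ r) (hr2 : 2 * (s - 1) ≤ r) (u : ι → ℝ) (hu : ∀ i, 0 < u i) (S : Finset ι)
    (hS : 3 ≤ S.card) :
    pp (fun i j => min (u i * u j) 1) S ≤ ∏ i ∈ S, gf r s (u i) := by
  classical
  have hr0 : 0 ≤ r := by linarith
  have v0 : ∀ i j, 0 ≤ min (u i * u j) 1 := fun i j => by
    have := hu i; have := hu j; positivity
  have v1 : ∀ i j, min (u i * u j) 1 ≤ 1 := fun i j => min_le_right _ _
  have vs : ∀ i j, min (u i * u j) 1 = min (u j * u i) 1 := fun i j => by rw [mul_comm]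
  obtain ⟨m, hm⟩ : ∃ m, m = S.card := ⟨_, rfl⟩
  induction m generalizing S with
  | zero => omega
  | succ m ih =>
    rcases Nat.lt_or_ge m 3 with h3 | h3
    · have : S.card = 3 := by omega
      obtain ⟨a, b, c, hab, hac, hbc, rfl⟩ := Finset.card_eq_three.1 this
      rw [pp_triple _ vs hab hac hbc, Finset.prod_insert (by simp [hab, hac]),
        Finset.prod_insert (by simp [hbc]), Finset.prod_singleton, ← mul_assoc]
      exact triple_bound hs1 hs2 hr1 hr2 (hu a) (hu b) (hu c)
    · have hne : S.Nonempty := Finset.card_pos.1 (by omega)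
      obtain ⟨a, ha, hmax⟩ := Finset.exists_max_image S u hne
      have hcard : (S.erase a).card = m := by rw [Finset.card_erase_of_mem ha]; omega
      have hI := ih (S.erase a) (by omega) hcard.symm
      have hP : 0 ≤ ∏ i ∈ S.erase a, gf r s (u i) :=
        Finset.prod_nonneg fun i _ => gf_nonneg r s (hu i).le
      rw [← Finset.mul_prod_erase S _ ha]
      conv_lhs => rw [← Finset.insert_erase ha]
      rw [pp_insert _ vs (Finset.notMem_erase a S)]
      apply mul_le_mul _ hI (pp_nonneg _ v0 _) (gf_nonneg r s (hu a).le)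
      rcases le_or_gt (u a) 1 with h1 | h1
      · calc ∏ i ∈ S.erase a, min (u a * u i) 1 ≤ ∏ i ∈ S.erase a, u a := by
              apply Finset.prod_le_prod (fun i _ => v0 a i)
              intro i hi
              refine (min_le_left _ _).trans ?_
              have := (hmax i (Finset.mem_of_mem_erase hi)).trans h1
              exact mul_le_of_le_one_right (hu a).le this
          _ = u a ^ m := by rw [Finset.prod_const, hcard]
          _ ≤ u a ^ 2 := pow_le_pow_of_le_one (hu a).le h1 (by omega)
          _ ≤ gf r s (u a) := by
              unfold gf
              rw [if_pos h1, ← Real.rpow_natCast]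
              exact Real.rpow_le_rpow_of_exponent_ge (hu a) h1 (by exact_mod_cast hs2)
      · exact (Finset.prod_le_one (fun i _ => v0 a i) (fun i _ => v1 a i)).trans
          (gf_ge_one hr0 h1.le)

/-! ## Tails and truncated moments -/

section tails

set_option linter.unusedSectionVars false

variable {ν : Measure ℝ} [IsProbabilityMeasure ν] {α : ℝ}

lemma tail_upper (hα : 0 < α)
    (htail : Tendsto (fun x : ℝ => x ^ α * (ν (Set.Ioi x)).toReal) atTop (nhds 1)) :
    ∃ C : ℝ, 0 < C ∧ ∀ x : ℝ, 0 < x → (ν (Set.Ioi x)).toReal ≤ C * x ^ (-α) := by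
  have h := htail.eventually (gt_mem_nhds (show (1 : ℝ) < 2 by norm_num))
  obtain ⟨x0, hx0⟩ := (h.and (eventually_ge_atTop 1)).exists_forall_of_atTop
  refine ⟨max 2 ((max x0 1) ^ α), by positivity, fun x hx => ?_⟩
  rcases le_or_gt x0 x with h1 | h1
  · have := (hx0 x h1).1
    have hxp : 0 < x ^ α := by positivity
    rw [Real.rpow_neg hx.le, ← div_eq_mul_inv, le_div_iff₀ hxp]
    calc _ = x ^ α * (ν (Set.Ioi x)).toReal := by ring
      _ ≤ 2 := this.le
      _ ≤ _ := le_max_left _ _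
  · have hxp : 0 < x ^ α := by positivity
    rw [Real.rpow_neg hx.le, ← div_eq_mul_inv, le_div_iff₀ hxp]
    calc (ν (Set.Ioi x)).toReal * x ^ α ≤ 1 * x ^ α := by
          gcongr
          exact measureReal_le_one
      _ ≤ (max x0 1) ^ α := by
          rw [one_mul]
          exact Real.rpow_le_rpow hx.le (h1.le.trans (le_max_left _ _)) hα.le
      _ ≤ _ := le_max_right _ _

lemma tail_lower 
    (htail : Tendsto (fun x : ℝ => x ^ α * (ν (Set.Ioi x)).toReal) atTop (nhds 1)) :
    ∀ᶠ x : ℝ in atTop, 1 / 2 * x ^ (-α) ≤ (ν (Set.Ioi x)).toReal := by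
  have h := htail.eventually (lt_mem_nhds (show (1 / 2 : ℝ) < 1 by norm_num))
  filter_upwards [h, eventually_gt_atTop 0] with x hx hx0
  have hxp : 0 < x ^ α := by positivity
  rw [Real.rpow_neg hx0.le, ← div_eq_mul_inv, div_le_iff₀ hxp]
  linarith

lemma bin_lower (hα : 0 < α) {l : ℝ} (hl : 1 < l)
    (htail : Tendsto (fun x : ℝ => x ^ α * (ν (Set.Ioi x)).toReal) atTop (nhds 1)) :
    ∃ c : ℝ, 0 < c ∧
      ∀ᶠ x : ℝ in atTop, c * x ^ (-α) ≤ (ν (Set.Ioc x (l * x))).toReal := by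
  have hl0 : 0 < l := by linarith
  have h2 : Tendsto (fun x : ℝ => (l * x) ^ α * (ν (Set.Ioi (l * x))).toReal) atTop (nhds 1) :=
    htail.comp (tendsto_id.const_mul_atTop hl0)
  have h3 := htail.sub (h2.const_mul (l ^ (-α)))
  have hlt : l ^ (-α) < 1 := Real.rpow_lt_one_of_one_lt_of_neg hl (by linarith)
  have h4 := h3.eventually (lt_mem_nhds (show (1 - l ^ (-α)) / 2 < 1 - l ^ (-α) * 1 by linarith))
  refine ⟨(1 - l ^ (-α)) / 2, by linarith, ?_⟩
  filter_upwards [h4, eventually_gt_atTop 0] with x hx hx0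
  have hxp : 0 < x ^ α := by positivity
  have e : (ν (Set.Ioc x (l * x))).toReal = (ν (Set.Ioi x)).toReal - (ν (Set.Ioi (l * x))).toReal := by
    have hle : x ≤ l * x := by nlinarith
    have h5 : ν (Set.Ioc x (l * x)) + ν (Set.Ioi (l * x)) = ν (Set.Ioi x) := by
      rw [← measure_union _ measurableSet_Ioi, Set.Ioc_union_Ioi_eq_Ioi hle]
      rw [Set.disjoint_left]
      intro y hy hy2
      exact absurd hy.2 (not_le.2 hy2)
    rw [← h5, ENNReal.toReal_add (measure_ne_top _ _) (measure_ne_top _ _)]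
    ring
  rw [e, Real.rpow_neg hx0.le, ← div_eq_mul_inv, div_le_iff₀ hxp]
  have e2 : l ^ (-α) * ((l * x) ^ α * (ν (Set.Ioi (l * x))).toReal)
      = x ^ α * (ν (Set.Ioi (l * x))).toReal := by
    rw [Real.mul_rpow hl0.le hx0.le, Real.rpow_neg hl0.le]
    have : l ^ α ≠ 0 := by positivity
    field_simp
  rw [e2] at hx
  linarith

lemma measurable_gf (r s : ℝ) : Measurable (gf r s) := by
  unfold gf
  apply Measurable.ite measurableSet_Iic <;> fun_prop

lemma gf_le_sum {r s u : ℝ} (hr : 0 < r) (hu : 0 ≤ u) :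
    gf r s u ≤ (min u 1) ^ s + (if 1 < u then u else 0) ^ r := by
  unfold gf
  split_ifs with h1 h2 h2
  · linarith
  · rw [min_eq_left h1, Real.zero_rpow hr.ne']; simp
  · have : 0 ≤ (min u 1) ^ s := by positivity
    linarith
  · exact absurd (not_le.1 h1) h2

lemma gf_moment (hα : 0 < α)  (hsupp : ν (Set.Iio 1) = 0)
    (htail : Tendsto (fun x : ℝ => x ^ α * (ν (Set.Ioi x)).toReal) atTop (nhds 1))
    {r s : ℝ} (hr : 0 < r) (hrα : r < α) (hs : α < s) :
    ∃ C : ℝ, 0 < C ∧ ∀ q : ℝ, 0 < q →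
      Integrable (fun x => gf r s (x / q)) ν ∧ ∫ x, gf r s (x / q) ∂ν ≤ C * q ^ (-α) := by
  obtain ⟨C0, hC0, hC⟩ := tail_upper hα htail
  have hs0 : 0 < s := hα.trans hs
  have hae : ∀ᵐ x ∂ν, (1 : ℝ) ≤ x := by
    rw [ae_iff]; simpa [Set.Iio] using hsupp
  have tailE : ∀ q : ℝ, 0 < q → ∀ y : ℝ, 0 < y →
      ν {x | y < x / q} ≤ ENNReal.ofReal (C0 * q ^ (-α)) * ENNReal.ofReal (y ^ (-α)) := by
    intro q hq y hy
    have e : {x : ℝ | y < x / q} = Set.Ioi (y * q) := by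
      ext x; simp [lt_div_iff₀ hq]
    rw [e, ← ENNReal.ofReal_mul (by positivity), ← ENNReal.ofReal_toReal (measure_ne_top ν _)]
    apply ENNReal.ofReal_le_ofReal
    have := hC (y * q) (by positivity)
    rw [Real.mul_rpow hy.le hq.le] at this
    linarith
  -- finite constants
  have I1 : ∫⁻ y in Set.Ioo (0 : ℝ) 1, ENNReal.ofReal (y ^ (s - 1 - α)) < ⊤ := by
    have : IntegrableOn (fun y : ℝ => y ^ (s - 1 - α)) (Set.Ioo 0 1) := by
      rw [intervalIntegral.integrableOn_Ioo_rpow_iff zero_lt_one]; linarith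
    exact this.lintegral_lt_top
  have I2 : ∫⁻ y in Set.Ioo (0 : ℝ) 1, ENNReal.ofReal (y ^ (r - 1)) < ⊤ := by
    have : IntegrableOn (fun y : ℝ => y ^ (r - 1)) (Set.Ioo 0 1) := by
      rw [intervalIntegral.integrableOn_Ioo_rpow_iff zero_lt_one]; linarith
    exact this.lintegral_lt_top
  have I3 : ∫⁻ y in Set.Ioi (1 : ℝ), ENNReal.ofReal (y ^ (r - 1 - α)) < ⊤ :=
    (integrableOn_Ioi_rpow_of_lt (by linarith) zero_lt_one).lintegral_lt_top
  set K : ENNReal := ENNReal.ofReal s * (∫⁻ y in Set.Ioo (0 : ℝ) 1, ENNReal.ofReal (y ^ (s - 1 - α)))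
    + ENNReal.ofReal r * ((∫⁻ y in Set.Ioo (0 : ℝ) 1, ENNReal.ofReal (y ^ (r - 1))) +
      ∫⁻ y in Set.Ioi (1 : ℝ), ENNReal.ofReal (y ^ (r - 1 - α))) with hK
  have hKt : K < ⊤ := by
    apply ENNReal.add_lt_top.2 ⟨ENNReal.mul_lt_top ENNReal.ofReal_lt_top I1, ENNReal.mul_lt_top ENNReal.ofReal_lt_top (ENNReal.add_lt_top.2 ⟨I2, I3⟩)⟩
  have main : ∀ q : ℝ, 0 < q →
      ∫⁻ x, ENNReal.ofReal (gf r s (x / q)) ∂ν ≤ ENNReal.ofReal (C0 * q ^ (-α)) * K := by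
    intro q hq
    have hae2 : ∀ᵐ x ∂ν, 0 ≤ x / q := by
      filter_upwards [hae] with x hx
      have : 0 ≤ x := by linarith
      positivity
    have A1 : ∫⁻ x, ENNReal.ofReal ((min (x / q) 1) ^ s) ∂ν ≤
        ENNReal.ofReal (C0 * q ^ (-α)) * (ENNReal.ofReal s * (∫⁻ y in Set.Ioo (0 : ℝ) 1, ENNReal.ofReal (y ^ (s - 1 - α)))) := by
      rw [lintegral_rpow_eq_lintegral_meas_lt_mul ν (f := fun x => min (x / q) 1) _ (by fun_prop) hs0]
      · rw [mul_left_comm]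
        gcongr ENNReal.ofReal s * ?_
        rw [← lintegral_const_mul' _ _ ENNReal.ofReal_ne_top, ← lintegral_indicator measurableSet_Ioi, ← lintegral_indicator measurableSet_Ioo]
        apply lintegral_mono
        intro y
        by_cases hy : y ∈ Set.Ioi (0 : ℝ)
        · rw [Set.indicator_of_mem hy]
          have hy' : 0 < y := hy
          by_cases hy1 : y < 1
          · rw [Set.indicator_of_mem (show y ∈ Set.Ioo (0 : ℝ) 1 from ⟨hy, hy1⟩)]
            calc _ ≤ (ENNReal.ofReal (C0 * q ^ (-α)) * ENNReal.ofReal (y ^ (-α))) * ENNReal.ofReal (y ^ (s - 1)) := by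
                  gcongr
                  refine le_trans (measure_mono ?_) (tailE q hq y hy)
                  intro x hx
                  exact lt_of_lt_of_le (show y < min (x / q) 1 from hx) (min_le_left _ _)
              _ = _ := by
                  rw [mul_assoc, ← ENNReal.ofReal_mul (by positivity), ← Real.rpow_add hy']
                  ring_nf
          · have : {a : ℝ | y < min (a / q) 1} = ∅ := by
              ext x
              simp only [Set.mem_ofPred_eq, Set.mem_empty_iff_false, iff_false, not_lt]
              exact (min_le_right _ _).trans (not_lt.1 hy1)
            rw [this]; simp
        · rw [Set.indicator_of_notMem hy]; exact zero_le
      · filter_upwards [hae2] with x hx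
        simp only [Pi.zero_apply]
        positivity
    have A2 : ∫⁻ x, ENNReal.ofReal ((if 1 < x / q then x / q else 0) ^ r) ∂ν ≤
        ENNReal.ofReal (C0 * q ^ (-α)) * (ENNReal.ofReal r * ((∫⁻ y in Set.Ioo (0 : ℝ) 1, ENNReal.ofReal (y ^ (r - 1))) +
      ∫⁻ y in Set.Ioi (1 : ℝ), ENNReal.ofReal (y ^ (r - 1 - α)))) := by
      rw [lintegral_rpow_eq_lintegral_meas_lt_mul ν (f := fun x => if 1 < x / q then x / q else 0) _ _ hr]
      · rw [mul_left_comm]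
        gcongr ENNReal.ofReal r * ?_
        rw [mul_add, ← lintegral_const_mul' _ _ ENNReal.ofReal_ne_top,
          ← lintegral_const_mul' _ _ ENNReal.ofReal_ne_top,
          ← lintegral_indicator measurableSet_Ioo, ← lintegral_indicator measurableSet_Ioi,
          ← lintegral_indicator measurableSet_Ioi]
        rw [← lintegral_add_left (by
          apply Measurable.indicator _ measurableSet_Ioo
          fun_prop)]
        apply lintegral_mono_ae
        have hne : ∀ᵐ y : ℝ, y ≠ 1 := by
          rw [ae_iff]; simp
        filter_upwards [hne] with y hyne
        by_cases hy : y ∈ Set.Ioi (0 : ℝ)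
        · rw [Set.indicator_of_mem hy]
          have hy' : 0 < y := hy
          rcases lt_or_gt_of_ne hyne with hy1 | hy1
          · rw [Set.indicator_of_mem (show y ∈ Set.Ioo (0 : ℝ) 1 from ⟨hy, hy1⟩)]
            refine le_trans ?_ le_self_add
            gcongr
            refine le_trans (measure_mono ?_) ((tailE q hq 1 one_pos).trans_eq (by simp))
            intro x hx
            have hx' : y < (if 1 < x / q then x / q else 0) := hx
            split_ifs at hx' with h
            · exact h
            · exact absurd hx' (not_lt.2 hy'.le)
          · rw [Set.indicator_of_mem (show y ∈ Set.Ioi (1 : ℝ) from hy1)]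
            refine le_trans ?_ le_add_self
            calc _ ≤ (ENNReal.ofReal (C0 * q ^ (-α)) * ENNReal.ofReal (y ^ (-α))) * ENNReal.ofReal (y ^ (r - 1)) := by
                  gcongr
                  refine le_trans (measure_mono ?_) (tailE q hq y hy)
                  intro x hx
                  have hx' : y < (if 1 < x / q then x / q else 0) := hx
                  split_ifs at hx' with h
                  · exact hx'
                  · exact absurd hx' (not_lt.2 hy'.le)
              _ = _ := by
                  rw [mul_assoc, ← ENNReal.ofReal_mul (by positivity), ← Real.rpow_add hy']
                  ring_nf
        · rw [Set.indicator_of_notMem hy]; exact zero_le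
      · filter_upwards [hae2] with x hx
        simp only [Pi.zero_apply]
        split_ifs <;> simp [hx]
      · apply Measurable.aemeasurable
        apply Measurable.ite _ (by fun_prop) (by fun_prop)
        exact measurableSet_lt (by fun_prop) (by fun_prop)
    calc _ ≤ ∫⁻ x, (ENNReal.ofReal ((min (x / q) 1) ^ s) + ENNReal.ofReal ((if 1 < x / q then x / q else 0) ^ r)) ∂ν := by
          apply lintegral_mono_ae
          filter_upwards [hae2] with x hx
          rw [← ENNReal.ofReal_add (by positivity) (by split_ifs <;> positivity)]
          exact ENNReal.ofReal_le_ofReal (gf_le_sum hr hx)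
      _ = _ := lintegral_add_left (by fun_prop) _
      _ ≤ _ := add_le_add A1 A2
      _ = _ := (mul_add _ _ _).symm
  refine ⟨C0 * (K.toReal + 1), by positivity, fun q hq => ?_⟩
  have hgm : Measurable (fun x => gf r s (x / q)) := (measurable_gf r s).comp (by fun_prop)
  have hg0 : ∀ᵐ x ∂ν, 0 ≤ gf r s (x / q) := by
    filter_upwards [hae] with x hx
    apply gf_nonneg
    have : 0 ≤ x := by linarith
    positivity
  have hfin : ENNReal.ofReal (C0 * q ^ (-α)) * K < ⊤ := ENNReal.mul_lt_top ENNReal.ofReal_lt_top hKt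
  constructor
  · refine ⟨hgm.aestronglyMeasurable, ?_⟩
    rw [hasFiniteIntegral_iff_ofReal hg0]
    exact (main q hq).trans_lt hfin
  · rw [integral_eq_lintegral_of_nonneg_ae hg0 hgm.aestronglyMeasurable]
    calc _ ≤ (ENNReal.ofReal (C0 * q ^ (-α)) * K).toReal := ENNReal.toReal_mono hfin.ne (main q hq)
      _ = C0 * q ^ (-α) * K.toReal := by
          rw [ENNReal.toReal_mul, ENNReal.toReal_ofReal (by positivity)]
      _ ≤ _ := by
          have : 0 ≤ C0 * q ^ (-α) := by positivity
          nlinarith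

end tails

/-! ## Probability estimates -/

section prob

variable {ν : Measure ℝ} [IsProbabilityMeasure ν]

lemma chernoff (n : ℕ) (X : ℝ → ℝ) (hX : Measurable X) {B M ε : ℝ} (hB : 0 < B)
    (h0 : ∀ x, 0 ≤ X x) (h1 : ∀ x, X x ≤ B) (hM0 : 0 ≤ M) (hM : n * ∫ x, X x ∂ν ≤ M)
    (hε : 0 < ε) (hε1 : ε ≤ 1) :
    (Measure.pi fun _ : Fin n => ν).real {w | (1 + ε) * M ≤ ∑ i, X (w i)} ≤
      Real.exp (-(ε ^ 2 * M / (4 * B))) := by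
  set θ : ℝ := ε / 2 with hθ
  have hθ0 : 0 < θ := by positivity
  have hθ1 : θ ≤ 1 := by linarith
  set t : ℝ := θ / B with ht
  have ht0 : 0 ≤ t := by positivity
  have htB : t * B = θ := by rw [ht]; field_simp
  have hXint : Integrable X ν :=
    Integrable.of_bound hX.aestronglyMeasurable B (Eventually.of_forall fun x => by
      rw [Real.norm_eq_abs, abs_of_nonneg (h0 x)]; exact h1 x)
  have hexpint : Integrable (fun x => Real.exp (t * X x)) ν := by
    apply Integrable.of_bound (by fun_prop) (Real.exp θ)
    refine Eventually.of_forall fun x => ?_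
    rw [Real.norm_eq_abs, abs_of_pos (Real.exp_pos _)]
    apply Real.exp_le_exp.2
    rw [← htB]
    exact mul_le_mul_of_nonneg_left (h1 x) ht0
  have hprod : ∀ w : Fin n → ℝ, Real.exp (t * ∑ i, X (w i)) = ∏ i, Real.exp (t * X (w i)) := by
    intro w
    rw [Finset.mul_sum, Real.exp_sum]
  have hint : Integrable (fun w : Fin n → ℝ => Real.exp (t * ∑ i, X (w i)))
      (Measure.pi fun _ : Fin n => ν) := by
    simp_rw [hprod]
    exact Integrable.fintype_prod (fun _ => hexpint)
  have hm := ProbabilityTheory.measure_ge_le_exp_mul_mgf (μ := Measure.pi fun _ : Fin n => ν)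
    (X := fun w => ∑ i, X (w i)) ((1 + ε) * M) ht0 hint
  refine hm.trans ?_
  have hexpθ : Real.exp θ ≤ 1 + θ + θ ^ 2 := by
    have := Real.abs_exp_sub_one_sub_id_le (x := θ) (by rw [abs_of_pos hθ0]; exact hθ1)
    have := (abs_le.1 this).2
    linarith
  have hone : ∫ x, Real.exp (t * X x) ∂ν ≤ Real.exp ((Real.exp θ - 1) / B * ∫ x, X x ∂ν) := by
    calc _ ≤ ∫ x, (1 + (Real.exp θ - 1) / B * X x) ∂ν := by
          apply integral_mono hexpint ((integrable_const _).add (hXint.const_mul _))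
          intro x
          show Real.exp (t * X x) ≤ 1 + (Real.exp θ - 1) / B * X x
          have hcx := convexOn_exp.2 (Set.mem_univ (0 : ℝ)) (Set.mem_univ θ)
            (show (0 : ℝ) ≤ 1 - X x / B by
              have : X x / B ≤ 1 := by rw [div_le_one hB]; exact h1 x
              linarith) (show (0 : ℝ) ≤ X x / B by have := h0 x; positivity) (by ring)
          simp only [smul_eq_mul, mul_zero, zero_add, Real.exp_zero, mul_one] at hcx
          have e1 : X x / B * θ = t * X x := by rw [ht]; ring
          rw [e1] at hcx
          calc _ ≤ _ := hcx
            _ = _ := by ring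
      _ = 1 + (Real.exp θ - 1) / B * ∫ x, X x ∂ν := by
          rw [integral_add (integrable_const _) (hXint.const_mul _), integral_const_mul]
          simp
      _ ≤ _ := by linarith [Real.add_one_le_exp ((Real.exp θ - 1) / B * ∫ x, X x ∂ν)]
  have hmgf : ProbabilityTheory.mgf (fun w : Fin n → ℝ => ∑ i, X (w i))
      (Measure.pi fun _ : Fin n => ν) t ≤ Real.exp ((Real.exp θ - 1) / B * M) := by
    rw [ProbabilityTheory.mgf]
    simp_rw [hprod]
    rw [integral_fintype_prod_eq_prod (f := fun _ x => Real.exp (t * X x))]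
    rw [Finset.prod_const, Finset.card_univ, Fintype.card_fin]
    calc _ ≤ (Real.exp ((Real.exp θ - 1) / B * ∫ x, X x ∂ν)) ^ n :=
          pow_le_pow_left₀ (integral_nonneg fun x => (Real.exp_pos _).le) hone n
      _ = Real.exp ((Real.exp θ - 1) / B * (n * ∫ x, X x ∂ν)) := by
          rw [← Real.exp_nat_mul]; ring_nf
      _ ≤ _ := by
          apply Real.exp_le_exp.2
          apply mul_le_mul_of_nonneg_left hM
          have : 0 ≤ Real.exp θ - 1 := by linarith [Real.add_one_le_exp θ]
          positivity
  calc _ ≤ Real.exp (-t * ((1 + ε) * M)) * Real.exp ((Real.exp θ - 1) / B * M) :=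
        mul_le_mul_of_nonneg_left hmgf (Real.exp_pos _).le
    _ = Real.exp (-t * ((1 + ε) * M) + (Real.exp θ - 1) / B * M) := (Real.exp_add _ _).symm
    _ ≤ _ := by
        apply Real.exp_le_exp.2
        have e : -t * ((1 + ε) * M) + (Real.exp θ - 1) / B * M
            = (Real.exp θ - 1 - θ * (1 + ε)) * (M / B) := by rw [ht]; ring
        have e2 : -(ε ^ 2 * M / (4 * B)) = (-(ε ^ 2 / 4)) * (M / B) := by ring
        rw [e, e2]
        apply mul_le_mul_of_nonneg_right _ (by positivity)
        rw [hθ] at hexpθ ⊢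
        nlinarith

lemma hub_count (n j : ℕ) (y : ℝ) :
    (Measure.pi fun _ : Fin n => ν).real
      {w | ∃ A : Finset (Fin n), A.card = j ∧ ∀ i ∈ A, y < w i} ≤
      (n * (ν (Set.Ioi y)).toReal) ^ j := by
  classical
  have e : {w : Fin n → ℝ | ∃ A : Finset (Fin n), A.card = j ∧ ∀ i ∈ A, y < w i} =
      ⋃ A ∈ Finset.powersetCard j (Finset.univ : Finset (Fin n)),
        Set.pi Set.univ (fun i => if i ∈ A then Set.Ioi y else Set.univ) := by
    ext w
    simp only [Set.mem_ofPred_eq, Finset.mem_powersetCard, Finset.subset_univ, true_and,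
      Set.mem_iUnion, exists_prop, Set.mem_pi, Set.mem_univ, forall_true_left]
    refine exists_congr fun A => and_congr Iff.rfl (forall_congr' fun i => ?_)
    by_cases hi : i ∈ A <;> simp [hi]
  rw [e]
  refine (measureReal_biUnion_finset_le _ _).trans ?_
  have hA : ∀ A ∈ Finset.powersetCard j (Finset.univ : Finset (Fin n)),
      (Measure.pi fun _ : Fin n => ν).real
        (Set.pi Set.univ (fun i => if i ∈ A then Set.Ioi y else Set.univ)) =
      (ν (Set.Ioi y)).toReal ^ j := by
    intro A hA
    rw [Measure.real, Measure.pi_pi, ENNReal.toReal_prod]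
    have : ∀ i, (ν (if i ∈ A then Set.Ioi y else Set.univ)).toReal
        = if i ∈ A then (ν (Set.Ioi y)).toReal else 1 := by
      intro i; split_ifs <;> simp
    simp_rw [this]
    rw [Finset.prod_ite_mem, Finset.univ_inter, Finset.prod_const,
      (Finset.mem_powersetCard.1 hA).2]
  rw [Finset.sum_congr rfl hA, Finset.sum_const, Finset.card_powersetCard, Finset.card_univ,
    Fintype.card_fin, nsmul_eq_mul, mul_pow]
  gcongr
  exact_mod_cast Nat.choose_le_pow n j

lemma prod_ite_card {n j : ℕ} (A : Finset (Fin n)) (hA : A.card = j) (p c : ℝ) :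
    ∏ i : Fin n, (if i ∈ A then p else c) = p ^ j * c ^ (n - j) := by
  classical
  rw [Finset.prod_ite]
  simp only [Finset.prod_const, Finset.filter_mem_eq_inter, Finset.univ_inter, hA]
  congr 2
  have : (Finset.univ.filter (fun i => i ∉ A)) = Aᶜ := by ext; simp
  rw [this, Finset.card_compl, hA, Fintype.card_fin]

lemma hub_lower (n j : ℕ) (hj : j ≤ n) (y : ℝ) (Q : Set ℝ) (hQ : MeasurableSet Q)
    (b : ℝ) :
    (n.choose j : ℝ) * (ν (Set.Ioi y)).toReal ^ j *
      (1 - n * (ν (Set.Ioi y)).toReal - Real.exp (b - (n - j) * (ν Q).toReal / 2)) ≤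
    (Measure.pi fun _ : Fin n => ν).real
      {w | (∃ A : Finset (Fin n), A.card = j ∧ ∀ i ∈ A, y < w i) ∧
        b ≤ ∑ i, Q.indicator (fun _ => (1 : ℝ)) (w i)} := by
  classical
  set p := (ν (Set.Ioi y)).toReal with hp
  set q := (ν Q).toReal with hq
  have hp0 : 0 ≤ p := ENNReal.toReal_nonneg
  have hp1 : p ≤ 1 := measureReal_le_one
  set P := (Measure.pi fun _ : Fin n => ν) with hP
  let Bs : Finset (Fin n) → Fin n → Set ℝ := fun A i => if i ∈ A then Set.Ioi y else Set.Iic y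
  have hBm : ∀ A i, MeasurableSet (Bs A i) := by
    intro A i; simp only [Bs]; split_ifs <;> measurability
  let E : Finset (Fin n) → Set (Fin n → ℝ) := fun A => Set.pi Set.univ (Bs A)
  have hEm : ∀ A, MeasurableSet (E A) := fun A => MeasurableSet.univ_pi (hBm A)
  let N : (Fin n → ℝ) → ℝ := fun w => ∑ i, Q.indicator (fun _ => (1 : ℝ)) (w i)
  have hNm : Measurable N := by
    apply Finset.measurable_sum
    intro i _
    exact (measurable_const.indicator hQ).comp (measurable_pi_apply i)
  have hDm : MeasurableSet {w | b ≤ N w} := measurableSet_le measurable_const hNm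
  have hsub : (⋃ A ∈ Finset.powersetCard j (Finset.univ : Finset (Fin n)), E A ∩ {w | b ≤ N w}) ⊆
      {w | (∃ A : Finset (Fin n), A.card = j ∧ ∀ i ∈ A, y < w i) ∧ b ≤ N w} := by
    intro w hw
    simp only [Set.mem_iUnion, exists_prop] at hw
    obtain ⟨A, hA, hw1, hw2⟩ := hw
    refine ⟨⟨A, (Finset.mem_powersetCard.1 hA).2, fun i hi => ?_⟩, hw2⟩
    have := hw1 i (Set.mem_univ i)
    simpa [Bs, hi] using this
  have hdisj : Set.PairwiseDisjoint
      (↑(Finset.powersetCard j (Finset.univ : Finset (Fin n))) : Set (Finset (Fin n)))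
      (fun A => E A ∩ {w | b ≤ N w}) := by
    intro A _ A' _ hne
    rw [Function.onFun, Set.disjoint_left]
    intro w h1 h2
    apply hne
    ext i
    have a1 := h1.1 i (Set.mem_univ i)
    have a2 := h2.1 i (Set.mem_univ i)
    by_cases c1 : i ∈ A <;> by_cases c2 : i ∈ A' <;> simp [Bs, c1, c2] at a1 a2 ⊢
    · exact absurd a1 (not_lt.2 a2)
    · exact absurd a2 (not_lt.2 a1)
  refine le_trans ?_ (measureReal_mono hsub)
  rw [measureReal_biUnion_finset hdisj (fun A _ => (hEm A).inter hDm)]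
  have key : ∀ A ∈ Finset.powersetCard j (Finset.univ : Finset (Fin n)),
      p ^ j * (1 - n * p - Real.exp (b - (n - j) * q / 2)) ≤ P.real (E A ∩ {w | b ≤ N w}) := by
    intro A hA
    have hcard := (Finset.mem_powersetCard.1 hA).2
    have h1 : P.real (E A) = p ^ j * (1 - p) ^ (n - j) := by
      rw [hP, Measure.real, Measure.pi_pi, ENNReal.toReal_prod]
      have : ∀ i, (ν (Bs A i)).toReal = if i ∈ A then p else 1 - p := by
        intro i
        simp only [Bs]
        split_ifs
        · rfl
        · have := probReal_compl_eq_one_sub (μ := ν) (measurableSet_Ioi (a := y))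
          rw [Set.compl_Ioi] at this
          exact this
      simp_rw [this]
      exact prod_ite_card A hcard _ _
    have h2 : P.real (E A ∩ {w | b ≤ N w}ᶜ) ≤ p ^ j * Real.exp (b - (n - j) * q / 2) := by
      let hh : Fin n → ℝ → ℝ := fun i =>
        (Bs A i).indicator (fun x => Real.exp (-(Q.indicator (fun _ => (1 : ℝ)) x)))
      have hexpm : Measurable (fun x => Real.exp (-(Q.indicator (fun _ => (1 : ℝ)) x))) :=
        Real.measurable_exp.comp (measurable_const.indicator hQ).neg
      have hle1 : ∀ x, Real.exp (-(Q.indicator (fun _ => (1 : ℝ)) x)) ≤ 1 := by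
        intro x
        rw [Real.exp_le_one_iff, neg_nonpos]
        exact Set.indicator_nonneg (fun _ _ => zero_le_one) x
      have hexpi : Integrable (fun x => Real.exp (-(Q.indicator (fun _ => (1 : ℝ)) x))) ν := by
        apply Integrable.of_bound hexpm.aestronglyMeasurable 1
        refine Eventually.of_forall fun x => ?_
        rw [Real.norm_eq_abs, abs_of_pos (Real.exp_pos _)]
        exact hle1 x
      have hhi : ∀ i, Integrable (hh i) ν := fun i => hexpi.indicator (hBm A i)
      have hh0 : ∀ i x, 0 ≤ hh i x := fun i x => Set.indicator_nonneg (fun _ _ => (Real.exp_pos _).le) x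
      have hpt : ∀ w, (E A ∩ {w | b ≤ N w}ᶜ).indicator (fun _ => (1 : ℝ)) w ≤
          Real.exp b * ∏ i, hh i (w i) := by
        intro w
        by_cases hw : w ∈ E A ∩ {w | b ≤ N w}ᶜ
        · rw [Set.indicator_of_mem hw]
          have : ∏ i, hh i (w i) = Real.exp (-(N w)) := by
            simp only [N]
            rw [← Finset.sum_neg_distrib, Real.exp_sum]
            apply Finset.prod_congr rfl
            intro i _
            exact Set.indicator_of_mem (hw.1 i (Set.mem_univ i)) _
          rw [this, ← Real.exp_add]
          apply Real.one_le_exp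
          have : ¬ (b ≤ N w) := hw.2
          linarith
        · rw [Set.indicator_of_notMem hw]
          have : 0 ≤ ∏ i, hh i (w i) := Finset.prod_nonneg fun i _ => hh0 i _
          positivity
      have hint : Integrable (fun w : Fin n → ℝ => ∏ i, hh i (w i)) P := Integrable.fintype_prod hhi
      have hI1 : ∀ i, ∫ x, hh i x ∂ν ≤ if i ∈ A then p else Real.exp (-(q / 2)) := by
        intro i
        split_ifs with hi
        · calc _ ≤ ∫ x, (Set.Ioi y).indicator (fun _ => (1 : ℝ)) x ∂ν := by
                apply integral_mono (hhi i) ((integrable_const _).indicator measurableSet_Ioi)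
                intro x
                simp only [hh, Bs, if_pos hi]
                exact Set.indicator_le_indicator (hle1 x)
            _ = p := by rw [integral_indicator measurableSet_Ioi]; simp [Measure.real, hp]
        · calc _ ≤ ∫ x, (1 - 1 / 2 * Q.indicator (fun _ => (1 : ℝ)) x) ∂ν := by
                apply integral_mono (hhi i) ((integrable_const _).sub
                  (((integrable_const _).indicator hQ).const_mul _))
                intro x
                refine (Set.indicator_le_self' (fun _ _ => (Real.exp_pos _).le) x).trans ?_
                show _ ≤ 1 - 1 / 2 * Q.indicator (fun _ => (1 : ℝ)) x
                by_cases hx : x ∈ Q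
                · simp only [Set.indicator_of_mem hx]
                  have := Real.exp_neg_one_lt_d9
                  linarith
                · simp [Set.indicator_of_notMem hx]
            _ = 1 - 1 / 2 * q := by
                rw [integral_sub (integrable_const _) (((integrable_const _).indicator hQ).const_mul _),
                  integral_const_mul, integral_indicator hQ]
                simp [Measure.real, hq]
            _ ≤ _ := by linarith [Real.add_one_le_exp (-(q / 2))]
      calc P.real (E A ∩ {w | b ≤ N w}ᶜ)
          = ∫ w, (E A ∩ {w | b ≤ N w}ᶜ).indicator (fun _ => (1 : ℝ)) w ∂P := by
            rw [integral_indicator ((hEm A).inter hDm.compl)]; simp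
        _ ≤ ∫ w, Real.exp b * ∏ i, hh i (w i) ∂P :=
            integral_mono ((integrable_const _).indicator ((hEm A).inter hDm.compl))
              (hint.const_mul _) hpt
        _ = Real.exp b * ∏ i, ∫ x, hh i x ∂ν := by
            rw [integral_const_mul, hP, integral_fintype_prod_eq_prod]
        _ ≤ Real.exp b * ∏ i, (if i ∈ A then p else Real.exp (-(q / 2))) := by
            gcongr with i
            · intro i _; exact integral_nonneg (hh0 i)
            · exact hI1 i
        _ = p ^ j * Real.exp (b - (n - j) * q / 2) := by
            rw [prod_ite_card A hcard, ← Real.exp_nat_mul, mul_left_comm, ← Real.exp_add,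
              Nat.cast_sub hj]
            ring_nf
    have h3 : P.real (E A) = P.real (E A ∩ {w | b ≤ N w}) + P.real (E A ∩ {w | b ≤ N w}ᶜ) := by
      rw [← Set.sdiff_eq]
      exact (measureReal_inter_add_sdiff hDm).symm
    have h4 : 1 - n * p ≤ (1 - p) ^ (n - j) := by
      have := one_add_mul_le_pow (a := -p) (by linarith) (n - j)
      have h5 : ((n - j : ℕ) : ℝ) ≤ n := by exact_mod_cast Nat.sub_le n j
      have h6 := mul_le_mul_of_nonneg_right h5 hp0
      have h7 : (1 + -p) = 1 - p := by ring
      rw [h7] at this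
      linarith
    have h5 : p ^ j * (1 - n * p) ≤ p ^ j * (1 - p) ^ (n - j) :=
      mul_le_mul_of_nonneg_left h4 (by positivity)
    linarith
  calc _ = ∑ A ∈ Finset.powersetCard j (Finset.univ : Finset (Fin n)),
        p ^ j * (1 - n * p - Real.exp (b - (n - j) * q / 2)) := by
        rw [Finset.sum_const, Finset.card_powersetCard, Finset.card_univ, Fintype.card_fin,
          nsmul_eq_mul, mul_assoc]
    _ ≤ _ := Finset.sum_le_sum key

lemma exp_decay {c θ : ℝ} (hc : 0 < c) (hθ : 0 < θ) (L : ℝ) :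
    ∀ᶠ n : ℕ in atTop, Real.exp (-(c * (n : ℝ) ^ θ)) ≤ (n : ℝ) ^ (-L) := by
  have h1 := tendsto_rpow_mul_exp_neg_mul_atTop_nhds_zero (L / θ) c hc
  have h2 : Tendsto (fun n : ℕ => (n : ℝ) ^ θ) atTop atTop :=
    (tendsto_rpow_atTop hθ).comp tendsto_natCast_atTop_atTop
  have h3 := (h1.comp h2).eventually (gt_mem_nhds (show (0 : ℝ) < 1 by norm_num))
  filter_upwards [h3, eventually_gt_atTop 0] with n hn hn0
  have hn' : (0 : ℝ) < n := by exact_mod_cast hn0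
  simp only [Function.comp] at hn
  rw [← Real.rpow_mul hn'.le, mul_div_cancel₀ _ hθ.ne'] at hn
  have hp : 0 < (n : ℝ) ^ L := by positivity
  rw [Real.rpow_neg hn'.le, ← one_div, le_div_iff₀ hp]
  have : -(c * (n : ℝ) ^ θ) = -c * (n : ℝ) ^ θ := by ring
  rw [this]
  linarith

end prob

/-! ## Asymptotics of the expected clique count -/

/-- Edge probabilities. -/
def vv {ι : Type*} (D : ℝ) (w : ι → ℝ) (i j : ι) : ℝ := min (w i * w j / D) 1

lemma vv_symm {ι : Type*} (D : ℝ) (w : ι → ℝ) (i j : ι) : vv D w i j = vv D w j i := by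
  simp [vv, mul_comm]

lemma vv_le_one {ι : Type*} (D : ℝ) (w : ι → ℝ) (i j : ι) : vv D w i j ≤ 1 := min_le_right _ _

lemma vv_nonneg {ι : Type*} {D : ℝ} (hD : 0 < D) {w : ι → ℝ} (hw : ∀ i, 0 < w i) (i j : ι) :
    0 ≤ vv D w i j := by
  have := hw i; have := hw j
  unfold vv; positivity

lemma vv_sqrt {ι : Type*} {D : ℝ} (hD : 0 < D) (w : ι → ℝ) :
    vv D w = fun i j => min (w i / √D * (w j / √D)) 1 := by
  funext i j
  have : w i / √D * (w j / √D) = w i * w j / D := by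
    rw [div_mul_div_comm, Real.mul_self_sqrt hD.le]
  rw [this, vv]

lemma fDef_eq_pp (μ : ℝ) (n k : ℕ) (x : Fin k → ℝ) :
    fDef μ n k x = pp (vv (μ * n) x) Finset.univ := by
  simp [fDef, pp, vv]

lemma Cful_eq_pp (μ : ℝ) (k n : ℕ) (w : Fin n → ℝ) :
    Cful μ k n w = ∑ S ∈ Finset.powersetCard k (Finset.univ : Finset (Fin n)),
      pp (vv (μ * n) w) S := rfl

lemma measurable_fDef (μ : ℝ) (n k : ℕ) : Measurable (fDef μ n k) := by
  unfold fDef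
  fun_prop

section setup

set_option linter.unusedSectionVars false

variable {ν : Measure ℝ} [IsProbabilityMeasure ν] {α : ℝ}

lemma ae_one_le (hsupp : ν (Set.Iio 1) = 0) : ∀ᵐ x ∂ν, 1 ≤ x := by
  rw [ae_iff]
  convert hsupp using 2
  ext x; simp

lemma ae_pi_one_le (hsupp : ν (Set.Iio 1) = 0) (n : ℕ) :
    ∀ᵐ w ∂(Measure.pi fun _ : Fin n => ν), ∀ i, 1 ≤ w i := by
  rw [ae_all_iff]
  intro i
  exact (Measure.tendsto_eval_ae_ae (μ := fun _ : Fin n => ν) (i := i)).eventually (ae_one_le hsupp)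

lemma mExp_eq (hsupp : ν (Set.Iio 1) = 0) (μ : ℝ) (k n : ℕ) :
    mExp ν μ k n = (n.choose k : ℝ) * ∫ x, fDef μ n k x ∂(Measure.pi fun _ : Fin k => ν) := by
  unfold mExp
  rw [Measure.restrict_eq_self_of_ae_mem]
  filter_upwards [ae_pi_one_le hsupp k] with x hx
  exact fun i _ => hx i

lemma twoInt_eq (hsupp : ν (Set.Iio 1) = 0) (μ : ℝ) (k n : ℕ) (c : ℝ) :
    twoInt ν μ k n c = ∫ x, ∫ y, fDef μ n k (hubVec k x y c) ∂ν ∂ν := by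
  unfold twoInt
  rw [Measure.restrict_eq_self_of_ae_mem]
  filter_upwards [ae_one_le hsupp] with x hx
  simpa using hx

lemma fDef_bounds {μ : ℝ} (hμ : 0 < μ) {n k : ℕ} (hn : 0 < n) {x : Fin k → ℝ} (hx : ∀ i, 0 < x i) :
    0 ≤ fDef μ n k x ∧ fDef μ n k x ≤ 1 := by
  have hD : 0 < μ * n := by positivity
  rw [fDef_eq_pp]
  exact ⟨pp_nonneg _ (vv_nonneg hD hx) _, pp_le_one _ (vv_nonneg hD hx) (vv_le_one _ _) _⟩

lemma fDef_integrable (hsupp : ν (Set.Iio 1) = 0) {μ : ℝ} (hμ : 0 < μ) {n k : ℕ} (hn : 0 < n) :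
    Integrable (fDef μ n k) (Measure.pi fun _ : Fin k => ν) := by
  apply Integrable.of_bound (measurable_fDef μ n k).aestronglyMeasurable 1
  filter_upwards [ae_pi_one_le hsupp k] with x hx
  have := fDef_bounds hμ hn (fun i => lt_of_lt_of_le one_pos (hx i))
  rw [Real.norm_eq_abs, abs_of_nonneg this.1]
  exact this.2

lemma int_f_lower (hsupp : ν (Set.Iio 1) = 0) {μ : ℝ} (hμ : 0 < μ) {n k : ℕ} (hn : 0 < n) :
    (ν (Set.Ioi √(μ * n))).toReal ^ k ≤ ∫ x, fDef μ n k x ∂(Measure.pi fun _ : Fin k => ν) := by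
  have hD : 0 < μ * n := by positivity
  set Q : Set (Fin k → ℝ) := Set.univ.pi fun _ => Set.Ioi √(μ * n)
  have hQ : MeasurableSet Q := MeasurableSet.univ_pi fun _ => measurableSet_Ioi
  have e : (ν (Set.Ioi √(μ * n))).toReal ^ k =
      ∫ x, Q.indicator (fun _ => (1 : ℝ)) x ∂(Measure.pi fun _ : Fin k => ν) := by
    rw [integral_indicator hQ]
    simp [Measure.real, Q, Measure.pi_pi]
  rw [e]
  apply integral_mono_ae ((integrable_const _).indicator hQ) (fDef_integrable hsupp hμ hn)
  filter_upwards [ae_pi_one_le hsupp k] with x hx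
  by_cases h : x ∈ Q
  · rw [Set.indicator_of_mem h]
    have h' : ∀ i, √(μ * n) < x i := by simpa [Q] using h
    unfold fDef
    apply le_of_eq
    symm
    apply Finset.prod_eq_one
    intro p _
    apply min_eq_right
    rw [one_le_div hD]
    calc μ * n = √(μ * n) * √(μ * n) := (Real.mul_self_sqrt hD.le).symm
      _ ≤ _ := mul_le_mul (h' _).le (h' _).le (Real.sqrt_nonneg _)
        ((Real.sqrt_nonneg _).trans (h' _).le)
  · rw [Set.indicator_of_notMem h]
    exact (fDef_bounds hμ hn (fun i => lt_of_lt_of_le one_pos (hx i))).1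

lemma int_f_upper (hα1 : 1 < α) (hα2 : α < 2) (hsupp : ν (Set.Iio 1) = 0)
    (htail : Tendsto (fun x : ℝ => x ^ α * (ν (Set.Ioi x)).toReal) atTop (nhds 1))
    {μ : ℝ} (hμ : 0 < μ) {k : ℕ} (hk : 3 ≤ k) :
    ∃ C : ℝ, 0 < C ∧ ∀ n : ℕ, 0 < n →
      ∫ x, fDef μ n k x ∂(Measure.pi fun _ : Fin k => ν) ≤ (C * √(μ * n) ^ (-α)) ^ k := by
  obtain ⟨C, hC, h⟩ := gf_moment (ν := ν) (by linarith : 0 < α) hsupp htail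
    (r := α - (2 - α) / 6) (s := α + (2 - α) / 6) (by linarith) (by linarith) (by linarith)
  refine ⟨C, hC, fun n hn => ?_⟩
  have hD : 0 < μ * n := by positivity
  have hq : 0 < √(μ * n) := Real.sqrt_pos.2 hD
  obtain ⟨hi, hb⟩ := h _ hq
  set g := fun x => gf (α - (2 - α) / 6) (α + (2 - α) / 6) (x / √(μ * n)) with hg
  have hpi : Integrable (fun x : Fin k → ℝ => ∏ i, g (x i)) (Measure.pi fun _ : Fin k => ν) :=
    Integrable.fintype_prod fun _ => hi
  calc _ ≤ ∫ x : Fin k → ℝ, ∏ i, g (x i) ∂(Measure.pi fun _ : Fin k => ν) := by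
        apply integral_mono_ae (fDef_integrable hsupp hμ hn) hpi
        filter_upwards [ae_pi_one_le hsupp k] with x hx
        rw [fDef_eq_pp, vv_sqrt hD]
        apply pp_le_prod (by linarith) (by linarith) (by linarith) (by linarith)
          (fun i => x i / √(μ * n))
        · intro i
          have := hx i
          positivity
        · simpa using hk
    _ = (∫ x, g x ∂ν) ^ k := by
        rw [integral_fintype_prod_eq_prod (f := fun _ x => g x)]
        simp
    _ ≤ _ := by
        apply pow_le_pow_left₀ _ hb
        apply integral_nonneg_of_ae
        filter_upwards [ae_one_le hsupp] with x hx
        apply gf_nonneg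
        positivity

lemma sqrt_rpow {μ : ℝ} (hμ : 0 < μ) (n : ℕ) (α : ℝ) :
    √(μ * n) ^ (-α) = μ ^ (-α / 2) * (n : ℝ) ^ (-α / 2) := by
  rw [Real.sqrt_eq_rpow, ← Real.rpow_mul (by positivity), Real.mul_rpow hμ.le (by positivity)]
  ring_nf

lemma choose_lower (k : ℕ) : ∃ c : ℝ, 0 < c ∧ ∀ᶠ n : ℕ in atTop,
    c * (n : ℝ) ^ k ≤ (n.choose k : ℝ) := by
  refine ⟨1 / (2 ^ k * k.factorial), by positivity, ?_⟩
  filter_upwards [eventually_ge_atTop (2 * k)] with n hn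
  have h := Nat.pow_le_choose (α := ℝ) k n
  refine le_trans ?_ h
  have h2 : (n : ℝ) / 2 ≤ ((n + 1 - k : ℕ) : ℝ) := by
    rw [div_le_iff₀ (by norm_num)]
    have : n ≤ (n + 1 - k) * 2 := by omega
    exact_mod_cast this
  calc _ = ((n : ℝ) / 2) ^ k / k.factorial := by rw [div_pow]; field_simp
    _ ≤ _ := by push_cast at h2 ⊢; gcongr

lemma tendsto_sqrt_mu {μ : ℝ} (hμ : 0 < μ) : Tendsto (fun n : ℕ => √(μ * n)) atTop atTop :=
  Real.tendsto_sqrt_atTop.comp (tendsto_natCast_atTop_atTop.const_mul_atTop hμ)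

lemma mExp_bounds (hα1 : 1 < α) (hα2 : α < 2) (hsupp : ν (Set.Iio 1) = 0)
    (htail : Tendsto (fun x : ℝ => x ^ α * (ν (Set.Ioi x)).toReal) atTop (nhds 1))
    {μ : ℝ} (hμ : 0 < μ) {k : ℕ} (hk : 3 ≤ k) :
    ∃ c C : ℝ, 0 < c ∧ 0 < C ∧ ∀ᶠ n : ℕ in atTop,
      c * ((n : ℝ) ^ (1 - α / 2)) ^ k ≤ mExp ν μ k n ∧
      mExp ν μ k n ≤ C * ((n : ℝ) ^ (1 - α / 2)) ^ k := by
  obtain ⟨C, hC, hCb⟩ := int_f_upper hα1 hα2 hsupp htail hμ hk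
  obtain ⟨c0, hc0, hc⟩ := choose_lower k
  have hm : 0 < μ ^ (-α / 2) := by positivity
  refine ⟨c0 * (1 / 2 * μ ^ (-α / 2)) ^ k, (C * μ ^ (-α / 2)) ^ k, by positivity, by positivity, ?_⟩
  filter_upwards [hc, (tendsto_sqrt_mu hμ).eventually (tail_lower htail), eventually_gt_atTop 0]
    with n h1 h2 hn
  have hn' : (0 : ℝ) < n := by exact_mod_cast hn
  have e : (n : ℝ) ^ (1 - α / 2) = n * (n : ℝ) ^ (-α / 2) := by
    rw [← Real.rpow_one_add' hn'.le (by linarith)]; ring_nf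
  rw [mExp_eq hsupp, e]
  rw [sqrt_rpow hμ] at h2
  have h3 := int_f_lower (k := k) hsupp hμ hn
  have h4 := hCb n hn
  rw [sqrt_rpow hμ] at h4
  have hI0 : 0 ≤ (ν (Set.Ioi √(μ * n))).toReal ^ k := by positivity
  constructor
  · calc _ = (c0 * (n : ℝ) ^ k) * (1 / 2 * (μ ^ (-α / 2) * (n : ℝ) ^ (-α / 2))) ^ k := by
          simp only [mul_pow]; ring
      _ ≤ (c0 * (n : ℝ) ^ k) * (ν (Set.Ioi √(μ * n))).toReal ^ k := by gcongr
      _ ≤ _ := by gcongr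
  · have hch : (n.choose k : ℝ) ≤ (n : ℝ) ^ k := by exact_mod_cast Nat.choose_le_pow n k
    calc _ ≤ (n : ℝ) ^ k * (C * (μ ^ (-α / 2) * (n : ℝ) ^ (-α / 2))) ^ k := by
          apply mul_le_mul hch h4 (hI0.trans h3) (by positivity)
      _ = _ := by simp only [mul_pow]; ring

end setup

/-! ## The hub size -/

lemma pp_hub {ι : Type*} [LinearOrder ι] [Fintype ι] (v : ι → ι → ℝ) (hs : ∀ i j, v i j = v j i)
    {S : Finset ι} {x y : ι} (hx : x ∈ S) (hy : y ∈ S) (hxy : x ≠ y)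
    (h : ∀ i ∈ S, ∀ j ∈ S, i ≠ j → ¬ (i = x ∧ j = y) → ¬ (i = y ∧ j = x) → v i j = 1) :
    pp v S = v x y := by
  wlog hlt : x < y generalizing x y with H
  · rw [hs x y]
    exact H hy hx hxy.symm (fun i hi j hj hij h1 h2 => h i hi j hj hij h2 h1)
      (lt_of_le_of_ne (not_lt.1 hlt) hxy.symm)
  · unfold pp
    rw [Finset.prod_eq_single (x, y)]
    · rintro ⟨i, j⟩ hp hne
      simp only [Finset.mem_filter, Finset.mem_univ, true_and] at hp
      apply h i hp.1 j hp.2.1 hp.2.2.ne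
      · rintro ⟨rfl, rfl⟩; exact hne rfl
      · rintro ⟨rfl, rfl⟩; exact absurd hp.2.2 (not_lt.2 hlt.le)
    · intro hp
      exact absurd (by simp [hx, hy, hlt]) hp

/-- Truncated quadratic function. -/
def phi (t x : ℝ) : ℝ := t * gf 1 2 (x / t)

lemma phi_eq {t x : ℝ} (ht : 0 < t) : phi t x = x * min (x / t) 1 := by
  unfold phi gf
  split_ifs with h
  · rw [min_eq_left h]
    rw [show (2 : ℝ) = ((2 : ℕ) : ℝ) by norm_num, Real.rpow_natCast]
    field_simp
  · rw [min_eq_right (not_le.1 h).le, Real.rpow_one]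
    field_simp

lemma phi_nonneg {t x : ℝ} (ht : 0 < t) (hx : 0 ≤ x) : 0 ≤ phi t x := by
  rw [phi_eq ht]; positivity

/-- Triangle containing a vertex of weight at most `D / t`. -/
lemma tri_le {D t x y c : ℝ} (hD : 0 < D) (ht : 0 < t) (hx : 0 < x) (hy : 0 < y)
    (hc : 0 < c) (hct : c ≤ D / t) :
    min (x * y / D) 1 * min (x * c / D) 1 * min (y * c / D) 1 ≤ 1 / D * phi t x * phi t y := by
  have hle : ∀ z, 0 < z → min (z * c / D) 1 ≤ min (z / t) 1 := by
    intro z hz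
    apply min_le_min_right
    calc z * c / D ≤ z * (D / t) / D := by gcongr
      _ = z / t := by field_simp
  calc _ ≤ (x * y / D) * min (x / t) 1 * min (y / t) 1 := by
        apply mul_le_mul (mul_le_mul (min_le_left _ _) (hle x hx) (by positivity) (by positivity))
          (hle y hy) (by positivity) (by positivity)
    _ = _ := by rw [phi_eq ht, phi_eq ht]; ring

lemma measurable_phi (t : ℝ) : Measurable (phi t) := by
  unfold phi
  exact ((measurable_gf 1 2).comp (measurable_id.div_const t)).const_mul t

section hub

set_option linter.unusedSectionVars false
variable {ν : Measure ℝ} [IsProbabilityMeasure ν] {α : ℝ}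

lemma phi_moment (hα1 : 1 < α) (hα2 : α < 2) (hsupp : ν (Set.Iio 1) = 0)
    (htail : Tendsto (fun x : ℝ => x ^ α * (ν (Set.Ioi x)).toReal) atTop (nhds 1)) :
    ∃ C : ℝ, 0 < C ∧ ∀ t : ℝ, 0 < t →
      Integrable (phi t) ν ∧ ∫ x, phi t x ∂ν ≤ C * t ^ (1 - α) := by
  obtain ⟨C, hC, h⟩ := gf_moment (ν := ν) (by linarith : 0 < α) hsupp htail
    (r := 1) (s := 2) (by linarith) (by linarith) (by linarith)
  refine ⟨C, hC, fun t ht => ?_⟩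
  obtain ⟨hi, hb⟩ := h t ht
  refine ⟨hi.const_mul t, ?_⟩
  unfold phi
  rw [integral_const_mul]
  calc _ ≤ t * (C * t ^ (-α)) := by gcongr
    _ = _ := by
      rw [sub_eq_add_neg, Real.rpow_add ht, Real.rpow_one]; ring

lemma measurable_hub (μ : ℝ) (n k : ℕ) (c : ℝ) :
    Measurable (fun z : ℝ × ℝ => fDef μ n k (hubVec k z.1 z.2 c)) := by
  apply (measurable_fDef μ n k).comp
  rw [measurable_pi_iff]
  intro i
  unfold hubVec
  split_ifs <;> fun_prop

lemma ae_prod_one_le (hsupp : ν (Set.Iio 1) = 0) : ∀ᵐ z ∂(ν.prod ν), 1 ≤ z.1 ∧ 1 ≤ z.2 :=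
  (Measure.quasiMeasurePreserving_fst.ae (ae_one_le hsupp)).and
    (Measure.quasiMeasurePreserving_snd.ae (ae_one_le hsupp))

lemma hub_pos {k : ℕ} {x y c : ℝ} (hx : 1 ≤ x) (hy : 1 ≤ y) (hc : 0 < c) (i : Fin k) :
    0 < hubVec k x y c i := by
  unfold hubVec
  split_ifs <;> linarith

lemma hub_integrable (hsupp : ν (Set.Iio 1) = 0) {μ : ℝ} (hμ : 0 < μ) {n : ℕ} (k : ℕ) (hn : 0 < n)
    {c : ℝ} (hc : 0 < c) :
    Integrable (fun z : ℝ × ℝ => fDef μ n k (hubVec k z.1 z.2 c)) (ν.prod ν) := by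
  apply Integrable.of_bound (measurable_hub μ n k c).aestronglyMeasurable 1
  filter_upwards [ae_prod_one_le hsupp] with z hz
  have := fDef_bounds hμ hn (hub_pos (k := k) hz.1 hz.2 hc)
  rw [Real.norm_eq_abs, abs_of_nonneg this.1]
  exact this.2

lemma twoInt_prod (hsupp : ν (Set.Iio 1) = 0) {μ : ℝ} (hμ : 0 < μ) {n : ℕ} (k : ℕ) (hn : 0 < n)
    {c : ℝ} (hc : 0 < c) :
    twoInt ν μ k n c = ∫ z, fDef μ n k (hubVec k z.1 z.2 c) ∂(ν.prod ν) := by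
  rw [twoInt_eq hsupp, integral_prod _ (hub_integrable hsupp hμ k hn hc)]

lemma twoInt_le (hα1 : 1 < α) (hα2 : α < 2) (hsupp : ν (Set.Iio 1) = 0)
    (htail : Tendsto (fun x : ℝ => x ^ α * (ν (Set.Ioi x)).toReal) atTop (nhds 1))
    {μ : ℝ} (hμ : 0 < μ) {k : ℕ} (hk : 3 ≤ k) :
    ∃ C : ℝ, 0 < C ∧ ∀ n : ℕ, 0 < n → ∀ t c : ℝ, 0 < t → 0 < c → c ≤ μ * n / t →
      twoInt ν μ k n c ≤ 1 / (μ * n) * (C * t ^ (1 - α)) ^ 2 := by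
  obtain ⟨C, hC, h⟩ := phi_moment hα1 hα2 hsupp htail
  refine ⟨C, hC, fun n hn t c ht hc hct => ?_⟩
  have hD : 0 < μ * n := by positivity
  obtain ⟨hi, hb⟩ := h t ht
  rw [twoInt_prod hsupp hμ k hn hc]
  have hI0 : 0 ≤ ∫ x, phi t x ∂ν := by
    apply integral_nonneg_of_ae
    filter_upwards [ae_one_le hsupp] with x hx
    exact phi_nonneg ht (by linarith)
  calc _ ≤ ∫ z : ℝ × ℝ, 1 / (μ * n) * (phi t z.1 * phi t z.2) ∂(ν.prod ν) := by
        apply integral_mono_ae (hub_integrable hsupp hμ k hn hc) ((hi.mul_prod hi).const_mul _)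
        filter_upwards [ae_prod_one_le hsupp] with z hz
        have hpos := hub_pos (k := k) hz.1 hz.2 hc
        rw [fDef_eq_pp]
        let i0 : Fin k := ⟨0, by omega⟩
        let i1 : Fin k := ⟨1, by omega⟩
        let i2 : Fin k := ⟨2, by omega⟩
        calc _ ≤ pp (vv (μ * n) (hubVec k z.1 z.2 c)) {i0, i1, i2} :=
              pp_mono _ (vv_nonneg hD hpos) (vv_le_one _ _) (Finset.subset_univ _)
          _ = _ := pp_triple _ (vv_symm _ _) (by simp [i0, i1]) (by simp [i0, i2])
              (by simp [i1, i2])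
          _ = min (z.1 * z.2 / (μ * n)) 1 * min (z.1 * c / (μ * n)) 1
              * min (z.2 * c / (μ * n)) 1 := by
              simp [vv, hubVec, i0, i1, i2]
          _ ≤ _ := tri_le hD ht (by linarith [hz.1]) (by linarith [hz.2]) hc hct
          _ = _ := by ring
    _ = 1 / (μ * n) * (∫ x, phi t x ∂ν) ^ 2 := by
        rw [integral_const_mul, integral_prod_mul]; ring
    _ ≤ _ := by gcongr

lemma twoInt_ge (hsupp : ν (Set.Iio 1) = 0) {μ : ℝ} (hμ : 0 < μ) {k : ℕ} (hk : 3 ≤ k)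
    {n : ℕ} (hn : 0 < n) {t c : ℝ} (ht : 0 < t) (hc : 0 < c) (htc : t * c = μ * n)
    (hle : t ≤ c) :
    (ν (Set.Ioc t (2 * t))).toReal ^ 2 * (t ^ 2 / (μ * n)) ≤ twoInt ν μ k n c := by
  have hD : 0 < μ * n := by positivity
  rw [twoInt_prod hsupp hμ k hn hc]
  set Q := Set.Ioc t (2 * t)
  have hQ : MeasurableSet (Q ×ˢ Q) := measurableSet_Ioc.prod measurableSet_Ioc
  have e : (ν Q).toReal ^ 2 * (t ^ 2 / (μ * n)) =
      ∫ z, (Q ×ˢ Q).indicator (fun _ => t ^ 2 / (μ * n)) z ∂(ν.prod ν) := by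
    rw [integral_indicator hQ]
    simp [Measure.real, Measure.prod_prod]
    left; ring
  rw [e]
  apply integral_mono_ae ((integrable_const _).indicator hQ) (hub_integrable hsupp hμ k hn hc)
  filter_upwards [ae_prod_one_le hsupp] with z hz
  have hpos := hub_pos (k := k) hz.1 hz.2 hc
  by_cases h : z ∈ Q ×ˢ Q
  · rw [Set.indicator_of_mem h]
    obtain ⟨⟨h1, h2⟩, h3, h4⟩ := h
    let i0 : Fin k := ⟨0, by omega⟩
    let i1 : Fin k := ⟨1, by omega⟩
    rw [fDef_eq_pp, pp_hub (x := i0) (y := i1) _ (vv_symm _ _) (Finset.mem_univ _)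
      (Finset.mem_univ _) (by simp [i0, i1])]
    · simp only [vv, hubVec, i0, i1, if_true, one_ne_zero, if_false]
      apply le_min
      · gcongr
        nlinarith
      · rw [div_le_one hD]
        nlinarith
    · intro i _ j _ hij hn1 hn2
      have key : μ * n ≤ hubVec k z.1 z.2 c i * hubVec k z.1 z.2 c j := by
        have hi0 : i0.val = 0 := rfl
        have hi1 : i1.val = 1 := rfl
        rw [Fin.ext_iff, Fin.ext_iff, hi0, hi1] at hn1 hn2
        rw [Ne, Fin.ext_iff] at hij
        unfold hubVec
        split_ifs <;> first | omega | nlinarith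
      apply min_eq_right
      rw [one_le_div hD]
      exact key
  · rw [Set.indicator_of_notMem h]
    exact (fDef_bounds hμ hn hpos).1

end hub

/-! ## Asymptotics of the critical hub size -/

section critical

set_option linter.unusedSectionVars false
variable {ν : Measure ℝ} [IsProbabilityMeasure ν] {α : ℝ}

lemma id_pow {α ρ : ℝ} {k : ℕ} (hid : 2 * ρ * (α - 1) = 1 - k * (1 - α / 2)) {x : ℝ} (hx : 0 < x) :
    x * ((x ^ ρ) ^ (1 - α)) ^ 2 = (x ^ (1 - α / 2)) ^ k := by
  rw [← Real.rpow_natCast, ← Real.rpow_natCast, ← Real.rpow_mul hx.le, ← Real.rpow_mul hx.le,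
    ← Real.rpow_mul hx.le]
  nth_rewrite 1 [← Real.rpow_one x]
  rw [← Real.rpow_add hx]
  congr 1
  push_cast
  linarith

lemma hub_setup (hα1 : 1 < α) (hα2 : α < 2)
    (htail : Tendsto (fun x : ℝ => x ^ α * (ν (Set.Ioi x)).toReal) atTop (nhds 1))
    {μ : ℝ} (hμ : 0 < μ) {k : ℕ} {ρ : ℝ} (hρ0 : 0 < ρ) (hρ1 : ρ < 1 / 2)
    (hid : 2 * ρ * (α - 1) = 1 - k * (1 - α / 2)) (B : ℝ) (hB : 0 < B) :
    ∃ K q : ℝ, 0 < K ∧ 0 < q ∧ ∀ᶠ n : ℕ in atTop,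
      0 < μ * (n : ℝ) ^ ρ / K ∧
      (μ * (n : ℝ) ^ ρ / K) * (K * (n : ℝ) ^ (1 - ρ)) = μ * n ∧
      2 * (μ * (n : ℝ) ^ ρ / K) < K * (n : ℝ) ^ (1 - ρ) ∧
      q * (n : ℝ) ^ (- (ρ * α)) ≤
        (ν (Set.Ioc (μ * (n : ℝ) ^ ρ / K) (2 * (μ * (n : ℝ) ^ ρ / K)))).toReal ∧
      B * ((n : ℝ) ^ (1 - α / 2)) ^ k ≤
        (n : ℝ) ^ 2 * ((ν (Set.Ioc (μ * (n : ℝ) ^ ρ / K) (2 * (μ * (n : ℝ) ^ ρ / K)))).toReal ^ 2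
          * ((μ * (n : ℝ) ^ ρ / K) ^ 2 / (μ * n))) := by
  obtain ⟨c, hc, hbin⟩ := bin_lower (ν := ν) (by linarith : 0 < α) (show (1 : ℝ) < 2 by norm_num) htail
  have hlim : Tendsto (fun K : ℝ => c ^ 2 / μ * ((K / μ) ^ (α - 1)) ^ 2) atTop atTop := by
    apply Tendsto.const_mul_atTop (by positivity)
    apply (tendsto_pow_atTop (by norm_num : (2 : ℕ) ≠ 0)).comp
    apply (tendsto_rpow_atTop (by linarith : 0 < α - 1)).comp
    exact tendsto_id.atTop_div_const hμ
  obtain ⟨K, hKB, hK⟩ := ((hlim.eventually_ge_atTop B).and (eventually_gt_atTop 0)).exists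
  refine ⟨K, c * (μ / K) ^ (-α), hK, by positivity, ?_⟩
  have hnρ : Tendsto (fun n : ℕ => (n : ℝ) ^ ρ) atTop atTop :=
    (tendsto_rpow_atTop hρ0).comp tendsto_natCast_atTop_atTop
  have ht : Tendsto (fun n : ℕ => μ * (n : ℝ) ^ ρ / K) atTop atTop :=
    (hnρ.const_mul_atTop hμ).atTop_div_const hK
  have hn2 : Tendsto (fun n : ℕ => (n : ℝ) ^ (1 - 2 * ρ)) atTop atTop :=
    (tendsto_rpow_atTop (by linarith)).comp tendsto_natCast_atTop_atTop
  filter_upwards [ht.eventually hbin, eventually_gt_atTop 0,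
    hn2.eventually_gt_atTop (2 * μ / K ^ 2)] with n h1 hn h2
  have hn' : (0 : ℝ) < n := by exact_mod_cast hn
  have hp : 0 < (n : ℝ) ^ ρ := by positivity
  have e1 : (n : ℝ) ^ (1 - ρ) = n / (n : ℝ) ^ ρ := by
    rw [Real.rpow_sub hn', Real.rpow_one]
  have e2 : (n : ℝ) ^ (1 - 2 * ρ) = n / ((n : ℝ) ^ ρ) ^ 2 := by
    rw [Real.rpow_sub hn', Real.rpow_one, mul_comm 2 ρ, Real.rpow_mul hn'.le]
    norm_num
  have e3 : (μ * (n : ℝ) ^ ρ / K) ^ (-α) = (μ / K) ^ (-α) * (n : ℝ) ^ (-(ρ * α)) := by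
    rw [mul_div_right_comm, Real.mul_rpow (by positivity) hp.le, ← Real.rpow_mul hn'.le]
    ring_nf
  refine ⟨by positivity, ?_, ?_, ?_, ?_⟩
  · rw [e1]; field_simp
  · rw [e1]
    rw [e2, div_lt_div_iff₀ (by positivity) (by positivity)] at h2
    rw [← mul_div_assoc, ← mul_div_assoc, div_lt_div_iff₀ hK hp]
    nlinarith
  · rw [mul_assoc, ← e3]; exact h1
  · set t := μ * (n : ℝ) ^ ρ / K with htd
    have ht0 : 0 < t := by positivity
    have e4 : t ^ (1 - α) = ((K / μ) ^ (α - 1)) * ((n : ℝ) ^ ρ) ^ (1 - α) := by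
      rw [htd, mul_div_right_comm, Real.mul_rpow (by positivity) hp.le]
      congr 1
      rw [← inv_div, Real.inv_rpow (by positivity), ← Real.rpow_neg (by positivity)]
      ring_nf
    have e5 : t ^ (1 - α) = t * t ^ (-α) := by
      rw [sub_eq_add_neg, Real.rpow_add ht0, Real.rpow_one]
    calc B * ((n : ℝ) ^ (1 - α / 2)) ^ k
        ≤ (c ^ 2 / μ * ((K / μ) ^ (α - 1)) ^ 2) * ((n : ℝ) ^ (1 - α / 2)) ^ k := by gcongr
      _ = (c ^ 2 / μ * ((K / μ) ^ (α - 1)) ^ 2) * (n * (((n : ℝ) ^ ρ) ^ (1 - α)) ^ 2) := by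
          rw [id_pow hid hn']
      _ = c ^ 2 / μ * n * (t ^ (1 - α)) ^ 2 := by rw [e4]; ring
      _ = (n : ℝ) ^ 2 * ((c * t ^ (-α)) ^ 2 * (t ^ 2 / (μ * n))) := by
          rw [e5]; field_simp
      _ ≤ _ := by gcongr

lemma cA_bounds (hα1 : 1 < α) (hα2 : α < 2) (hsupp : ν (Set.Iio 1) = 0)
    (htail : Tendsto (fun x : ℝ => x ^ α * (ν (Set.Ioi x)).toReal) atTop (nhds 1))
    {μ : ℝ} (hμ : 0 < μ) {k : ℕ} (hk : 3 ≤ k) {ρ : ℝ} (hρ0 : 0 < ρ) (hρ1 : ρ < 1 / 2)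
    (hid : 2 * ρ * (α - 1) = 1 - k * (1 - α / 2)) {a : ℝ} (ha : 0 < a) :
    ∃ κ₁ κ₂ : ℝ, 0 < κ₁ ∧ 0 < κ₂ ∧ ∀ᶠ n : ℕ in atTop,
      κ₁ * (n : ℝ) ^ (1 - ρ) ≤ cA ν μ k a n ∧ cA ν μ k a n ≤ κ₂ * (n : ℝ) ^ (1 - ρ) := by
  obtain ⟨cm, Cm, hcm, hCm, hm⟩ := mExp_bounds hα1 hα2 hsupp htail hμ hk
  obtain ⟨c2, hc2, hch⟩ := choose_lower 2
  obtain ⟨K, q, hK, hq, hset⟩ := hub_setup hα1 hα2 htail hμ (k := k) hρ0 hρ1 hid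
    (2 * a * Cm / c2) (by positivity)
  obtain ⟨C, hC, htw⟩ := twoInt_le hα1 hα2 hsupp htail hμ hk
  have hlim : Tendsto (fun L : ℝ => C ^ 2 / μ * ((L * μ) ^ (-(α - 1))) ^ 2) atTop (nhds 0) := by
    have h1 : Tendsto (fun L : ℝ => (L * μ) ^ (-(α - 1))) atTop (nhds 0) :=
      (tendsto_rpow_neg_atTop (by linarith : 0 < α - 1)).comp (tendsto_id.atTop_mul_const hμ)
    simpa using (h1.pow 2).const_mul (C ^ 2 / μ)
  obtain ⟨L, hL, hL0⟩ := ((hlim.eventually_le_const (show 0 < a * cm by positivity)).and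
    (eventually_gt_atTop 0)).exists
  refine ⟨1 / L, K, by positivity, hK, ?_⟩
  filter_upwards [hm, hch, hset, eventually_gt_atTop 0] with n h1 h2 h3 hn
  obtain ⟨h31, h32, h33, h34, h35⟩ := h3
  have hn' : (0 : ℝ) < n := by exact_mod_cast hn
  have hp : 0 < (n : ℝ) ^ ρ := by positivity
  have hR : 0 < ((n : ℝ) ^ (1 - α / 2)) ^ k := by positivity
  have hmem : K * (n : ℝ) ^ (1 - ρ) ∈
      {c : ℝ | 0 < c ∧ a * mExp ν μ k n < (n.choose 2 : ℝ) * twoInt ν μ k n c} := by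
    refine ⟨by positivity, ?_⟩
    have h4 := twoInt_ge hsupp hμ hk hn h31 (by positivity : 0 < K * (n : ℝ) ^ (1 - ρ)) h32
      (by linarith)
    calc a * mExp ν μ k n ≤ a * (Cm * ((n : ℝ) ^ (1 - α / 2)) ^ k) := by gcongr; exact h1.2
      _ < 2 * (a * (Cm * ((n : ℝ) ^ (1 - α / 2)) ^ k)) := by
          have : 0 < a * (Cm * ((n : ℝ) ^ (1 - α / 2)) ^ k) := by positivity
          linarith
      _ = c2 * (2 * a * Cm / c2 * ((n : ℝ) ^ (1 - α / 2)) ^ k) := by field_simp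
      _ ≤ c2 * ((n : ℝ) ^ 2 * twoInt ν μ k n (K * (n : ℝ) ^ (1 - ρ))) := by
          apply mul_le_mul_of_nonneg_left (h35.trans ?_) hc2.le
          gcongr
      _ = (c2 * (n : ℝ) ^ 2) * twoInt ν μ k n (K * (n : ℝ) ^ (1 - ρ)) := by ring
      _ ≤ _ := by
          gcongr
          refine le_trans ?_ h4
          positivity
  constructor
  · apply le_csInf ⟨_, hmem⟩
    rintro c ⟨hc0, hc⟩
    by_contra hlt
    push Not at hlt
    have e1 : (n : ℝ) ^ (1 - ρ) = n / (n : ℝ) ^ ρ := by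
      rw [Real.rpow_sub hn', Real.rpow_one]
    have ht0 : 0 < L * μ * (n : ℝ) ^ ρ := by positivity
    have h5 := htw n hn (L * μ * (n : ℝ) ^ ρ) c ht0 hc0 (by
      refine hlt.le.trans (le_of_eq ?_)
      rw [e1]; field_simp)
    have hch2 : (n.choose 2 : ℝ) ≤ (n : ℝ) ^ 2 := by exact_mod_cast Nat.choose_le_pow n 2
    have e4 : (L * μ * (n : ℝ) ^ ρ) ^ (1 - α) =
        (L * μ) ^ (-(α - 1)) * ((n : ℝ) ^ ρ) ^ (1 - α) := by
      rw [Real.mul_rpow (by positivity) hp.le]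
      ring_nf
    have : (n.choose 2 : ℝ) * twoInt ν μ k n c ≤ a * mExp ν μ k n := by
      calc _ ≤ (n.choose 2 : ℝ) * (1 / (μ * n) * (C * (L * μ * (n : ℝ) ^ ρ) ^ (1 - α)) ^ 2) := by
            gcongr
        _ ≤ (n : ℝ) ^ 2 * (1 / (μ * n) * (C * (L * μ * (n : ℝ) ^ ρ) ^ (1 - α)) ^ 2) := by
            gcongr
        _ = (C ^ 2 / μ * ((L * μ) ^ (-(α - 1))) ^ 2) * (n * (((n : ℝ) ^ ρ) ^ (1 - α)) ^ 2) := by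
            rw [e4]; field_simp
        _ = (C ^ 2 / μ * ((L * μ) ^ (-(α - 1))) ^ 2) * ((n : ℝ) ^ (1 - α / 2)) ^ k := by
            rw [id_pow hid hn']
        _ ≤ a * cm * ((n : ℝ) ^ (1 - α / 2)) ^ k := by gcongr
        _ = a * (cm * ((n : ℝ) ^ (1 - α / 2)) ^ k) := by ring
        _ ≤ _ := by gcongr; exact h1.1
    linarith
  · exact csInf_le ⟨0, fun c hc => hc.1.le⟩ hmem

/-- Order of magnitude of the expected number of hubs. -/
lemma hubProb_bounds (hα1 : 1 < α) (hα2 : α < 2) (hsupp : ν (Set.Iio 1) = 0)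
    (htail : Tendsto (fun x : ℝ => x ^ α * (ν (Set.Ioi x)).toReal) atTop (nhds 1))
    {μ : ℝ} (hμ : 0 < μ) {k : ℕ} (hk : 3 ≤ k) {ρ : ℝ} (hρ0 : 0 < ρ) (hρ1 : ρ < 1 / 2)
    (hid : 2 * ρ * (α - 1) = 1 - k * (1 - α / 2)) {a : ℝ} (ha : 0 < a) :
    ∃ c C : ℝ, 0 < c ∧ 0 < C ∧ ∀ᶠ n : ℕ in atTop,
      c * (n : ℝ) ^ (1 - α * (1 - ρ)) ≤ n * (ν (Set.Ioi (cA ν μ k a n))).toReal ∧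
      n * (ν (Set.Ioi (cA ν μ k a n))).toReal ≤ C * (n : ℝ) ^ (1 - α * (1 - ρ)) := by
  obtain ⟨κ₁, κ₂, h1, h2, hb⟩ := cA_bounds hα1 hα2 hsupp htail hμ hk hρ0 hρ1 hid ha
  obtain ⟨C, hC, hup⟩ := tail_upper (ν := ν) (by linarith : 0 < α) htail
  have hlow := tail_lower (ν := ν) htail
  have hT : Tendsto (fun n : ℕ => κ₂ * (n : ℝ) ^ (1 - ρ)) atTop atTop :=
    ((tendsto_rpow_atTop (by linarith)).comp tendsto_natCast_atTop_atTop).const_mul_atTop h2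
  refine ⟨1 / 2 * κ₂ ^ (-α), C * κ₁ ^ (-α), by positivity, by positivity, ?_⟩
  filter_upwards [hb, hT.eventually hlow, eventually_gt_atTop 0] with n h3 h4 hn
  have hn' : (0 : ℝ) < n := by exact_mod_cast hn
  have e : ∀ κ : ℝ, 0 < κ → (κ * (n : ℝ) ^ (1 - ρ)) ^ (-α) * n =
      κ ^ (-α) * (n : ℝ) ^ (1 - α * (1 - ρ)) := by
    intro κ hκ
    rw [Real.mul_rpow hκ.le (by positivity), ← Real.rpow_mul hn'.le, mul_assoc]
    congr 1
    nth_rewrite 2 [← Real.rpow_one (n : ℝ)]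
    rw [← Real.rpow_add hn']
    ring_nf
  constructor
  · calc _ = (1 / 2 * (κ₂ * (n : ℝ) ^ (1 - ρ)) ^ (-α)) * n := by
          rw [mul_assoc, mul_assoc, e κ₂ h2]
      _ ≤ (ν (Set.Ioi (κ₂ * (n : ℝ) ^ (1 - ρ)))).toReal * n := by gcongr
      _ ≤ (ν (Set.Ioi (cA ν μ k a n))).toReal * n := by
          gcongr
          · exact measure_ne_top _ _
          · exact h3.2
      _ = _ := mul_comm _ _
  · calc _ = (ν (Set.Ioi (cA ν μ k a n))).toReal * n := mul_comm _ _
      _ ≤ (ν (Set.Ioi (κ₁ * (n : ℝ) ^ (1 - ρ)))).toReal * n := by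
          gcongr
          · exact measure_ne_top _ _
          · exact h3.1
      _ ≤ (C * (κ₁ * (n : ℝ) ^ (1 - ρ)) ^ (-α)) * n := by
          gcongr
          exact hup _ (by positivity)
      _ = _ := by rw [mul_assoc, mul_assoc, e κ₁ h1]

end critical

/-! ## The lower bound -/

section lower

set_option linter.unusedSectionVars false
variable {ν : Measure ℝ} [IsProbabilityMeasure ν] {α : ℝ}

lemma Cful_lower {μ : ℝ} (hμ : 0 < μ) {k n : ℕ} (hk : 3 ≤ k) (hn : 0 < n) {t c b : ℝ}
    (ht : 0 < t) (htc : t * c = μ * n) (hle : 2 * t < c) (hb2 : 2 ≤ b)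
    (w : Fin n → ℝ) (hw : ∀ i, 1 ≤ w i)
    (hA : ∃ A : Finset (Fin n), A.card = k - 2 ∧ ∀ i ∈ A, c < w i)
    (hJ : b ≤ ∑ i, (Set.Ioc t (2 * t)).indicator (fun _ => (1 : ℝ)) (w i)) :
    b ^ 2 / 4 * (t ^ 2 / (μ * n)) ≤ Cful μ k n w := by
  classical
  have hD : 0 < μ * n := by positivity
  have hw0 : ∀ i, 0 < w i := fun i => lt_of_lt_of_le one_pos (hw i)
  obtain ⟨A, hAc, hA⟩ := hA
  set J : Finset (Fin n) := Finset.univ.filter fun i => w i ∈ Set.Ioc t (2 * t) with hJd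
  have hJc : b ≤ (J.card : ℝ) := by
    refine hJ.trans (le_of_eq ?_)
    rw [hJd, Finset.card_filter]
    push_cast
    apply Finset.sum_congr rfl
    intro i _
    simp [Set.indicator_apply]
  have hdisj : Disjoint A J := by
    rw [Finset.disjoint_left]
    intro i hi hiJ
    have h1 := hA i hi
    simp only [hJd, Finset.mem_filter, Finset.mem_univ, true_and, Set.mem_Ioc] at hiJ
    linarith [hiJ.2]
  rw [Cful_eq_pp]
  have hinj : Set.InjOn (fun T => A ∪ T) (↑(Finset.powersetCard 2 J) : Set (Finset (Fin n))) := by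
    intro T hT T' hT' h
    rw [Finset.mem_coe, Finset.mem_powersetCard] at hT hT'
    have d1 : Disjoint A T := hdisj.mono_right hT.1
    have d2 : Disjoint A T' := hdisj.mono_right hT'.1
    have h' : A ∪ T = A ∪ T' := h
    calc T = (A ∪ T) \ A := by rw [Finset.union_sdiff_cancel_left d1]
      _ = (A ∪ T') \ A := by rw [h']
      _ = T' := by rw [Finset.union_sdiff_cancel_left d2]
  calc b ^ 2 / 4 * (t ^ 2 / (μ * n)) ≤ (J.card.choose 2 : ℝ) * (t ^ 2 / (μ * n)) := by
        gcongr
        rw [Nat.cast_choose_two]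
        nlinarith
    _ = ∑ T ∈ Finset.powersetCard 2 J, t ^ 2 / (μ * n) := by
        rw [Finset.sum_const, Finset.card_powersetCard, nsmul_eq_mul]
    _ ≤ ∑ T ∈ Finset.powersetCard 2 J, pp (vv (μ * n) w) (A ∪ T) := by
        apply Finset.sum_le_sum
        intro T hT
        rw [Finset.mem_powersetCard] at hT
        obtain ⟨x, y, hxy, rfl⟩ := Finset.card_eq_two.1 hT.2
        have hxJ : x ∈ J := hT.1 (by simp)
        have hyJ : y ∈ J := hT.1 (by simp)
        simp only [hJd, Finset.mem_filter, Finset.mem_univ, true_and, Set.mem_Ioc] at hxJ hyJ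
        rw [pp_hub (x := x) (y := y) _ (vv_symm _ _) (by simp) (by simp) hxy]
        · unfold vv
          apply le_min
          · gcongr
            nlinarith
          · rw [div_le_one hD]
            nlinarith
        · have hbig : ∀ i ∈ A ∪ {x, y}, i = x ∨ i = y ∨ c < w i := by
            intro i hi
            simp only [Finset.mem_union, Finset.mem_insert, Finset.mem_singleton] at hi
            rcases hi with h | h | h
            · exact Or.inr (Or.inr (hA i h))
            · exact Or.inl h
            · exact Or.inr (Or.inl h)
          have hbig2 : ∀ i ∈ A ∪ {x, y}, t < w i := by
            intro i hi
            rcases hbig i hi with h | h | h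
            · rw [h]; exact hxJ.1
            · rw [h]; exact hyJ.1
            · linarith
          have key : ∀ i ∈ A ∪ {x, y}, ∀ j ∈ A ∪ {x, y}, c < w j → vv (μ * n) w i j = 1 := by
            intro i hi j hj hc
            apply min_eq_right
            rw [one_le_div hD, ← htc]
            have := hbig2 i hi
            have hc0 : 0 < c := by linarith
            exact mul_le_mul this.le hc.le hc0.le (hw0 i).le
          intro i hi j hj hij h1 h2
          rcases hbig j hj with h | h | h
          · rcases hbig i hi with h' | h' | h'
            · exact absurd (h'.trans h.symm) hij
            · exact absurd ⟨h', h⟩ h2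
            · rw [vv_symm]; exact key j hj i hi h'
          · rcases hbig i hi with h' | h' | h'
            · exact absurd ⟨h', h⟩ h1
            · exact absurd (h'.trans h.symm) hij
            · rw [vv_symm]; exact key j hj i hi h'
          · exact key i hi j hj h
    _ = ∑ S ∈ (Finset.powersetCard 2 J).image (fun T => A ∪ T), pp (vv (μ * n) w) S := by
        rw [Finset.sum_image hinj]
    _ ≤ _ := by
        apply Finset.sum_le_sum_of_subset_of_nonneg
        · intro S hS
          obtain ⟨T, hT, rfl⟩ := Finset.mem_image.1 hS
          rw [Finset.mem_powersetCard] at hT ⊢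
          refine ⟨Finset.subset_univ _, ?_⟩
          rw [Finset.card_union_of_disjoint (hdisj.mono_right hT.1), hAc, hT.2]
          omega
        · intro S _ _
          exact pp_nonneg _ (vv_nonneg hD hw0) _

lemma exp_neg_two_le : Real.exp (-2) ≤ 1 / 4 := by
  have e : Real.exp (-2) = Real.exp (-1) * Real.exp (-1) := by rw [← Real.exp_add]; norm_num
  have h1 := Real.exp_neg_one_lt_d9
  have h2 := Real.exp_pos (-1)
  rw [e]
  nlinarith

set_option maxHeartbeats 1000000 in
lemma prob_lower (hα1 : 1 < α) (hα2 : α < 2) (hsupp : ν (Set.Iio 1) = 0)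
    (htail : Tendsto (fun x : ℝ => x ^ α * (ν (Set.Ioi x)).toReal) atTop (nhds 1))
    {μ : ℝ} (hμ : 0 < μ) {k : ℕ} (hk : 3 ≤ k) {ρ : ℝ} (hρ0 : 0 < ρ) (hρ1 : ρ < 1 / 2)
    (hid : 2 * ρ * (α - 1) = 1 - k * (1 - α / 2)) (hδ : 1 < α * (1 - ρ)) {a : ℝ} (ha : 0 < a) :
    ∃ c : ℝ, 0 < c ∧ ∀ᶠ n : ℕ in atTop,
      c * ((n : ℝ) ^ (1 - α * (1 - ρ))) ^ (k - 2) ≤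
      (Measure.pi fun _ : Fin n => ν).real {w | (1 + a) * mExp ν μ k n < Cful μ k n w} := by
  obtain ⟨cm, Cm, hcm, hCm, hm⟩ := mExp_bounds hα1 hα2 hsupp htail hμ hk
  obtain ⟨cj, hcj, hch⟩ := choose_lower (k - 2)
  obtain ⟨K, q, hK, hq, hset⟩ := hub_setup hα1 hα2 htail hμ (k := k) hρ0 hρ1 hid
    (512 * (1 + a) * Cm) (by positivity)
  obtain ⟨C, hC, hup⟩ := tail_upper (ν := ν) (by linarith : 0 < α) htail
  have hlow := tail_lower (ν := ν) htail
  have hT : Tendsto (fun n : ℕ => K * (n : ℝ) ^ (1 - ρ)) atTop atTop :=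
    ((tendsto_rpow_atTop (by linarith)).comp tendsto_natCast_atTop_atTop).const_mul_atTop hK
  have hlim1 : Tendsto (fun n : ℕ => C * K ^ (-α) * (n : ℝ) ^ (-(α * (1 - ρ) - 1))) atTop (nhds 0) := by
    have := ((tendsto_rpow_neg_atTop (by linarith : 0 < α * (1 - ρ) - 1)).comp
      tendsto_natCast_atTop_atTop).const_mul (C * K ^ (-α))
    simpa using this
  have hlim2 : Tendsto (fun n : ℕ => q / 8 * (n : ℝ) ^ (1 - ρ * α)) atTop atTop :=
    ((tendsto_rpow_atTop (by nlinarith)).comp tendsto_natCast_atTop_atTop).const_mul_atTop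
      (by positivity)
  refine ⟨cj * (1 / 2 * K ^ (-α)) ^ (k - 2) * (1 / 2), by positivity, ?_⟩
  filter_upwards [hm, hch, hset, eventually_gt_atTop 0, hT.eventually hlow,
    hlim1.eventually_le_const (show (0 : ℝ) < 1 / 4 by norm_num), hlim2.eventually_ge_atTop 2,
    eventually_ge_atTop (2 * (k - 2))] with n h1 h2 h3 hn h4 h5 h6 hnk
  obtain ⟨h31, h32, h33, h34, h35⟩ := h3
  have hn' : (0 : ℝ) < n := by exact_mod_cast hn
  have hR : 0 < ((n : ℝ) ^ (1 - α / 2)) ^ k := by positivity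
  have e : (K * (n : ℝ) ^ (1 - ρ)) ^ (-α) * n = K ^ (-α) * (n : ℝ) ^ (1 - α * (1 - ρ)) := by
    rw [Real.mul_rpow hK.le (by positivity), ← Real.rpow_mul hn'.le, mul_assoc]
    congr 1
    nth_rewrite 2 [← Real.rpow_one (n : ℝ)]
    rw [← Real.rpow_add hn']
    ring_nf
  set t := μ * (n : ℝ) ^ ρ / K with ht
  set Q := Set.Ioc t (2 * t) with hQ
  set y := K * (n : ℝ) ^ (1 - ρ) with hy
  set p := (ν (Set.Ioi y)).toReal with hp
  set b := n * (ν Q).toReal / 8 with hb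
  have hy0 : 0 < y := by positivity
  have hb1 : q / 8 * (n : ℝ) ^ (1 - ρ * α) ≤ b := by
    rw [hb, sub_eq_add_neg, Real.rpow_add hn', Real.rpow_one]
    have := mul_le_mul_of_nonneg_left h34 hn'.le
    linarith
  have hb2 : 2 ≤ b := h6.trans hb1
  have hnp : n * p ≤ 1 / 4 := by
    have := mul_le_mul_of_nonneg_right (hup y hy0) hn'.le
    rw [mul_assoc, e] at this
    have e2 : (n : ℝ) ^ (1 - α * (1 - ρ)) = (n : ℝ) ^ (-(α * (1 - ρ) - 1)) := by ring_nf
    rw [e2] at this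
    linarith
  have hhub := hub_lower (ν := ν) n (k - 2) (by omega) y Q measurableSet_Ioc b
  have hexp : Real.exp (b - (n - (k - 2 : ℕ)) * (ν Q).toReal / 2) ≤ 1 / 4 := by
    have hj : ((k - 2 : ℕ) : ℝ) ≤ n / 2 := by
      rw [le_div_iff₀ (by norm_num)]
      have : (k - 2) * 2 ≤ n := by omega
      exact_mod_cast this
    have hQ0 : 0 ≤ (ν Q).toReal := ENNReal.toReal_nonneg
    have : b - (n - (k - 2 : ℕ)) * (ν Q).toReal / 2 ≤ -2 := by
      have := mul_le_mul_of_nonneg_right hj hQ0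
      have hb' : n * (ν Q).toReal = 8 * b := by rw [hb]; ring
      nlinarith
    exact (Real.exp_le_exp.2 this).trans exp_neg_two_le
  have hp0 : 0 ≤ p := ENNReal.toReal_nonneg
  calc _ = (cj * (1 / 2 * (K ^ (-α) * (n : ℝ) ^ (1 - α * (1 - ρ)))) ^ (k - 2)) * (1 / 2) := by
        simp only [mul_pow]; ring
    _ = (cj * ((1 / 2 * y ^ (-α)) * n) ^ (k - 2)) * (1 / 2) := by
        rw [← e, mul_assoc (1 / 2 : ℝ) _ (n : ℝ)]
    _ ≤ (cj * (p * n) ^ (k - 2)) * (1 / 2) := by gcongr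
    _ = cj * (n : ℝ) ^ (k - 2) * p ^ (k - 2) * (1 / 2) := by rw [mul_pow]; ring
    _ ≤ (n.choose (k - 2) : ℝ) * p ^ (k - 2) * (1 - n * p -
          Real.exp (b - (n - (k - 2 : ℕ)) * (ν Q).toReal / 2)) := by
        gcongr
        linarith
    _ ≤ _ := hhub
    _ ≤ _ := by
        apply ENNReal.toReal_mono (measure_ne_top _ _)
        apply measure_mono_ae
        filter_upwards [ae_pi_one_le hsupp n] with w hw
        rintro ⟨hA, hJ⟩
        show (1 + a) * mExp ν μ k n < Cful μ k n w
        have h7 := Cful_lower hμ hk hn h31 h32 h33 hb2 w hw hA hJ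
        refine lt_of_lt_of_le ?_ h7
        calc (1 + a) * mExp ν μ k n ≤ (1 + a) * (Cm * ((n : ℝ) ^ (1 - α / 2)) ^ k) := by
              gcongr; exact h1.2
          _ < 2 * ((1 + a) * (Cm * ((n : ℝ) ^ (1 - α / 2)) ^ k)) := by
              have : 0 < (1 + a) * (Cm * ((n : ℝ) ^ (1 - α / 2)) ^ k) := by positivity
              linarith
          _ = (512 * (1 + a) * Cm * ((n : ℝ) ^ (1 - α / 2)) ^ k) / 256 := by ring
          _ ≤ ((n : ℝ) ^ 2 * ((ν Q).toReal ^ 2 * (t ^ 2 / (μ * n)))) / 256 := by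
              gcongr
          _ = _ := by rw [hb]; ring

end lower

/-! ## The upper bound: deterministic estimates -/

lemma hub_fibers {n k : ℕ} (hk : 3 ≤ k) {D t X1 X2 r s : ℝ} (hD : 0 < D) (ht : 0 < t)
    (hs1 : 1 ≤ s) (hs2 : s ≤ 2) (hr1 : s / 2 ≤ r) (hr2 : 2 * (s - 1) ≤ r)
    (w : Fin n → ℝ) (hw : ∀ i, 0 < w i) (H : Finset (Fin n))
    (hX1 : ∑ i ∈ Hᶜ, gf r s (w i / √D) ≤ X1) (hX1' : 1 ≤ X1)
    (hX2 : ∑ i ∈ Hᶜ, phi t (w i) ≤ X2)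
    (hE2 : ¬ ∃ A : Finset (Fin n), A.card = k - 2 ∧ ∀ i ∈ A, D / t < w i)
    (A : Finset (Fin n)) (hA : A.Nonempty) :
    ∑ S ∈ (Finset.powersetCard k (Finset.univ : Finset (Fin n))).filter (fun S => S ∩ H = A),
      pp (vv D w) S ≤ X1 ^ (k - 1) + X2 ^ 2 / D + X2 / t + 1 := by
  have hv0 := vv_nonneg hD hw
  have hv1 := vv_le_one D w
  have hq : 0 < √D := Real.sqrt_pos.2 hD
  have hphi0 : ∀ i, 0 ≤ phi t (w i) := fun i => phi_nonneg ht (hw i).le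
  have hX20 : 0 ≤ X2 := (Finset.sum_nonneg fun i _ => hphi0 i).trans hX2
  have hg0 : ∀ i, 0 ≤ gf r s (w i / √D) := fun i => gf_nonneg r s (div_pos (hw i) hq).le
  have hSum0 : 0 ≤ ∑ i ∈ Hᶜ, gf r s (w i / √D) := Finset.sum_nonneg fun i _ => hg0 i
  have hP0 : 0 ≤ ∑ i ∈ Hᶜ, phi t (w i) := Finset.sum_nonneg fun i _ => hphi0 i
  have t1 : 0 ≤ X1 ^ (k - 1) := by positivity
  have t2 : 0 ≤ X2 ^ 2 / D := by positivity
  have t3 : 0 ≤ X2 / t := by positivity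
  have hA1 : 1 ≤ A.card := hA.card_pos
  have hsplit : ∀ S : Finset (Fin n), S.card = k → S ∩ H = A → (S \ H).card + A.card = k := by
    intro S hS hSA
    rw [← hSA, ← hS]
    have := Finset.card_sdiff_add_card_inter S H
    omega
  have hsmall : ∀ B : Finset (Fin n), k - 2 ≤ B.card → ∃ h ∈ B, w h ≤ D / t := by
    intro B hB
    by_contra hcon
    push Not at hcon
    obtain ⟨B', hB', hc⟩ := Finset.exists_subset_card_eq hB
    exact hE2 ⟨B', hc, fun i hi => hcon i (hB' hi)⟩
  rcases lt_or_ge k A.card with h0 | h0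
  · have := fiber_sum_le (pp (vv D w)) (fun _ => 0) (fun _ => le_rfl) 0 le_rfl H A k (by
      intro S hS hSA
      have := hsplit S hS hSA
      omega)
    rw [zero_mul] at this
    linarith
  rcases Nat.lt_or_ge A.card (k - 2) with h1 | h1
  · have := fiber_sum_le (pp (vv D w)) (fun i => gf r s (w i / √D)) hg0 1 zero_le_one H A k (by
      intro S hS hSA
      have h3 := hsplit S hS hSA
      rw [one_mul]
      calc _ ≤ pp (vv D w) (S \ H) := pp_mono _ hv0 hv1 Finset.sdiff_subset
        _ ≤ _ := by
          rw [vv_sqrt hD]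
          exact pp_le_prod hs1 hs2 hr1 hr2 (fun i => w i / √D) (fun i => div_pos (hw i) hq) _
            (by omega))
    rw [one_mul] at this
    have h5 : (∑ i ∈ Hᶜ, gf r s (w i / √D)) ^ (k - A.card) ≤ X1 ^ (k - 1) :=
      (pow_le_pow_left₀ hSum0 hX1 _).trans (pow_le_pow_right₀ hX1' (by omega))
    linarith
  obtain ⟨h, hhA, hh⟩ := hsmall A h1
  have hhS : ∀ S : Finset (Fin n), S ∩ H = A → h ∈ S ∧ h ∈ H := by
    intro S hSA
    rw [← hSA] at hhA
    exact Finset.mem_inter.1 hhA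
  have hcases : A.card = k - 2 ∨ A.card = k - 1 ∨ A.card = k := by omega
  rcases hcases with h2 | h2 | h2
  · have := fiber_sum_le (pp (vv D w)) (fun i => phi t (w i)) hphi0 (1 / D) (by positivity) H A k (by
      intro S hS hSA
      have h3 := hsplit S hS hSA
      obtain ⟨x, y, hxy, hSH⟩ := Finset.card_eq_two.1 (show (S \ H).card = 2 by omega)
      have hx : x ∈ S \ H := by rw [hSH]; simp
      have hy : y ∈ S \ H := by rw [hSH]; simp
      rw [Finset.mem_sdiff] at hx hy
      have hh' := hhS S hSA
      rw [hSH, Finset.prod_pair hxy]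
      have hxh : x ≠ h := fun e => hx.2 (e ▸ hh'.2)
      have hyh : y ≠ h := fun e => hy.2 (e ▸ hh'.2)
      calc _ ≤ pp (vv D w) {x, y, h} := pp_mono _ hv0 hv1 (by
              intro z hz
              simp only [Finset.mem_insert, Finset.mem_singleton] at hz
              rcases hz with rfl | rfl | rfl
              exacts [hx.1, hy.1, hh'.1])
        _ = _ := pp_triple _ (vv_symm _ _) hxy hxh hyh
        _ ≤ _ := tri_le hD ht (hw x) (hw y) (hw h) hh
        _ = _ := by ring)
    rw [show k - A.card = 2 by omega] at this
    have h5 := pow_le_pow_left₀ hP0 hX2 2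
    have h6 : 1 / D * (∑ i ∈ Hᶜ, phi t (w i)) ^ 2 ≤ X2 ^ 2 / D := by
      rw [one_div, inv_mul_eq_div]; gcongr
    linarith
  · obtain ⟨g, hgA, hg⟩ := hsmall (A.erase h) (by rw [Finset.card_erase_of_mem hhA]; omega)
    rw [Finset.mem_erase] at hgA
    have hgS : ∀ S : Finset (Fin n), S ∩ H = A → g ∈ S ∧ g ∈ H := by
      intro S hSA
      have := hgA.2
      rw [← hSA] at this
      exact Finset.mem_inter.1 this
    have := fiber_sum_le (pp (vv D w)) (fun i => phi t (w i)) hphi0 (1 / t) (by positivity) H A k (by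
      intro S hS hSA
      have h3 := hsplit S hS hSA
      obtain ⟨x, hSH⟩ := Finset.card_eq_one.1 (show (S \ H).card = 1 by omega)
      have hx : x ∈ S \ H := by rw [hSH]; simp
      rw [Finset.mem_sdiff] at hx
      have hh' := hhS S hSA
      have hg' := hgS S hSA
      rw [hSH, Finset.prod_singleton]
      have hxh : x ≠ h := fun e => hx.2 (e ▸ hh'.2)
      have hxg : x ≠ g := fun e => hx.2 (e ▸ hg'.2)
      have hle : ∀ c, 0 < c → c ≤ D / t → w x * c / D ≤ w x / t := by
        intro c hc hct
        have := hw x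
        calc w x * c / D ≤ w x * (D / t) / D := by gcongr
          _ = w x / t := by field_simp
      have hx0 := hw x
      calc _ ≤ pp (vv D w) {x, h, g} := pp_mono _ hv0 hv1 (by
              intro z hz
              simp only [Finset.mem_insert, Finset.mem_singleton] at hz
              rcases hz with rfl | rfl | rfl
              exacts [hx.1, hh'.1, hg'.1])
        _ = vv D w x h * vv D w x g * vv D w h g :=
            pp_triple _ (vv_symm _ _) hxh hxg (Ne.symm hgA.1)
        _ ≤ (w x / t) * min (w x / t) 1 * 1 := by
            apply mul_le_mul (mul_le_mul ((min_le_left _ _).trans (hle _ (hw h) hh))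
              (min_le_min_right _ (hle _ (hw g) hg)) (hv0 _ _) (by positivity)) (hv1 _ _) (hv0 _ _)
            positivity
        _ = _ := by rw [phi_eq ht]; ring)
    rw [show k - A.card = 1 by omega, pow_one] at this
    have h6 : 1 / t * (∑ i ∈ Hᶜ, phi t (w i)) ≤ X2 / t := by
      rw [one_div, inv_mul_eq_div]; gcongr
    linarith
  · have := fiber_sum_le (pp (vv D w)) (fun _ => 1) (fun _ => zero_le_one) 1 zero_le_one H A k (by
      intro S hS hSA
      simpa using pp_le_one _ hv0 hv1 S)
    rw [h2] at this
    simp only [Nat.sub_self, pow_zero, mul_one] at this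
    linarith

lemma hub_split {n k : ℕ} (hk : 3 ≤ k) {D t X1 X2 r s : ℝ} (hD : 0 < D) (ht : 0 < t)
    (hs1 : 1 ≤ s) (hs2 : s ≤ 2) (hr1 : s / 2 ≤ r) (hr2 : 2 * (s - 1) ≤ r)
    (w : Fin n → ℝ) (hw : ∀ i, 0 < w i) (H : Finset (Fin n))
    (hX1 : ∑ i ∈ Hᶜ, gf r s (w i / √D) ≤ X1) (hX1' : 1 ≤ X1)
    (hX2 : ∑ i ∈ Hᶜ, phi t (w i) ≤ X2)
    (hE2 : ¬ ∃ A : Finset (Fin n), A.card = k - 2 ∧ ∀ i ∈ A, D / t < w i)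
    {M : ℕ} (hM : H.card ≤ M) :
    ∑ S ∈ Finset.powersetCard k (Finset.univ : Finset (Fin n)), pp (vv D w) S ≤
      ∑ S ∈ Finset.powersetCard k Hᶜ, pp (vv D w) S +
        2 ^ M * (X1 ^ (k - 1) + X2 ^ 2 / D + X2 / t + 1) := by
  have hX20 : 0 ≤ X2 := (Finset.sum_nonneg fun i _ => phi_nonneg ht (hw i).le).trans hX2
  have hY0 : 0 ≤ X1 ^ (k - 1) + X2 ^ 2 / D + X2 / t + 1 := by positivity
  set Y := X1 ^ (k - 1) + X2 ^ 2 / D + X2 / t + 1 with hY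
  rw [← Finset.sum_fiberwise_of_maps_to (t := H.powerset) (g := fun S => S ∩ H)
    (fun S _ => Finset.mem_powerset.2 Finset.inter_subset_right)]
  rw [← Finset.add_sum_erase _ _ (Finset.empty_mem_powerset H)]
  apply add_le_add
  · apply Finset.sum_le_sum_of_subset_of_nonneg
    · intro S hS
      simp only [Finset.mem_filter, Finset.mem_powersetCard] at hS ⊢
      refine ⟨?_, hS.1.2⟩
      intro x hx
      rw [Finset.mem_compl]
      intro hxH
      have : x ∈ S ∩ H := Finset.mem_inter.2 ⟨hx, hxH⟩
      rw [hS.2] at this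
      simp at this
    · intro S _ _
      exact pp_nonneg _ (vv_nonneg hD hw) _
  · calc _ ≤ ∑ A ∈ H.powerset.erase ∅, Y := by
          apply Finset.sum_le_sum
          intro A hA
          exact hub_fibers hk hD ht hs1 hs2 hr1 hr2 w hw H hX1 hX1' hX2 hE2 A
            (Finset.nonempty_iff_ne_empty.2 (Finset.ne_of_mem_erase hA))
      _ = ((H.powerset.erase ∅).card : ℝ) * Y := by rw [Finset.sum_const, nsmul_eq_mul]
      _ ≤ 2 ^ M * Y := by
          gcongr
          have h1 : (H.powerset.erase ∅).card ≤ 2 ^ M :=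
            (Finset.card_erase_le).trans (by
              rw [Finset.card_powerset]
              exact Nat.pow_le_pow_right (by norm_num) hM)
          exact_mod_cast h1

lemma mid_split {n k : ℕ} (hk : 3 ≤ k) {D X1 r s η ε : ℝ} (hD : 0 < D)
    (hη : 0 ≤ η) (hε : 0 < ε) (hε1 : ε ≤ 1)
    (hs1 : 1 ≤ s + η) (hs2 : s + η ≤ 2) (hr1 : (s + η) / 2 ≤ r - η)
    (hr2 : 2 * (s + η - 1) ≤ r - η)
    (w : Fin n → ℝ) (hw : ∀ i, 0 < w i) (U : Finset (Fin n))
    (hX1 : ∑ i ∈ U, gf r s (w i / √D) ≤ X1) :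
    ∑ S ∈ Finset.powersetCard k U, pp (vv D w) S ≤
      ∑ S ∈ Finset.powersetCard k (U.filter fun i => ε < w i / √D ∧ w i / √D ≤ 1 / ε),
        pp (vv D w) S + ε ^ η * X1 ^ k := by
  have hq : 0 < √D := Real.sqrt_pos.2 hD
  have hg0 : ∀ i, 0 ≤ gf r s (w i / √D) := fun i => gf_nonneg r s (div_pos (hw i) hq).le
  set V := U.filter fun i => ε < w i / √D ∧ w i / √D ≤ 1 / ε with hV
  rw [← Finset.sum_filter_add_sum_filter_not (Finset.powersetCard k U) (fun S => S ⊆ V)]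
  apply add_le_add
  · apply Finset.sum_le_sum_of_subset_of_nonneg
    · intro S hS
      simp only [Finset.mem_filter, Finset.mem_powersetCard] at hS ⊢
      exact ⟨hS.2, hS.1.2⟩
    · intro S _ _
      exact pp_nonneg _ (vv_nonneg hD hw) _
  · calc _ ≤ ∑ S ∈ (Finset.powersetCard k U).filter (fun S => ¬ S ⊆ V),
            ε ^ η * ∏ i ∈ S, gf r s (w i / √D) := by
          apply Finset.sum_le_sum
          intro S hS
          simp only [Finset.mem_filter, Finset.mem_powersetCard] at hS
          obtain ⟨i, hi, hiV⟩ := Finset.not_subset.1 hS.2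
          have hiU := hS.1.1 hi
          have hout : w i / √D ≤ ε ∨ 1 / ε < w i / √D := by
            by_contra hcon
            push Not at hcon
            exact hiV (by rw [hV, Finset.mem_filter]; exact ⟨hiU, hcon⟩)
          calc pp (vv D w) S ≤ ∏ i ∈ S, gf (r - η) (s + η) (w i / √D) := by
                rw [vv_sqrt hD]
                exact pp_le_prod hs1 hs2 hr1 hr2 (fun i => w i / √D)
                  (fun i => div_pos (hw i) hq) _ (by omega)
            _ = gf (r - η) (s + η) (w i / √D) *
                  ∏ j ∈ S.erase i, gf (r - η) (s + η) (w j / √D) :=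
                (Finset.mul_prod_erase _ _ hi).symm
            _ ≤ (ε ^ η * gf r s (w i / √D)) * ∏ j ∈ S.erase i, gf r s (w j / √D) := by
                apply mul_le_mul
                · exact gf_out (div_pos (hw i) hq) hη hε hε1 hout
                · apply Finset.prod_le_prod
                  · intro j _; exact gf_nonneg _ _ (div_pos (hw j) hq).le
                  · intro j _; exact gf_mono_exp (div_pos (hw j) hq) (by linarith) (by linarith)
                · apply Finset.prod_nonneg
                  intro j _; exact gf_nonneg _ _ (div_pos (hw j) hq).le
                · have := hg0 i
                  positivity
            _ = ε ^ η * ∏ i ∈ S, gf r s (w i / √D) := by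
                rw [mul_assoc, Finset.mul_prod_erase _ (fun i => gf r s (w i / √D)) hi]
      _ ≤ ∑ S ∈ Finset.powersetCard k U, ε ^ η * ∏ i ∈ S, gf r s (w i / √D) := by
          apply Finset.sum_le_sum_of_subset_of_nonneg (Finset.filter_subset _ _)
          intro S _ _
          have := Finset.prod_nonneg (s := S) fun i _ => hg0 i
          positivity
      _ = ε ^ η * ∑ S ∈ Finset.powersetCard k U, ∏ i ∈ S, gf r s (w i / √D) := by
          rw [Finset.mul_sum]
      _ ≤ ε ^ η * X1 ^ k := by
          gcongr
          exact (esymm_le _ hg0 U k).trans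
            (pow_le_pow_left₀ (Finset.sum_nonneg fun i _ => hg0 i) hX1 k)

/-! ## The upper bound: comparison of the bulk with the expectation -/

lemma fDef_mono {μ : ℝ} (hμ : 0 < μ) {n k : ℕ} (hn : 0 < n) {x y : Fin k → ℝ}
    (hx : ∀ i, 0 < x i) (hxy : ∀ i, x i ≤ y i) : fDef μ n k x ≤ fDef μ n k y := by
  have hD : 0 < μ * n := by positivity
  unfold fDef
  apply Finset.prod_le_prod
  · intro p _
    have := hx p.1; have := hx p.2
    positivity
  · intro p _
    apply min_le_min_right
    gcongr
    · exact (hx p.2).le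
    · exact (hx p.1).le.trans (hxy p.1)
    · exact hxy _
    · exact hxy _

lemma fDef_scale {μ : ℝ} (hμ : 0 < μ) {n k : ℕ} (hn : 0 < n) {x y : Fin k → ℝ} {l : ℝ} (hl : 1 ≤ l)
    (hx : ∀ i, 0 < x i) (hy : ∀ i, 0 < y i) (hxy : ∀ i, y i ≤ l * x i) :
    fDef μ n k y ≤
      (l ^ 2) ^ (Finset.univ.filter (fun p : Fin k × Fin k => p.1 < p.2)).card * fDef μ n k x := by
  have hD : 0 < μ * n := by positivity
  unfold fDef
  rw [← Finset.prod_const, ← Finset.prod_mul_distrib]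
  apply Finset.prod_le_prod
  · intro p _
    have := hy p.1; have := hy p.2
    positivity
  · intro p _
    have h1 : y p.1 * y p.2 / (μ * n) ≤ l ^ 2 * (x p.1 * x p.2 / (μ * n)) := by
      rw [← mul_div_assoc]
      apply div_le_div_of_nonneg_right _ hD.le
      calc y p.1 * y p.2 ≤ (l * x p.1) * (l * x p.2) :=
            mul_le_mul (hxy _) (hxy _) (hy _).le ((hy _).le.trans (hxy _))
        _ = l ^ 2 * (x p.1 * x p.2) := by ring
    have h2 : (1 : ℝ) ≤ l ^ 2 := by nlinarith
    rcases le_total (x p.1 * x p.2 / (μ * n)) 1 with h | h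
    · rw [min_eq_left h]; exact (min_le_left _ _).trans h1
    · rw [min_eq_right h, mul_one]; exact (min_le_right _ _).trans h2

lemma bins_det {μ : ℝ} (hμ : 0 < μ) {n k m : ℕ} (hn : 0 < n) (bs : ℕ → ℝ) (hbs : ∀ l, 0 < bs l)
    (w : Fin n → ℝ) (hw : ∀ i, 0 < w i) (U : Finset (Fin n))
    (hU : ∀ i ∈ U, ∃ l : Fin m, w i ∈ Set.Ioc (bs l) (bs (l + 1))) (Z : Fin m → ℝ)
    (hZ : ∀ l : Fin m, ∑ i, (Set.Ioc (bs l) (bs (l + 1))).indicator (fun _ => (1 : ℝ)) (w i) ≤ Z l) :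
    (k.factorial : ℝ) * ∑ S ∈ Finset.powersetCard k U, pp (vv (μ * n) w) S ≤
      ∑ l : Fin k → Fin m, fDef μ n k (fun i => bs (l i + 1)) * ∏ i, Z (l i) := by
  have hD : 0 < μ * n := by positivity
  set I : Fin m → ℝ → ℝ := fun l => (Set.Ioc (bs l) (bs (l + 1))).indicator (fun _ => (1 : ℝ)) with hI
  have hI0 : ∀ l x, 0 ≤ I l x := fun l x => Set.indicator_nonneg (fun _ _ => zero_le_one) x
  have hf0 : ∀ l : Fin k → Fin m, 0 ≤ fDef μ n k (fun i => bs (l i + 1)) :=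
    fun l => (fDef_bounds hμ hn (fun i => hbs _)).1
  have hterm : ∀ (e : Fin k → Fin n) (l : Fin k → Fin m),
      0 ≤ fDef μ n k (fun i => bs (l i + 1)) * ∏ i, I (l i) (w (e i)) := fun e l =>
    mul_nonneg (hf0 l) (Finset.prod_nonneg fun i _ => hI0 _ _)
  have h := sum_sets_le_tuples k U (pp (vv (μ * n) w))
    (fun e => ∑ l : Fin k → Fin m, fDef μ n k (fun i => bs (l i + 1)) * ∏ i, I (l i) (w (e i)))
    (fun e => Finset.sum_nonneg fun l _ => hterm e l) (by
      intro e he heU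
      choose l hl using fun i => hU (e i) (heU i)
      rw [← pp_map (vv (μ * n) w) (vv_symm _ _) e he]
      have e1 : pp (fun i j => vv (μ * n) w (e i) (e j)) Finset.univ =
          fDef μ n k (fun i => w (e i)) := by
        rw [fDef_eq_pp]; rfl
      rw [e1]
      refine le_trans ?_ (Finset.single_le_sum (fun l _ => hterm e l) (Finset.mem_univ l))
      have e2 : ∏ i, I (l i) (w (e i)) = 1 := by
        apply Finset.prod_eq_one
        intro i _
        simp only [hI]
        exact Set.indicator_of_mem (hl i) _
      rw [e2, mul_one]
      exact fDef_mono hμ hn (fun i => hw _) (fun i => (hl i).2))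
  refine h.trans ?_
  rw [Finset.sum_comm]
  apply Finset.sum_le_sum
  intro l _
  rw [← Finset.mul_sum]
  apply mul_le_mul_of_nonneg_left _ (hf0 l)
  have e3 : ∑ e : Fin k → Fin n, ∏ i, I (l i) (w (e i)) = ∏ i, ∑ j, I (l i) (w j) := by
    rw [Finset.prod_univ_sum]
    simp
  rw [e3]
  apply Finset.prod_le_prod
  · intro i _; exact Finset.sum_nonneg fun j _ => hI0 _ _
  · intro i _; exact hZ (l i)

lemma bins_int {ν : Measure ℝ} [IsProbabilityMeasure ν] (hsupp : ν (Set.Iio 1) = 0)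
    {μ : ℝ} (hμ : 0 < μ) {n k : ℕ} (m : ℕ) (hn : 0 < n)
    (bs : ℕ → ℝ) (hbs : ∀ l, 0 < bs l) {lam : ℝ} (hlam : 1 ≤ lam)
    (hstep : ∀ l, bs (l + 1) = lam * bs l) :
    ∑ l : Fin k → Fin m, fDef μ n k (fun i => bs (l i + 1)) *
        ∏ i, (ν (Set.Ioc (bs (l i)) (bs (l i + 1)))).toReal ≤
      (lam ^ 2) ^ (Finset.univ.filter (fun p : Fin k × Fin k => p.1 < p.2)).card *
        ∫ x, fDef μ n k x ∂(Measure.pi fun _ : Fin k => ν) := by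
  set c := (lam ^ 2) ^ (Finset.univ.filter (fun p : Fin k × Fin k => p.1 < p.2)).card with hc
  have hc0 : 0 ≤ c := by positivity
  set P := Measure.pi fun _ : Fin k => ν with hP
  have hmono : Monotone bs := by
    apply monotone_nat_of_le_succ
    intro l
    rw [hstep]
    nlinarith [hbs l]
  set Q : (Fin k → Fin m) → Set (Fin k → ℝ) := fun l =>
    Set.univ.pi fun i => Set.Ioc (bs (l i)) (bs (l i + 1)) with hQ
  have hQm : ∀ l, MeasurableSet (Q l) := fun l => MeasurableSet.univ_pi fun i => measurableSet_Ioc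
  have hdis : Pairwise (Function.onFun Disjoint Q) := by
    intro l l' hne
    obtain ⟨i, hi⟩ := Function.ne_iff.1 hne
    have h1 := hmono.pairwise_disjoint_on_Ioc_succ (fun h => hi (Fin.ext h) : (l i : ℕ) ≠ (l' i : ℕ))
    show Disjoint (Q l) (Q l')
    rw [Set.disjoint_left]
    intro x hx hx'
    exact Set.disjoint_left.1 h1 (hx i (Set.mem_univ i)) (hx' i (Set.mem_univ i))
  have hfi := fDef_integrable (k := k) hsupp hμ hn
  calc _ ≤ ∑ l : Fin k → Fin m, c * ∫ x in Q l, fDef μ n k x ∂P := by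
        apply Finset.sum_le_sum
        intro l _
        have e : fDef μ n k (fun i => bs (l i + 1)) *
            ∏ i, (ν (Set.Ioc (bs (l i)) (bs (l i + 1)))).toReal =
            ∫ x in Q l, fDef μ n k (fun i => bs (l i + 1)) ∂P := by
          rw [setIntegral_const]
          simp only [Measure.real, hP, hQ, Measure.pi_pi, ENNReal.toReal_prod, smul_eq_mul]
          ring
        rw [e, ← integral_const_mul]
        apply setIntegral_mono_on (integrable_const _).integrableOn
          (hfi.const_mul c).integrableOn (hQm l)
        intro x hx
        have hx' : ∀ i, x i ∈ Set.Ioc (bs (l i)) (bs (l i + 1)) := fun i => hx i (Set.mem_univ i)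
        apply fDef_scale hμ hn hlam (fun i => (hbs _).trans (hx' i).1) (fun i => hbs _)
        intro i
        rw [hstep]
        have := (hx' i).1
        gcongr
    _ = c * ∫ x in ⋃ l, Q l, fDef μ n k x ∂P := by
        rw [integral_iUnion_fintype hQm hdis (fun l => hfi.integrableOn), Finset.mul_sum]
    _ ≤ c * ∫ x, fDef μ n k x ∂P := by
        apply mul_le_mul_of_nonneg_left _ hc0
        apply setIntegral_le_integral hfi
        filter_upwards [ae_pi_one_le hsupp k] with x hx
        exact (fDef_bounds hμ hn (fun i => lt_of_lt_of_le one_pos (hx i))).1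

/-! ## The upper bound: combination on the good event -/

lemma bins_cover (bs : ℕ → ℝ) (x : ℝ) (h0 : bs 0 < x) :
    ∀ m : ℕ, x ≤ bs m → ∃ l : Fin m, x ∈ Set.Ioc (bs l) (bs (l + 1)) := by
  intro m
  induction m with
  | zero => intro h; exact absurd h0 (not_lt.2 h)
  | succ m ih =>
    intro h
    by_cases hm : x ≤ bs m
    · obtain ⟨l, hl⟩ := ih hm
      exact ⟨l.castSucc, hl⟩
    · exact ⟨Fin.last m, not_le.1 hm, h⟩

lemma good_det {ν : Measure ℝ} [IsProbabilityMeasure ν] (hsupp : ν (Set.Iio 1) = 0)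
    {μ : ℝ} (hμ : 0 < μ) {n k m M : ℕ} (hn : 0 < n) (hk : 3 ≤ k)
    {t T X1 X2 r s η ε1 ε2 lam : ℝ} (ht : 0 < t)
    (hη : 0 ≤ η) (hε : 0 < ε1) (hε1 : ε1 ≤ 1) (hε2 : 0 ≤ ε2)
    (hs0 : 1 ≤ s) (hs1 : 1 ≤ s + η) (hs2 : s + η ≤ 2) (hr1 : (s + η) / 2 ≤ r - η)
    (hr2 : 2 * (s + η - 1) ≤ r - η)
    (bs : ℕ → ℝ) (hbs : ∀ l, 0 < bs l) (hlam : 1 ≤ lam) (hstep : ∀ l, bs (l + 1) = lam * bs l)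
    (hb0 : bs 0 = ε1 * √(μ * n)) (hbm : √(μ * n) / ε1 ≤ bs m)
    (w : Fin n → ℝ) (hw : ∀ i, 1 ≤ w i) (hX1 : 1 ≤ X1)
    (hE1 : ¬ ∃ A : Finset (Fin n), A.card = M ∧ ∀ i ∈ A, T < w i)
    (hE2 : ¬ ∃ A : Finset (Fin n), A.card = k - 2 ∧ ∀ i ∈ A, μ * n / t < w i)
    (hE3 : ∑ i, (Set.Icc 1 T).indicator (fun x => gf r s (x / √(μ * n))) (w i) ≤ X1)
    (hE4 : ∑ i, (Set.Icc 1 T).indicator (phi t) (w i) ≤ X2)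
    (hE5 : ∀ l : Fin m, ∑ i, (Set.Ioc (bs l) (bs (l + 1))).indicator (fun _ => (1 : ℝ)) (w i) ≤
      (1 + ε2) * (n * (ν (Set.Ioc (bs l) (bs (l + 1)))).toReal)) :
    Cful μ k n w ≤
      ((1 + ε2) ^ k * (lam ^ 2) ^ (Finset.univ.filter (fun p : Fin k × Fin k => p.1 < p.2)).card) *
        ((n : ℝ) ^ k / k.factorial * ∫ x, fDef μ n k x ∂(Measure.pi fun _ : Fin k => ν)) +
      ε1 ^ η * X1 ^ k + 2 ^ M * (X1 ^ (k - 1) + X2 ^ 2 / (μ * n) + X2 / t + 1) := by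
  have hD : 0 < μ * n := by positivity
  have hq : 0 < √(μ * n) := Real.sqrt_pos.2 hD
  have hw0 : ∀ i, 0 < w i := fun i => lt_of_lt_of_le one_pos (hw i)
  set H : Finset (Fin n) := Finset.univ.filter fun i => T < w i with hH
  have hHc : ∀ g : ℝ → ℝ, ∑ i ∈ Hᶜ, g (w i) = ∑ i, (Set.Icc 1 T).indicator g (w i) := by
    intro g
    have : Hᶜ = Finset.univ.filter fun i => w i ∈ Set.Icc 1 T := by
      ext i
      simp [hH, hw i]
    rw [this, Finset.sum_filter]
    apply Finset.sum_congr rfl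
    intro i _
    rw [Set.indicator_apply]
  have hHM : H.card ≤ M := by
    by_contra hcon
    push Not at hcon
    obtain ⟨A, hA, hAc⟩ := Finset.exists_subset_card_eq hcon.le
    exact hE1 ⟨A, hAc, fun i hi => (Finset.mem_filter.1 (hA hi)).2⟩
  have h3 : ∑ i ∈ Hᶜ, gf r s (w i / √(μ * n)) ≤ X1 := by
    rw [hHc (fun x => gf r s (x / √(μ * n)))]; exact hE3
  have h4 : ∑ i ∈ Hᶜ, phi t (w i) ≤ X2 := by rw [hHc (phi t)]; exact hE4
  have hA := hub_split hk hD ht hs0 (by linarith) (by linarith) (by linarith) w hw0 H h3 hX1 h4 hE2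
    hHM
  have hB := mid_split hk hD hη hε hε1 hs1 hs2 hr1 hr2 w hw0 Hᶜ h3
  set V := Hᶜ.filter fun i => ε1 < w i / √(μ * n) ∧ w i / √(μ * n) ≤ 1 / ε1 with hV
  have hCc := bins_det (k := k) hμ hn bs hbs w hw0 V (m := m) (by
    intro i hi
    rw [hV, Finset.mem_filter] at hi
    obtain ⟨_, h1, h2⟩ := hi
    apply bins_cover
    · rw [hb0]; rwa [lt_div_iff₀ hq] at h1
    · refine le_trans ?_ hbm
      rw [div_le_iff₀ hq] at h2
      refine h2.trans (le_of_eq ?_)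
      ring) _ hE5
  have hI := bins_int (k := k) hsupp hμ m hn bs hbs hlam hstep
  set c := (lam ^ 2) ^ (Finset.univ.filter (fun p : Fin k × Fin k => p.1 < p.2)).card with hc
  set I := ∫ x, fDef μ n k x ∂(Measure.pi fun _ : Fin k => ν) with hId
  have hfac : (0 : ℝ) < k.factorial := by positivity
  have hbulk : ∑ S ∈ Finset.powersetCard k V, pp (vv (μ * n) w) S ≤
      ((1 + ε2) ^ k * c) * ((n : ℝ) ^ k / k.factorial * I) := by
    have h5 : (k.factorial : ℝ) * ∑ S ∈ Finset.powersetCard k V, pp (vv (μ * n) w) S ≤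
        ((1 + ε2) * n) ^ k * (c * I) := by
      refine hCc.trans ?_
      calc _ = ((1 + ε2) * n) ^ k * ∑ l : Fin k → Fin m, fDef μ n k (fun i => bs (l i + 1)) *
            ∏ i, (ν (Set.Ioc (bs (l i)) (bs (l i + 1)))).toReal := by
            rw [Finset.mul_sum]
            apply Finset.sum_congr rfl
            intro l _
            simp_rw [← mul_assoc (1 + ε2) (n : ℝ)]
            rw [Finset.prod_mul_distrib, Finset.prod_const, Finset.card_univ, Fintype.card_fin]
            ring
        _ ≤ _ := by gcongr
    rw [← le_div_iff₀' hfac] at h5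
    refine h5.trans (le_of_eq ?_)
    rw [mul_pow]
    field_simp
  rw [Cful_eq_pp]
  linarith

/-! ## The upper bound: probabilities of the bad events -/

section bad

set_option linter.unusedSectionVars false
variable {ν : Measure ℝ} [IsProbabilityMeasure ν] {α : ℝ}

lemma hub_prob (hα : 0 < α)
    (htail : Tendsto (fun x : ℝ => x ^ α * (ν (Set.Ioi x)).toReal) atTop (nhds 1))
    {κ : ℝ} (hκ : 0 < κ) (τ : ℝ) (j : ℕ) :
    ∃ C : ℝ, 0 < C ∧ ∀ n : ℕ, 0 < n →
      (Measure.pi fun _ : Fin n => ν).real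
        {w | ∃ A : Finset (Fin n), A.card = j ∧ ∀ i ∈ A, κ * (n : ℝ) ^ τ < w i} ≤
      C * ((n : ℝ) ^ (1 - α * τ)) ^ j := by
  obtain ⟨C, hC, hup⟩ := tail_upper (ν := ν) hα htail
  refine ⟨(C * κ ^ (-α)) ^ j, by positivity, fun n hn => ?_⟩
  have hn' : (0 : ℝ) < n := by exact_mod_cast hn
  refine (hub_count n j _).trans ?_
  rw [← mul_pow]
  apply pow_le_pow_left₀ (by positivity)
  have h := mul_le_mul_of_nonneg_left (hup (κ * (n : ℝ) ^ τ) (by positivity)) hn'.le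
  refine h.trans (le_of_eq ?_)
  rw [Real.mul_rpow hκ.le (by positivity), ← Real.rpow_mul hn'.le, sub_eq_add_neg,
    Real.rpow_add hn', Real.rpow_one]
  ring_nf

/-- A Chernoff bound for sums truncated at `T`. -/
lemma trunc_prob (n : ℕ) (X : ℝ → ℝ) (hX : Measurable X) {T B M : ℝ} (hB : 0 < B)
    (hsupp : ν (Set.Iio 1) = 0)
    (h0 : ∀ x, 1 ≤ x → 0 ≤ X x) (h1 : ∀ x, 1 ≤ x → x ≤ T → X x ≤ B) (hXi : Integrable X ν)
    (hM0 : 0 ≤ M) (hM : n * ∫ x, X x ∂ν ≤ M) :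
    (Measure.pi fun _ : Fin n => ν).real {w | 2 * M ≤ ∑ i, (Set.Icc 1 T).indicator X (w i)} ≤
      Real.exp (-(M / (4 * B))) := by
  have h := chernoff (ν := ν) n ((Set.Icc 1 T).indicator X) (hX.indicator measurableSet_Icc)
    (B := B) (M := M) (ε := 1) hB
    (fun x => Set.indicator_nonneg (fun x hx => h0 x hx.1) x)
    (fun x => by
      by_cases hx : x ∈ Set.Icc 1 T
      · rw [Set.indicator_of_mem hx]; exact h1 x hx.1 hx.2
      · rw [Set.indicator_of_notMem hx]; exact hB.le) hM0
    (by
      refine le_trans ?_ hM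
      apply mul_le_mul_of_nonneg_left _ (Nat.cast_nonneg n)
      apply integral_mono_ae (hXi.indicator measurableSet_Icc) hXi
      filter_upwards [ae_one_le hsupp] with x hx
      exact Set.indicator_le_self' (fun _ _ => h0 x hx) x)
    one_pos le_rfl
  have e : (1 + 1 : ℝ) = 2 := by norm_num
  rw [e, one_pow, one_mul] at h
  exact h

lemma E3_prob (hα1 : 1 < α) (hα2 : α < 2) (hsupp : ν (Set.Iio 1) = 0)
    (htail : Tendsto (fun x : ℝ => x ^ α * (ν (Set.Ioi x)).toReal) atTop (nhds 1))
    {μ : ℝ} (hμ : 0 < μ) {r s τ : ℝ} (hr : 0 < r) (hrα : r < α) (hs : α < s) (hτ : 1 / 2 < τ)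
    (hτr : (τ - 1 / 2) * r < 1 - α / 2) (L : ℝ) :
    ∃ C : ℝ, 0 < C ∧ ∀ᶠ n : ℕ in atTop,
      (Measure.pi fun _ : Fin n => ν).real
        {w | C * (n : ℝ) ^ (1 - α / 2) ≤
          ∑ i, (Set.Icc 1 ((n : ℝ) ^ τ)).indicator (fun x => gf r s (x / √(μ * n))) (w i)} ≤
      (n : ℝ) ^ (-L) := by
  obtain ⟨C, hC, hmom⟩ := gf_moment (ν := ν) (by linarith : 0 < α) hsupp htail hr hrα hs
  have hm : 0 < μ ^ (-α / 2) := by positivity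
  set C3 := C * μ ^ (-α / 2) with hC3
  have hC30 : 0 < C3 := by positivity
  set κ := 1 + μ ^ (-r / 2) with hκ
  have hκ0 : 0 < κ := by positivity
  refine ⟨2 * C3, by positivity, ?_⟩
  filter_upwards [eventually_gt_atTop 0, exp_decay (c := C3 / (4 * κ))
    (θ := 1 - α / 2 - (τ - 1 / 2) * r) (by positivity) (by linarith) L] with n hn hdec
  have hn' : (0 : ℝ) < n := by exact_mod_cast hn
  have hn1 : (1 : ℝ) ≤ n := by exact_mod_cast hn
  have hD : 0 < μ * n := by positivity
  have hq : 0 < √(μ * n) := Real.sqrt_pos.2 hD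
  obtain ⟨hi, hb⟩ := hmom _ hq
  have hpw1 : 1 ≤ (n : ℝ) ^ ((τ - 1 / 2) * r) :=
    Real.one_le_rpow hn1 (mul_nonneg (by linarith) hr.le)
  have hTq : ((n : ℝ) ^ τ / √(μ * n)) ^ r = μ ^ (-r / 2) * (n : ℝ) ^ ((τ - 1 / 2) * r) := by
    rw [Real.div_rpow (by positivity) hq.le, div_eq_mul_inv, ← Real.rpow_neg hq.le, sqrt_rpow hμ,
      ← Real.rpow_mul hn'.le, mul_left_comm, ← Real.rpow_add hn']
    ring_nf
  have h := trunc_prob (ν := ν) n (fun x => gf r s (x / √(μ * n)))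
    ((measurable_gf r s).comp (measurable_id.div_const _)) (T := (n : ℝ) ^ τ)
    (B := κ * (n : ℝ) ^ ((τ - 1 / 2) * r)) (M := C3 * (n : ℝ) ^ (1 - α / 2)) (by positivity) hsupp
    (fun x hx => gf_nonneg _ _ (by positivity)) (by
      intro x hx hxT
      have hpm : 0 < μ ^ (-r / 2) := by positivity
      unfold gf
      split_ifs with hle
      · have h1 : (x / √(μ * n)) ^ s ≤ 1 := Real.rpow_le_one (by positivity) hle (by linarith)
        have h2 : (1 : ℝ) ≤ κ := by rw [hκ]; linarith
        nlinarith
      · have h1 : (x / √(μ * n)) ^ r ≤ ((n : ℝ) ^ τ / √(μ * n)) ^ r := by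
          apply Real.rpow_le_rpow (by positivity) _ hr.le
          gcongr
        rw [hTq] at h1
        rw [hκ]
        linarith) hi (by positivity) (by
      calc _ ≤ (n : ℝ) * (C * √(μ * n) ^ (-α)) := by gcongr
        _ = _ := by
          rw [sqrt_rpow hμ, hC3, show (1 - α / 2) = 1 + -α / 2 by ring, Real.rpow_add hn',
            Real.rpow_one]
          ring)
  rw [← mul_assoc] at h
  refine h.trans (le_trans (le_of_eq ?_) hdec)
  congr 2
  have e : (n : ℝ) ^ (1 - α / 2 - (τ - 1 / 2) * r) =
      (n : ℝ) ^ (1 - α / 2) / (n : ℝ) ^ ((τ - 1 / 2) * r) := Real.rpow_sub hn' _ _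
  rw [e]
  have hp : 0 < (n : ℝ) ^ ((τ - 1 / 2) * r) := by positivity
  generalize (n : ℝ) ^ ((τ - 1 / 2) * r) = A at hp
  generalize (n : ℝ) ^ (1 - α / 2) = B
  field_simp

lemma E4_prob (hα1 : 1 < α) (hα2 : α < 2) (hsupp : ν (Set.Iio 1) = 0)
    (htail : Tendsto (fun x : ℝ => x ^ α * (ν (Set.Ioi x)).toReal) atTop (nhds 1)) :
    ∃ C : ℝ, 0 < C ∧ ∀ κ ρ τ L : ℝ, 0 < κ → τ < 1 - ρ * (α - 1) → ∀ᶠ n : ℕ in atTop,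
      (Measure.pi fun _ : Fin n => ν).real
        {w | C * (n * (κ * (n : ℝ) ^ ρ) ^ (1 - α)) ≤
          ∑ i, (Set.Icc 1 ((n : ℝ) ^ τ)).indicator (phi (κ * (n : ℝ) ^ ρ)) (w i)} ≤
      (n : ℝ) ^ (-L) := by
  obtain ⟨C, hC, hmom⟩ := phi_moment hα1 hα2 hsupp htail
  refine ⟨2 * C, by positivity, fun κ ρ τ L hκ hτ => ?_⟩
  filter_upwards [eventually_gt_atTop 0, exp_decay (c := C * κ ^ (1 - α) / 4)
    (θ := 1 - ρ * (α - 1) - τ) (by positivity) (by linarith) L] with n hn hdec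
  have hn' : (0 : ℝ) < n := by exact_mod_cast hn
  have ht : 0 < κ * (n : ℝ) ^ ρ := by positivity
  obtain ⟨hi, hb⟩ := hmom _ ht
  have h := trunc_prob (ν := ν) n (phi (κ * (n : ℝ) ^ ρ)) (measurable_phi _) (T := (n : ℝ) ^ τ)
    (B := (n : ℝ) ^ τ) (M := C * (n * (κ * (n : ℝ) ^ ρ) ^ (1 - α))) (by positivity) hsupp
    (fun x hx => phi_nonneg ht (by linarith)) (by
      intro x hx hxT
      rw [phi_eq ht]
      have := min_le_right (x / (κ * (n : ℝ) ^ ρ)) 1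
      nlinarith) hi (by positivity) (by
      calc _ ≤ (n : ℝ) * (C * (κ * (n : ℝ) ^ ρ) ^ (1 - α)) := by gcongr
        _ = _ := by ring)
  rw [← mul_assoc] at h
  refine h.trans (le_trans (le_of_eq ?_) hdec)
  congr 2
  rw [Real.mul_rpow hκ.le (by positivity), ← Real.rpow_mul hn'.le, Real.rpow_sub hn',
    show 1 - ρ * (α - 1) = 1 + ρ * (1 - α) by ring, Real.rpow_add hn', Real.rpow_one]
  field_simp

lemma E5_prob (hα1 : 1 < α) (hα2 : α < 2)
    (htail : Tendsto (fun x : ℝ => x ^ α * (ν (Set.Ioi x)).toReal) atTop (nhds 1))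
    {μ : ℝ} (hμ : 0 < μ) {β lam ε2 : ℝ} (hβ : 0 < β) (hlam : 1 < lam) (hε : 0 < ε2) (hε1 : ε2 ≤ 1)
    (L : ℝ) :
    ∀ᶠ n : ℕ in atTop,
      (Measure.pi fun _ : Fin n => ν).real
        {w | (1 + ε2) * (n * (ν (Set.Ioc (β * √(μ * n)) (lam * (β * √(μ * n))))).toReal) ≤
          ∑ i, (Set.Ioc (β * √(μ * n)) (lam * (β * √(μ * n)))).indicator (fun _ => (1 : ℝ)) (w i)} ≤
      (n : ℝ) ^ (-L) := by
  obtain ⟨c, hc, hbin⟩ := bin_lower (ν := ν) (by linarith : 0 < α) hlam htail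
  have hlim : Tendsto (fun n : ℕ => β * √(μ * n)) atTop atTop :=
    (tendsto_sqrt_mu hμ).const_mul_atTop hβ
  have hm : 0 < μ ^ (-α / 2) := by positivity
  filter_upwards [eventually_gt_atTop 0, hlim.eventually hbin,
    exp_decay (c := ε2 ^ 2 * (c * (β ^ (-α) * μ ^ (-α / 2))) / 4) (θ := 1 - α / 2)
    (by positivity) (by linarith) L] with n hn hb hdec
  have hn' : (0 : ℝ) < n := by exact_mod_cast hn
  set Q := Set.Ioc (β * √(μ * n)) (lam * (β * √(μ * n))) with hQ
  have h := chernoff (ν := ν) n (Q.indicator (fun _ => (1 : ℝ)))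
    (measurable_const.indicator measurableSet_Ioc) (B := 1) (M := n * (ν Q).toReal) (ε := ε2) one_pos
    (fun x => Set.indicator_nonneg (fun _ _ => zero_le_one) x)
    (fun x => Set.indicator_le_self' (fun _ _ => zero_le_one) x) (by positivity)
    (by
      rw [integral_indicator measurableSet_Ioc, setIntegral_const, smul_eq_mul, mul_one]
      exact le_rfl) hε hε1
  refine h.trans (le_trans ?_ hdec)
  apply Real.exp_le_exp.2
  rw [neg_le_neg_iff]
  rw [Real.mul_rpow hβ.le (Real.sqrt_nonneg _), sqrt_rpow hμ] at hb
  have h2 := mul_le_mul_of_nonneg_left hb hn'.le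
  rw [show (1 - α / 2) = 1 + -α / 2 by ring, Real.rpow_add hn', Real.rpow_one]
  have h3 := mul_le_mul_of_nonneg_left h2 (show 0 ≤ ε2 ^ 2 / 4 by positivity)
  calc _ = ε2 ^ 2 / 4 * (n * (c * (β ^ (-α) * (μ ^ (-α / 2) * (n : ℝ) ^ (-α / 2))))) := by ring
    _ ≤ _ := h3
    _ = _ := by ring

end bad

/-! ## The upper bound: conclusion -/

section upper

lemma choose_upper (k : ℕ) {γ : ℝ} (hγ : 0 < γ) : ∀ᶠ n : ℕ in atTop,
    (n : ℝ) ^ k / k.factorial ≤ (1 + γ) * (n.choose k : ℝ) := by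
  obtain ⟨φ, hφ, h⟩ := Asymptotics.isEquivalent_iff_exists_eq_mul.1 (isEquivalent_choose k).symm
  filter_upwards [h, hφ.eventually_le_const (show (1 : ℝ) < 1 + γ by linarith)] with n h1 h2
  rw [h1]
  exact mul_le_mul_of_nonneg_right h2 (Nat.cast_nonneg _)

lemma const_choice (k P : ℕ) {γ : ℝ} (hγ : 0 < γ) : ∃ ε : ℝ, 0 < ε ∧ ε ≤ 1 ∧
    (1 + ε) ^ k * ((1 + ε) ^ 2) ^ P ≤ 1 + γ := by
  have hc : Tendsto (fun ε : ℝ => (1 + ε) ^ k * ((1 + ε) ^ 2) ^ P) (nhdsWithin 0 (Set.Ioi 0))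
      (nhds 1) := by
    have : Continuous (fun ε : ℝ => (1 + ε) ^ k * ((1 + ε) ^ 2) ^ P) := by fun_prop
    have h := this.tendsto 0
    simp only [add_zero, one_pow, mul_one] at h
    exact h.mono_left nhdsWithin_le_nhds
  obtain ⟨ε, h1, h2, h3⟩ := ((hc.eventually_le_const (show (1 : ℝ) < 1 + γ by linarith)).and
    ((eventually_mem_nhdsWithin).and
      ((eventually_le_nhds (zero_lt_one (α := ℝ))).filter_mono nhdsWithin_le_nhds))).exists
  exact ⟨ε, h2, h3, h1⟩

lemma pow_small (A : ℝ) {ε p q : ℝ} (hpq : p < q) (hε : 0 < ε) : ∀ᶠ n : ℕ in atTop,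
    A * (n : ℝ) ^ p ≤ ε * (n : ℝ) ^ q := by
  have h2 : Tendsto (fun n : ℕ => ε * (n : ℝ) ^ (q - p)) atTop atTop :=
    ((tendsto_rpow_atTop (by linarith)).comp tendsto_natCast_atTop_atTop).const_mul_atTop hε
  filter_upwards [h2.eventually_ge_atTop A, eventually_gt_atTop 0] with n h hn
  have hn' : (0 : ℝ) < n := by exact_mod_cast hn
  have e : (n : ℝ) ^ q = (n : ℝ) ^ (q - p) * (n : ℝ) ^ p := by
    rw [← Real.rpow_add hn']; ring_nf
  rw [e, ← mul_assoc]
  exact mul_le_mul_of_nonneg_right h (by positivity)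

lemma err_small {α ρ κ : ℝ} {k : ℕ} (hk : 3 ≤ k) (hα2 : α < 2) (hρ0 : 0 < ρ)
    (hid : 2 * ρ * (α - 1) = 1 - k * (1 - α / 2)) (hκ : 0 < κ)
    (C3 C4 B : ℝ) (hB : 0 ≤ B) {ε : ℝ} (hε : 0 < ε) : ∀ᶠ n : ℕ in atTop,
    B * ((C3 * (n : ℝ) ^ (1 - α / 2)) ^ (k - 1) +
      C4 * (n * (κ * (n : ℝ) ^ ρ) ^ (1 - α)) / (κ * (n : ℝ) ^ ρ) + 1) ≤
      ε * ((n : ℝ) ^ (1 - α / 2)) ^ k := by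
  have hθ : 0 < 1 - α / 2 := by linarith
  have hk' : (3 : ℝ) ≤ k := by exact_mod_cast hk
  filter_upwards [eventually_gt_atTop 0,
    pow_small (B * C3 ^ (k - 1)) (p := (1 - α / 2) * (k - 1)) (q := (1 - α / 2) * k) (ε := ε / 3)
      (by nlinarith) (by positivity),
    pow_small (B * (C4 * κ ^ (-α))) (p := 1 - ρ * α) (q := (1 - α / 2) * k) (ε := ε / 3)
      (by nlinarith) (by positivity),
    pow_small B (p := 0) (q := (1 - α / 2) * k) (ε := ε / 3)
      (by nlinarith) (by positivity)] with n hn h1 h2 h3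
  have hn' : (0 : ℝ) < n := by exact_mod_cast hn
  rw [Real.rpow_zero] at h3
  have e1 : ((n : ℝ) ^ (1 - α / 2)) ^ k = (n : ℝ) ^ ((1 - α / 2) * k) := by
    rw [← Real.rpow_natCast, ← Real.rpow_mul hn'.le]
  have e2 : ((n : ℝ) ^ (1 - α / 2)) ^ (k - 1) = (n : ℝ) ^ ((1 - α / 2) * (k - 1)) := by
    rw [← Real.rpow_natCast, ← Real.rpow_mul hn'.le, Nat.cast_sub (by omega), Nat.cast_one]
  have e3 : C4 * (n * (κ * (n : ℝ) ^ ρ) ^ (1 - α)) / (κ * (n : ℝ) ^ ρ) =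
      C4 * κ ^ (-α) * (n : ℝ) ^ (1 - ρ * α) := by
    have ht : 0 < κ * (n : ℝ) ^ ρ := by positivity
    have : (κ * (n : ℝ) ^ ρ) ^ (1 - α) / (κ * (n : ℝ) ^ ρ) = (κ * (n : ℝ) ^ ρ) ^ (-α) := by
      rw [← Real.rpow_sub_one ht.ne']; ring_nf
    rw [mul_div_assoc, mul_div_assoc, this, Real.mul_rpow hκ.le (by positivity),
      ← Real.rpow_mul hn'.le, show 1 - ρ * α = 1 + ρ * (-α) by ring, Real.rpow_add hn',
      Real.rpow_one]
    ring
  rw [e1, mul_pow, e2, e3]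
  linarith

lemma union5 {Ω : Type*} [MeasurableSpace Ω] (P : Measure Ω) [IsFiniteMeasure P] {m : ℕ}
    (B E1 E2 E3 E4 : Set Ω) (E5 : Fin m → Set Ω)
    (h : ∀ᵐ w ∂P, w ∈ B → w ∈ E1 ∨ w ∈ E2 ∨ w ∈ E3 ∨ w ∈ E4 ∨ ∃ l, w ∈ E5 l)
    {p1 p2 p3 p4 p5 : ℝ} (h1 : P.real E1 ≤ p1) (h2 : P.real E2 ≤ p2) (h3 : P.real E3 ≤ p3)
    (h4 : P.real E4 ≤ p4) (h5 : ∀ l, P.real (E5 l) ≤ p5) :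
    P.real B ≤ p1 + p2 + p3 + p4 + m * p5 := by
  have hsub : P.real B ≤ P.real (E1 ∪ (E2 ∪ (E3 ∪ (E4 ∪ ⋃ l, E5 l)))) := by
    apply ENNReal.toReal_mono (measure_ne_top _ _)
    apply measure_mono_ae
    filter_upwards [h] with w hw hB
    have := hw hB
    show w ∈ E1 ∪ (E2 ∪ (E3 ∪ (E4 ∪ ⋃ l, E5 l)))
    simp only [Set.mem_union, Set.mem_iUnion]
    exact this
  have a1 := measureReal_union_le (μ := P) E1 (E2 ∪ (E3 ∪ (E4 ∪ ⋃ l, E5 l)))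
  have a2 := measureReal_union_le (μ := P) E2 (E3 ∪ (E4 ∪ ⋃ l, E5 l))
  have a3 := measureReal_union_le (μ := P) E3 (E4 ∪ ⋃ l, E5 l)
  have a4 := measureReal_union_le (μ := P) E4 (⋃ l, E5 l)
  have a5 : P.real (⋃ l, E5 l) ≤ m * p5 := by
    refine (measureReal_iUnion_fintype_le E5).trans ?_
    refine (Finset.sum_le_sum fun l _ => h5 l).trans ?_
    simp
  linarith

end upper

section upper2

variable {ν : Measure ℝ} [IsProbabilityMeasure ν] {α : ℝ}

set_option maxHeartbeats 1000000 in
lemma prob_upper (hα1 : 1 < α) (hα2 : α < 2) (hsupp : ν (Set.Iio 1) = 0)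
    (htail : Tendsto (fun x : ℝ => x ^ α * (ν (Set.Ioi x)).toReal) atTop (nhds 1))
    {μ : ℝ} (hμ : 0 < μ) {k : ℕ} (hk : 3 ≤ k) {ρ : ℝ} (hρ0 : 0 < ρ) (hρ1 : ρ < 1 / 2)
    (hid : 2 * ρ * (α - 1) = 1 - k * (1 - α / 2)) (hδ : 1 < α * (1 - ρ)) {a : ℝ} (ha : 0 < a) :
    ∃ C : ℝ, 0 < C ∧ ∀ᶠ n : ℕ in atTop,
      (Measure.pi fun _ : Fin n => ν).real {w | (1 + a) * mExp ν μ k n < Cful μ k n w} ≤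
        C * ((n : ℝ) ^ (1 - α * (1 - ρ))) ^ (k - 2) := by
  obtain ⟨cm, Cm, hcm, hCm, hmb⟩ := mExp_bounds hα1 hα2 hsupp htail hμ hk
  obtain ⟨η, hη⟩ : ∃ η, η = (2 - α) / 12 := ⟨_, rfl⟩
  have hη0 : 0 < η := by rw [hη]; linarith
  obtain ⟨r, hr⟩ : ∃ r, r = α - η := ⟨_, rfl⟩
  obtain ⟨s, hs⟩ : ∃ s, s = α + η := ⟨_, rfl⟩
  have hr0 : 0 < r := by linarith
  obtain ⟨L, hL⟩ : ∃ L : ℝ, L = (α * (1 - ρ) - 1) * (k - 2 : ℕ) := ⟨_, rfl⟩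
  -- approximation constants
  obtain ⟨γ, hγ0, hγ⟩ : ∃ γ : ℝ, 0 < γ ∧ (1 + γ) ^ 2 ≤ 1 + a / 4 := by
    refine ⟨min a 1 / 16, by positivity, ?_⟩
    have h1 := min_le_left a 1
    have h2 := min_le_right a 1
    have h3 : 0 < min a 1 := by positivity
    nlinarith
  obtain ⟨ε2, hε20, hε21, hR⟩ := const_choice k
    (Finset.univ.filter (fun p : Fin k × Fin k => p.1 < p.2)).card hγ0
  -- truncation exponent
  obtain ⟨τ, hτ1, hτ2⟩ : ∃ τ, 1 / α < τ ∧ τ < min (1 - ρ) (1 / 2 + (1 - α / 2) / r) := by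
    apply exists_between
    apply lt_min
    · rw [div_lt_iff₀ (by linarith)]; linarith
    · have h1 : (1 - α / 2) / α < (1 - α / 2) / r :=
        div_lt_div_of_pos_left (by linarith) hr0 (by linarith)
      have h2 : 1 / α = 1 / 2 + (1 - α / 2) / α := by field_simp; ring
      linarith
  obtain ⟨hτ3, hτ4⟩ := lt_min_iff.1 hτ2
  have hτh : 1 / 2 < τ := by
    have : 1 / 2 < 1 / α := one_div_lt_one_div_of_lt (by linarith) hα2
    linarith
  have hτr : (τ - 1 / 2) * r < 1 - α / 2 := by
    have : τ - 1 / 2 < (1 - α / 2) / r := by linarith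
    rwa [lt_div_iff₀ hr0] at this
  have hατ : 1 < α * τ := by
    rw [div_lt_iff₀ (by linarith)] at hτ1; linarith
  have hτρ : τ < 1 - ρ * (α - 1) := by nlinarith
  obtain ⟨C3, hC3, hE3⟩ := E3_prob (ν := ν) hα1 hα2 hsupp htail hμ (r := r) (s := s) hr0
    (by linarith) (by linarith) hτh hτr L
  -- small window parameter
  obtain ⟨ε1, hε10, hε11, hε1⟩ : ∃ ε1 : ℝ, 0 < ε1 ∧ ε1 ≤ 1 ∧ ε1 ^ η * C3 ^ k ≤ a / 8 * cm := by
    have h1 : Tendsto (fun x : ℝ => x ^ η * C3 ^ k) (nhdsWithin 0 (Set.Ioi 0)) (nhds 0) := by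
      have h := ((Real.continuousAt_rpow_const 0 η (Or.inr hη0.le)).tendsto).mul_const (C3 ^ k)
      rw [Real.zero_rpow hη0.ne', zero_mul] at h
      exact h.mono_left nhdsWithin_le_nhds
    obtain ⟨ε, h1, h2, h3⟩ := ((h1.eventually_le_const (show 0 < a / 8 * cm by positivity)).and
      ((eventually_mem_nhdsWithin).and
      ((eventually_le_nhds (zero_lt_one (α := ℝ))).filter_mono nhdsWithin_le_nhds))).exists
    exact ⟨ε, h2, h3, h1⟩
  obtain ⟨m, hm⟩ := pow_unbounded_of_one_lt (1 / ε1 / ε1) (show 1 < 1 + ε2 by linarith)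
  rw [div_lt_iff₀ hε10] at hm
  obtain ⟨M, hM⟩ := exists_nat_ge (L / (α * τ - 1))
  rw [div_le_iff₀ (by linarith)] at hM
  obtain ⟨C4, hC4, hE4⟩ := E4_prob hα1 hα2 hsupp htail
  obtain ⟨κ, hκ, hκ0⟩ : ∃ κ : ℝ, 2 ^ M * (C4 ^ 2 / μ * (κ ^ (1 - α)) ^ 2) ≤ a / 8 * cm ∧ 0 < κ := by
    have hlim : Tendsto (fun κ : ℝ => 2 ^ M * (C4 ^ 2 / μ * (κ ^ (1 - α)) ^ 2)) atTop (nhds 0) := by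
      have h1 : Tendsto (fun κ : ℝ => κ ^ (-(α - 1))) atTop (nhds 0) :=
        tendsto_rpow_neg_atTop (by linarith : 0 < α - 1)
      rw [show -(α - 1) = 1 - α by ring] at h1
      simpa using ((h1.pow 2).const_mul (C4 ^ 2 / μ)).const_mul (2 ^ M)
    exact ((hlim.eventually_le_const (show 0 < a / 8 * cm by positivity)).and
      (eventually_gt_atTop 0)).exists
  obtain ⟨C1, hC1, hE1⟩ := hub_prob (ν := ν) (by linarith : 0 < α) htail one_pos τ M
  obtain ⟨C2, hC2, hE2⟩ := hub_prob (ν := ν) (by linarith : 0 < α) htail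
    (show 0 < μ / κ by positivity) (1 - ρ) (k - 2)
  have hE5 : ∀ᶠ n : ℕ in atTop, ∀ l : Fin m, _ := eventually_all.2 fun l : Fin m =>
    E5_prob hα1 hα2 htail hμ (β := ε1 * (1 + ε2) ^ (l : ℕ)) (by positivity)
      (show 1 < 1 + ε2 by linarith) hε20 hε21 L
  have hN : Tendsto (fun n : ℕ => C3 * (n : ℝ) ^ (1 - α / 2)) atTop atTop :=
    ((tendsto_rpow_atTop (by linarith)).comp tendsto_natCast_atTop_atTop).const_mul_atTop hC3
  refine ⟨C1 + C2 + 1 + 1 + m, by positivity, ?_⟩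
  filter_upwards [eventually_gt_atTop 0, hmb, hE3, hE4 κ ρ τ L hκ0 hτρ, hE5,
    hN.eventually_ge_atTop 1, choose_upper k hγ0,
    err_small hk hα2 hρ0 hid hκ0 C3 C4 (2 ^ M) (by positivity) (show 0 < a / 8 * cm by positivity)]
    with n hn hmn h3 h4 h5 hX1 hch herr
  have hn' : (0 : ℝ) < n := by exact_mod_cast hn
  have hn1 : (1 : ℝ) ≤ n := by exact_mod_cast hn
  have hY : (n : ℝ) ^ (-L) = ((n : ℝ) ^ (1 - α * (1 - ρ))) ^ (k - 2) := by
    rw [← Real.rpow_natCast, ← Real.rpow_mul hn'.le, hL]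
    ring_nf
  have h1 := hE1 n hn
  have h2 := hE2 n hn
  have h1' : C1 * ((n : ℝ) ^ (1 - α * τ)) ^ M ≤ C1 * (n : ℝ) ^ (-L) := by
    apply mul_le_mul_of_nonneg_left _ hC1.le
    rw [← Real.rpow_natCast, ← Real.rpow_mul hn'.le]
    apply Real.rpow_le_rpow_of_exponent_le hn1
    linarith
  rw [← hY] at h2 ⊢
  have hu := union5 (Measure.pi fun _ : Fin n => ν)
    {w | (1 + a) * mExp ν μ k n < Cful μ k n w} _ _ _ _ _ ?_ (h1.trans h1') h2 h3 h4 h5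
  · refine hu.trans (le_of_eq ?_)
    ring
  filter_upwards [ae_pi_one_le hsupp n] with w hw hB
  by_contra hcon
  simp only [not_or, not_exists (α := Fin m), not_le, one_mul] at hcon
  obtain ⟨g1, g2, g3, g4, g5⟩ := hcon
  have ht : 0 < κ * (n : ℝ) ^ ρ := by positivity
  have hq : 0 < √(μ * n) := Real.sqrt_pos.2 (by positivity)
  have hTe : μ * n / (κ * (n : ℝ) ^ ρ) = μ / κ * (n : ℝ) ^ (1 - ρ) := by
    rw [Real.rpow_sub hn', Real.rpow_one]
    field_simp
  have hstep : ∀ l : ℕ, ε1 * (1 + ε2) ^ (l + 1) * √(μ * n) =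
      (1 + ε2) * (ε1 * (1 + ε2) ^ l * √(μ * n)) := fun l => by ring
  have hgood := good_det hsupp hμ hn hk (t := κ * (n : ℝ) ^ ρ) (T := (n : ℝ) ^ τ)
    (X1 := C3 * (n : ℝ) ^ (1 - α / 2)) (X2 := C4 * (n * (κ * (n : ℝ) ^ ρ) ^ (1 - α)))
    (r := r) (s := s) (η := η) (ε1 := ε1) (ε2 := ε2) (lam := 1 + ε2) (m := m) (M := M)
    ht hη0.le hε10 hε11 hε20.le (by linarith) (by linarith) (by linarith) (by linarith)
    (by linarith) (fun l => ε1 * (1 + ε2) ^ l * √(μ * n)) (fun l => by positivity) (by linarith)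
    hstep (by simp only [pow_zero, mul_one]) (by
      rw [div_eq_mul_inv, mul_comm]
      apply mul_le_mul_of_nonneg_right _ hq.le
      rw [inv_eq_one_div]
      linarith) w hw hX1 g1 (by rw [hTe]; exact g2) g3.le g4.le (fun l => by
      have := (g5 l).le
      simp only [hstep]
      exact this)
  have hI : 0 ≤ ∫ x, fDef μ n k x ∂(Measure.pi fun _ : Fin k => ν) := by
    apply integral_nonneg_of_ae
    filter_upwards [ae_pi_one_le hsupp k] with x hx
    exact (fDef_bounds hμ hn (fun i => lt_of_lt_of_le one_pos (hx i))).1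
  have hmE := mExp_eq hsupp μ k n
  have b1 : ((1 + ε2) ^ k * ((1 + ε2) ^ 2) ^
      (Finset.univ.filter (fun p : Fin k × Fin k => p.1 < p.2)).card) *
        ((n : ℝ) ^ k / k.factorial * ∫ x, fDef μ n k x ∂(Measure.pi fun _ : Fin k => ν)) ≤
      (1 + a / 4) * mExp ν μ k n := by
    rw [hmE]
    calc _ ≤ (1 + γ) * ((1 + γ) * (n.choose k : ℝ) *
          ∫ x, fDef μ n k x ∂(Measure.pi fun _ : Fin k => ν)) := by
          apply mul_le_mul hR (mul_le_mul_of_nonneg_right hch hI) (by positivity) (by positivity)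
      _ = (1 + γ) ^ 2 * ((n.choose k : ℝ) *
          ∫ x, fDef μ n k x ∂(Measure.pi fun _ : Fin k => ν)) := by ring
      _ ≤ _ := mul_le_mul_of_nonneg_right hγ (by positivity)
  have hNk : 0 ≤ ((n : ℝ) ^ (1 - α / 2)) ^ k := by positivity
  have b2 : ε1 ^ η * (C3 * (n : ℝ) ^ (1 - α / 2)) ^ k ≤
      a / 8 * cm * ((n : ℝ) ^ (1 - α / 2)) ^ k := by
    rw [mul_pow, ← mul_assoc]
    exact mul_le_mul_of_nonneg_right hε1 hNk
  have b3 : 2 ^ M * ((C4 * (n * (κ * (n : ℝ) ^ ρ) ^ (1 - α))) ^ 2 / (μ * n)) ≤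
      a / 8 * cm * ((n : ℝ) ^ (1 - α / 2)) ^ k := by
    refine le_trans (le_of_eq ?_) (mul_le_mul_of_nonneg_right hκ hNk)
    rw [← id_pow hid hn', Real.mul_rpow hκ0.le (by positivity)]
    field_simp
  have b4 := mul_le_mul_of_nonneg_left hmn.1 (show 0 ≤ a / 8 by positivity)
  have hB' : (1 + a) * mExp ν μ k n < Cful μ k n w := hB
  have hm0 : 0 ≤ mExp ν μ k n := le_trans (by positivity) hmn.1
  have b5 : 0 ≤ a * mExp ν μ k n := by positivity
  linarith

end upper2

/-- for `α > 2 - 2/k` and `a > 0`,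
`P(C_n > (1+a) m_n^{(k)}) = Θ((n P(W > c_a(n)))^{k-2})`. -/
theorem stmt4
    (α : ℝ) (hα : α ∈ Set.Ioo (1 : ℝ) 2)
    (ν : Measure ℝ) [IsProbabilityMeasure ν]
    (hsupp : ν (Set.Iio 1) = 0)
    (htail : Tendsto (fun x : ℝ => x ^ α * (ν (Set.Ioi x)).toReal) atTop (nhds 1))
    (hint : Integrable (fun x : ℝ => x) ν)
    (μ : ℝ) (hμ : μ = ∫ x, x ∂ν)
    (k : ℕ) (hk : 3 ≤ k)
    (hα2 : 2 - 2 / (k : ℝ) < α)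
    (a : ℝ) (ha : 0 < a) :
    ∃ c C : ℝ, ∃ n₀ : ℕ, 0 < c ∧ c ≤ C ∧ ∀ n, n₀ ≤ n →
      c * ((n : ℝ) * (ν (Set.Ioi (cA ν μ k a n))).toReal) ^ (k - 2) ≤
          ((Measure.pi fun _ : Fin n => ν)
            {w | (1 + a) * mExp ν μ k n < Cful μ k n w}).toReal ∧
      ((Measure.pi fun _ : Fin n => ν)
            {w | (1 + a) * mExp ν μ k n < Cful μ k n w}).toReal ≤
          C * ((n : ℝ) * (ν (Set.Ioi (cA ν μ k a n))).toReal) ^ (k - 2) := by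
  obtain ⟨hα1, hαlt⟩ := hα
  have hk' : (3 : ℝ) ≤ k := by exact_mod_cast hk
  have hk0 : (0 : ℝ) < k := by linarith
  have hμ0 : 0 < μ := by
    have h1 : ∫ _x : ℝ, (1 : ℝ) ∂ν ≤ ∫ x, x ∂ν :=
      integral_mono_ae (integrable_const 1) hint (ae_one_le hsupp)
    rw [← hμ] at h1
    simp at h1
    linarith
  obtain ⟨ρ, hρ⟩ : ∃ ρ : ℝ, ρ = (1 - k * (1 - α / 2)) / (2 * (α - 1)) := ⟨_, rfl⟩
  have hid : 2 * ρ * (α - 1) = 1 - k * (1 - α / 2) := by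
    have : α - 1 ≠ 0 := by linarith
    rw [hρ]; field_simp
  have hkα : k * (1 - α / 2) < 1 := by
    have h1 : 2 - α < 2 / k := by linarith
    rw [lt_div_iff₀ hk0] at h1
    linarith
  have hρ0 : 0 < ρ := by
    rw [hρ]
    exact div_pos (by linarith) (by linarith)
  have hδ : 1 < α * (1 - ρ) := by
    have h1 : 2 * ρ * (α - 1) ≤ 1 - 3 * (1 - α / 2) := by nlinarith
    have h2 : 0 < (2 - α) ^ 2 := by
      have : 0 < 2 - α := by linarith
      positivity
    by_contra hcon
    push Not at hcon
    have h3 : α - 1 ≤ α * ρ := by linarith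
    have h4 : (α - 1) * (2 * (α - 1)) ≤ α * ρ * (2 * (α - 1)) :=
      mul_le_mul_of_nonneg_right h3 (by linarith)
    have h5 : α * (2 * ρ * (α - 1)) ≤ α * (1 - 3 * (1 - α / 2)) :=
      mul_le_mul_of_nonneg_left h1 (by linarith)
    nlinarith
  have hρ1 : ρ < 1 / 2 := by
    by_contra hcon
    push Not at hcon
    nlinarith
  obtain ⟨cl, hcl, hlow⟩ := prob_lower hα1 hαlt hsupp htail hμ0 hk hρ0 hρ1 hid hδ ha
  obtain ⟨Cu, hCu, hup⟩ := prob_upper hα1 hαlt hsupp htail hμ0 hk hρ0 hρ1 hid hδ ha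
  obtain ⟨ch, Ch, hch, hCh, hhub⟩ := hubProb_bounds hα1 hαlt hsupp htail hμ0 hk hρ0 hρ1 hid ha
  obtain ⟨n₀, hn₀⟩ := eventually_atTop.1 (hlow.and (hup.and hhub))
  refine ⟨cl / Ch ^ (k - 2), max (cl / Ch ^ (k - 2)) (Cu / ch ^ (k - 2)), n₀, by positivity,
    le_max_left _ _, fun n hn => ?_⟩
  obtain ⟨h1, h2, h3, h4⟩ := hn₀ n hn
  have hx : 0 ≤ (n : ℝ) ^ (1 - α * (1 - ρ)) := by positivity
  generalize (n : ℝ) ^ (1 - α * (1 - ρ)) = x at h1 h2 h3 h4 hx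
  have hp0 : 0 ≤ (n : ℝ) * (ν (Set.Ioi (cA ν μ k a n))).toReal := by positivity
  generalize (n : ℝ) * (ν (Set.Ioi (cA ν μ k a n))).toReal = p at h3 h4 hp0 ⊢
  have h3' := pow_le_pow_left₀ (by positivity) h3 (k - 2)
  have h4' := pow_le_pow_left₀ hp0 h4 (k - 2)
  rw [mul_pow] at h3' h4'
  constructor
  · refine le_trans ?_ h1
    rw [div_mul_eq_mul_div, div_le_iff₀ (by positivity), mul_assoc]
    apply mul_le_mul_of_nonneg_left _ hcl.le
    linarith
  · refine le_trans (h2 : _ ≤ Cu * x ^ (k - 2)) ?_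
    refine le_trans ?_ (mul_le_mul_of_nonneg_right (le_max_right _ _) (by positivity))
    rw [div_mul_eq_mul_div, le_div_iff₀ (by positivity), mul_assoc]
    apply mul_le_mul_of_nonneg_left _ hCu.le
    linarith
end
end

section
/- Let 1 ≤ h ≤ k−3 and let b_1(n),…,b_h(n) be arbitrary sequences with values in [1,∞). Then S_B^{(h)}(n) = O(n^{−α(k−h)/2}) as n → ∞, uniformly in the choice of the sequences b_1(n),…,b_h(n). -/
open MeasureTheory Filter Set

noncomputable section

/-- `S_B^{(h)}(n) = ∫_{[1,∞)^{k-h}} f_n(b_1,…,b_h, x_{h+1},…,x_k) dF(x_{h+1})⋯dF(x_k)`. -/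
def SB (ν : Measure ℝ) (μ : ℝ) (k h : ℕ) (b : Fin h → ℝ) (n : ℕ) : ℝ :=
  ∫ x in Set.univ.pi (fun _ : Fin (k - h) => Set.Ici (1 : ℝ)),
    fDef μ n k (fun i =>
      if hlt : i.val < h then b ⟨i.val, hlt⟩
      else x ⟨i.val - h, by have := i.isLt; omega⟩)
    ∂(Measure.pi fun _ : Fin (k - h) => ν)


def GG (θ u : ℝ) : ℝ := (1 - θ) * min (4/3*u) (2/3*u) + θ * (2*u)

lemma GG_three (θ : ℝ) (h0 : 0 ≤ θ) (h1 : θ ≤ 1) (a b c : ℝ) :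
    min (a+b) 0 + min (b+c) 0 + min (a+c) 0 ≤ GG θ a + GG θ b + GG θ c := by
  have e1 : min (a+b) 0 + min (b+c) 0 + min (a+c) 0 ≤
      min (4/3*a) (2/3*a) + min (4/3*b) (2/3*b) + min (4/3*c) (2/3*c) := by
    simp only [min_def]; split_ifs <;> linarith
  have e2 : min (a+b) 0 + min (b+c) 0 + min (a+c) 0 ≤ 2*a+2*b+2*c := by
    have := min_le_left (a+b) 0
    have := min_le_left (b+c) 0
    have := min_le_left (a+c) 0
    linarith
  unfold GG
  have := mul_le_mul_of_nonneg_left e1 (sub_nonneg.2 h1)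
  have := mul_le_mul_of_nonneg_left e2 h0
  linarith

lemma GG_nonneg (θ : ℝ) (h0 : 0 ≤ θ) (h1 : θ ≤ 1) (a : ℝ) (ha : 0 ≤ a) : 0 ≤ GG θ a := by
  unfold GG
  have : 0 ≤ min (4/3*a) (2/3*a) := by apply le_min <;> linarith
  have := mul_nonneg (sub_nonneg.2 h1) this
  have := mul_nonneg h0 ha
  linarith

lemma GG_neg (θ : ℝ) (h1 : θ ≤ 1) (a : ℝ) (ha : a ≤ 0) : 2 * a ≤ GG θ a := by
  unfold GG
  have : 2*a ≤ min (4/3*a) (2/3*a) := by apply le_min <;> linarith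
  have := mul_le_mul_of_nonneg_left this (sub_nonneg.2 h1)
  linarith

lemma pair_sum {ι : Type*} [DecidableEq ι] (u : ι → ℝ) (θ : ℝ) (h0 : 0 ≤ θ) (h1 : θ ≤ 1)
    (m : ℕ) : ∀ s : Finset ι, s.card = m + 3 →
    ∑ p ∈ s.offDiag, min (u p.1 + u p.2) 0 ≤ 2 * ∑ i ∈ s, GG θ (u i) := by
  induction m with
  | zero =>
    intro s hs
    obtain ⟨x, y, z, hxy, hxz, hyz, rfl⟩ := Finset.card_eq_three.1 hs
    have key := GG_three θ h0 h1 (u x) (u y) (u z)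
    have : ({x, y, z} : Finset ι).offDiag = {(x,y),(x,z),(y,x),(y,z),(z,x),(z,y)} := by
      ext ⟨p, q⟩
      simp only [Finset.mem_offDiag, Finset.mem_insert, Finset.mem_singleton, Prod.mk.injEq]
      grind
    rw [this]
    have hs2 : ∑ i ∈ ({x, y, z} : Finset ι), GG θ (u i) = GG θ (u x) + GG θ (u y) + GG θ (u z) := by
      rw [Finset.sum_insert (by simp [hxy, hxz]), Finset.sum_insert (by simp [hyz])]; simp; ring
    rw [hs2]
    rw [Finset.sum_insert (by simp; grind), Finset.sum_insert (by simp; grind),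
      Finset.sum_insert (by simp; grind), Finset.sum_insert (by simp; grind),
      Finset.sum_insert (by simp; grind), Finset.sum_singleton]
    simp only
    rw [add_comm (u y) (u x), add_comm (u z) (u x), add_comm (u z) (u y)]
    linarith
  | succ m ih =>
    intro s hs
    obtain ⟨v, hv, hmax⟩ := s.exists_max_image u (Finset.card_pos.1 (by omega))
    have hc : (s.erase v).card = m + 3 := by rw [Finset.card_erase_of_mem hv]; omega
    have ih' := ih _ hc
    rw [← Finset.insert_erase hv, Finset.offDiag_insert (Finset.notMem_erase v s),
      Finset.sum_insert (Finset.notMem_erase v s)]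
    have hd1 : Disjoint ((s.erase v).offDiag ∪ {v} ×ˢ (s.erase v)) ((s.erase v) ×ˢ {v}) := by
      rw [Finset.disjoint_left]; rintro ⟨p, q⟩; simp; grind
    have hd2 : Disjoint ((s.erase v).offDiag) ({v} ×ˢ (s.erase v)) := by
      rw [Finset.disjoint_left]; rintro ⟨p, q⟩; simp; grind
    rw [Finset.sum_union hd1, Finset.sum_union hd2, Finset.sum_product, Finset.sum_product,
      Finset.sum_singleton]
    simp only [Finset.sum_singleton]
    have hb : ∑ y ∈ s.erase v, min (u v + u y) 0 ≤ GG θ (u v) := by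
      rcases le_total 0 (u v) with hpos | hneg
      · exact (Finset.sum_nonpos (fun i _ => min_le_right _ _)).trans (GG_nonneg θ h0 h1 _ hpos)
      · refine le_trans ?_ (GG_neg θ h1 _ hneg)
        have : ∑ y ∈ s.erase v, min (u v + u y) 0 ≤ ∑ y ∈ s.erase v, u v := by
          refine Finset.sum_le_sum fun i hi => (min_le_left _ _).trans ?_
          have := hmax i (Finset.mem_of_mem_erase hi)
          linarith
        refine this.trans ?_
        rw [Finset.sum_const, hc, nsmul_eq_mul]
        push_cast
        have : (m:ℝ) * u v ≤ 0 := mul_nonpos_of_nonneg_of_nonpos (by positivity) hneg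
        linarith
    have hb' : ∑ y ∈ s.erase v, min (u y + u v) 0 ≤ GG θ (u v) := by
      simpa [add_comm] using hb
    linarith

lemma sum_lt_offDiag {k : ℕ} (w : Fin k → Fin k → ℝ) (hw : ∀ i j, w i j = w j i) :
    2 * ∑ p ∈ Finset.univ.filter (fun p : Fin k × Fin k => p.1 < p.2), w p.1 p.2
      = ∑ p ∈ (Finset.univ : Finset (Fin k)).offDiag, w p.1 p.2 := by
  have e : (Finset.univ : Finset (Fin k)).offDiag =
      Finset.univ.filter (fun p : Fin k × Fin k => p.1 < p.2) ∪
      Finset.univ.filter (fun p : Fin k × Fin k => p.2 < p.1) := by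
    ext ⟨p, q⟩; simp
  rw [e, Finset.sum_union, two_mul]
  · congr 1
    refine Finset.sum_nbij' Prod.swap Prod.swap ?_ ?_ ?_ ?_ ?_ <;> simp
    intro a b _; exact hw _ _
  · rw [Finset.disjoint_left]; rintro ⟨p, q⟩; simp; grind

lemma fDef_eq_aux {k : ℕ} (t M : ℝ) (ht : 0 < t) (hM : t * t = M) (x : Fin k → ℝ) (hx : ∀ i, 0 < x i) :
    ∏ p ∈ Finset.univ.filter (fun p : Fin k × Fin k => p.1 < p.2), min (x p.1 * x p.2 / M) 1
    = Real.exp (∑ p ∈ Finset.univ.filter (fun p : Fin k × Fin k => p.1 < p.2),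
        min (Real.log (x p.1 / t) + Real.log (x p.2 / t)) 0) := by
  rw [Real.exp_sum]
  refine Finset.prod_congr rfl fun p _ => ?_
  have h1 := div_pos (hx p.1) ht
  have h2 := div_pos (hx p.2) ht
  rw [Real.exp_monotone.map_min, Real.exp_add, Real.exp_log h1, Real.exp_log h2, Real.exp_zero,
    ← hM, div_mul_div_comm]

lemma fDef_bound (k h : ℕ) (hk : h + 3 ≤ k) (θ : ℝ) (h0 : 0 ≤ θ) (h1 : θ ≤ 1)
    (t M : ℝ) (ht : 0 < t) (hM : t * t = M) (b : Fin h → ℝ) (hb : ∀ i, 1 ≤ b i)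
    (x : Fin (k-h) → ℝ) (hx : ∀ i, 1 ≤ x i) (y : Fin k → ℝ)
    (hy : y = (fun i =>
      if hlt : i.val < h then b ⟨i.val, hlt⟩
      else x ⟨i.val - h, by have := i.isLt; omega⟩)) :
    ∏ p ∈ Finset.univ.filter (fun p : Fin k × Fin k => p.1 < p.2), min (y p.1 * y p.2 / M) 1
      ≤ ∏ i, Real.exp (GG θ (Real.log (x i / t))) := by
  have hypos : ∀ i, 0 < y i := by
    intro i; rw [hy]; dsimp only
    split_ifs with hh
    · exact lt_of_lt_of_le one_pos (hb _)
    · exact lt_of_lt_of_le one_pos (hx _)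
  rw [fDef_eq_aux t M ht hM y hypos, ← Real.exp_sum, Real.exp_le_exp]
  set u : Fin k → ℝ := fun i => Real.log (y i / t) with hu
  set s : Finset (Fin k) := Finset.univ.filter (fun i => h ≤ i.val) with hs
  have hsum : ∀ f : ℝ → ℝ, ∑ i ∈ s, f (y i) = ∑ i, f (x i) := by
    intro f
    refine Finset.sum_bij' (fun i _ => (⟨i.val - h, by have := i.isLt; omega⟩ : Fin (k-h)))
      (fun j _ => (⟨j.val + h, by have := j.isLt; omega⟩ : Fin k)) ?_ ?_ ?_ ?_ ?_
    · simp
    · simp [hs]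
    · intro i hi
      simp only [hs, Finset.mem_filter, Finset.mem_univ, true_and] at hi
      ext; simp; omega
    · intro i hi; ext; simp
    · intro i hi
      simp only [hs, Finset.mem_filter, Finset.mem_univ, true_and] at hi
      rw [hy]; simp [not_lt.2 hi]
  have hcard : s.card = (k - h - 3) + 3 := by
    have hc := Finset.card_bij' (s := s) (t := (Finset.univ : Finset (Fin (k-h))))
      (fun i _ => (⟨i.val - h, by have := i.isLt; omega⟩ : Fin (k-h)))
      (fun j _ => (⟨j.val + h, by have := j.isLt; omega⟩ : Fin k)) (by simp) (by simp [hs])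
      (by
        intro i hi
        simp only [hs, Finset.mem_filter, Finset.mem_univ, true_and] at hi
        ext; simp; omega)
      (by intro i hi; ext; simp)
    rw [hc, Finset.card_univ, Fintype.card_fin]; omega
  have e1 := pair_sum u θ h0 h1 _ s hcard
  have e2 := sum_lt_offDiag (fun i j => min (u i + u j) 0) (fun i j => by rw [add_comm])
  have e3 : ∑ p ∈ (Finset.univ : Finset (Fin k)).offDiag, min (u p.1 + u p.2) 0 ≤
      ∑ p ∈ s.offDiag, min (u p.1 + u p.2) 0 := by
    refine Finset.sum_le_sum_of_subset_of_nonpos' ?_ ?_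
    · exact Finset.offDiag_mono (Finset.subset_univ s)
    · intro i _ _; exact min_le_right _ _
  have e4 := hsum (fun z => GG θ (Real.log (z / t)))
  simp only [hu] at *
  linarith

lemma layer_bound (ρ : Measure ℝ) (f φ : ℝ → ℝ) (p A : ℝ) (hp : 0 < p) (hA : 0 ≤ A)
    (hf : 0 ≤ᵐ[ρ] f) (hfm : Measurable f) (hφ : ∀ s, 0 < s → 0 ≤ φ s)
    (hb : ∀ s, 0 < s → ρ {x | s < f x} ≤ ENNReal.ofReal (A * φ s)) :
    ∫⁻ x, ENNReal.ofReal (f x ^ p) ∂ρ ≤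
      (ENNReal.ofReal p * ∫⁻ s in Ioi (0:ℝ), ENNReal.ofReal (φ s * s ^ (p-1))) *
        ENNReal.ofReal A := by
  rw [lintegral_rpow_eq_lintegral_meas_lt_mul ρ hf hfm.aemeasurable hp, mul_assoc]
  refine mul_le_mul_right ?_ _
  rw [← lintegral_mul_const' _ _ ENNReal.ofReal_ne_top]
  refine setLIntegral_mono' measurableSet_Ioi fun s hs => ?_
  have hs' : (0:ℝ) < s := hs
  refine (mul_le_mul_left (hb s hs') _).trans ?_
  rw [← ENNReal.ofReal_mul (mul_nonneg hA (hφ s hs')),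
    ← ENNReal.ofReal_mul (mul_nonneg (hφ s hs') (Real.rpow_nonneg hs'.le _))]
  apply le_of_eq; congr 1; ring

lemma int_phi1 (α β : ℝ) (h : α < β) :
    IntegrableOn (fun s : ℝ => (if s < 1 then s ^ (-α) else 0) * s ^ (β - 1)) (Ioi 0) := by
  have h1 : IntegrableOn (fun s : ℝ => s ^ (β - 1 - α)) (Ioo 0 1) :=
    (intervalIntegral.integrableOn_Ioo_rpow_iff one_pos).2 (by linarith)
  have h2 : IntegrableOn (fun s : ℝ => (if s < 1 then s ^ (-α) else 0) * s ^ (β - 1)) (Ioo 0 1) := by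
    refine h1.congr_fun ?_ measurableSet_Ioo
    intro s hs
    simp only [hs.2, if_true]
    rw [← Real.rpow_add hs.1]; congr 1; ring
  have h3 : IntegrableOn (fun s : ℝ => (if s < 1 then s ^ (-α) else 0) * s ^ (β - 1)) (Ici 1) := by
    refine (integrableOn_zero (s := Ici (1:ℝ))).congr_fun ?_ measurableSet_Ici
    intro s hs
    simp [not_lt.2 (Set.mem_Ici.1 hs)]
  rw [← Ioo_union_Ici_eq_Ioi (zero_lt_one (α := ℝ))]
  exact h2.union h3

lemma int_phi2 (α γ : ℝ) (h0 : 0 < γ) (h : γ < α) :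
    IntegrableOn (fun s : ℝ => (max s 1) ^ (-α) * s ^ (γ - 1)) (Ioi 0) := by
  have h2 : IntegrableOn (fun s : ℝ => (max s 1) ^ (-α) * s ^ (γ - 1)) (Ioo 0 1) := by
    have h1 : IntegrableOn (fun s : ℝ => s ^ (γ - 1)) (Ioo 0 1) :=
      (intervalIntegral.integrableOn_Ioo_rpow_iff one_pos).2 (by linarith)
    refine h1.congr_fun ?_ measurableSet_Ioo
    intro s hs
    simp [max_eq_right hs.2.le]
  have h3 : IntegrableOn (fun s : ℝ => (max s 1) ^ (-α) * s ^ (γ - 1)) (Ici 1) := by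
    have h1 : IntegrableOn (fun s : ℝ => s ^ (γ - 1 - α)) (Ici 1) :=
      (integrableOn_Ici_iff_integrableOn_Ioi).2 (integrableOn_Ioi_rpow_of_lt (by linarith) one_pos)
    refine h1.congr_fun ?_ measurableSet_Ici
    intro s hs
    have hs' : (1:ℝ) ≤ s := hs
    simp only [max_eq_left hs']
    rw [← Real.rpow_add (by linarith)]; congr 1; ring
  rw [← Ioo_union_Ici_eq_Ioi (zero_lt_one (α := ℝ))]
  exact h2.union h3

lemma exp_GG_le (θ : ℝ) (h1 : θ ≤ 1) (y : ℝ) (hy : 0 < y) :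
    Real.exp (GG θ (Real.log y)) ≤
      (min y 1) ^ (4/3 + 2/3*θ) + ((Ioi (1:ℝ)).indicator id y) ^ (2/3 + 4/3*θ) := by
  rcases le_or_gt y 1 with h | h
  · have hl : Real.log y ≤ 0 := Real.log_nonpos hy.le h
    have : GG θ (Real.log y) ≤ Real.log y * (4/3 + 2/3*θ) := by
      unfold GG
      have := mul_le_mul_of_nonneg_left (min_le_left (4/3*Real.log y) (2/3*Real.log y)) (sub_nonneg.2 h1)
      linarith
    have e := Real.exp_le_exp.2 this
    rw [← Real.rpow_def_of_pos hy] at e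
    rw [min_eq_left h]
    have : 0 ≤ ((Ioi (1:ℝ)).indicator id y) ^ (2/3 + 4/3*θ) :=
      Real.rpow_nonneg (Set.indicator_nonneg (fun a ha => zero_le_one.trans (le_of_lt ha)) _) _
    linarith
  · have : GG θ (Real.log y) ≤ Real.log y * (2/3 + 4/3*θ) := by
      unfold GG
      have := mul_le_mul_of_nonneg_left (min_le_right (4/3*Real.log y) (2/3*Real.log y)) (sub_nonneg.2 h1)
      linarith
    have e := Real.exp_le_exp.2 this
    rw [← Real.rpow_def_of_pos hy] at e
    rw [Set.indicator_of_mem (show y ∈ Ioi (1:ℝ) from h)]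
    have : 0 ≤ (min y 1) ^ (4/3 + 2/3*θ) := Real.rpow_nonneg (by positivity) _
    simp only [id]
    linarith

lemma GG_meas (θ t : ℝ) : Measurable (fun x : ℝ => Real.exp (GG θ (Real.log (x / t)))) := by
  unfold GG; fun_prop

lemma one_var (α K θ : ℝ) (hK : 0 ≤ K) (h0 : 0 ≤ θ) (h1 : θ ≤ 1)
    (hβ : α < 4/3 + 2/3*θ) (hγ : 2/3 + 4/3*θ < α) (ρ : Measure ℝ) (hρ : ∀ᵐ x ∂ρ, 1 ≤ x)
    (htail : ∀ x, 0 < x → ρ (Ioi x) ≤ ENNReal.ofReal (K * x ^ (-α))) :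
    ∃ C : ℝ, 0 ≤ C ∧ ∀ t : ℝ, 0 < t →
      Integrable (fun x => Real.exp (GG θ (Real.log (x / t)))) ρ ∧
      ∫ x, Real.exp (GG θ (Real.log (x / t))) ∂ρ ≤ C * t ^ (-α) := by
  set C1 := ENNReal.ofReal (4/3 + 2/3*θ) * ∫⁻ s in Ioi (0:ℝ),
    ENNReal.ofReal ((if s < 1 then s ^ (-α) else 0) * s ^ ((4/3 + 2/3*θ)-1)) with hC1
  set C2 := ENNReal.ofReal (2/3 + 4/3*θ) * ∫⁻ s in Ioi (0:ℝ),
    ENNReal.ofReal ((max s 1) ^ (-α) * s ^ ((2/3 + 4/3*θ)-1)) with hC2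
  have hC1t : C1 ≠ ⊤ := ENNReal.mul_ne_top ENNReal.ofReal_ne_top
    (int_phi1 α _ hβ).lintegral_lt_top.ne
  have hC2t : C2 ≠ ⊤ := ENNReal.mul_ne_top ENNReal.ofReal_ne_top
    (int_phi2 α _ (by linarith) hγ).lintegral_lt_top.ne
  refine ⟨(C1 + C2).toReal * K, by positivity, fun t ht => ?_⟩
  have hA : 0 ≤ K * t ^ (-α) := by positivity
  have b1 := layer_bound ρ (fun x => min (x/t) 1) (fun s => if s < 1 then s ^ (-α) else 0)
    (4/3 + 2/3*θ) (K * t ^ (-α)) (by linarith) hA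
    (by filter_upwards [hρ] with x hx
        exact le_min (div_nonneg (by linarith) ht.le) zero_le_one)
    (by fun_prop)
    (by intro s hs; split_ifs <;> positivity)
    (by intro s hs
        by_cases hs1 : s < 1
        · rw [if_pos hs1, mul_assoc, ← Real.mul_rpow ht.le hs.le]
          refine le_trans (measure_mono ?_) (htail _ (mul_pos ht hs))
          intro x hx
          have hx' : s < min (x/t) 1 := hx
          have := (lt_min_iff.1 hx').1
          rw [lt_div_iff₀ ht] at this
          show t * s < x
          linarith
        · have : {x : ℝ | s < min (x/t) 1} = ∅ := by
            ext x; simp; intro _; linarith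
          rw [this]; simp)
  have b2 := layer_bound ρ (fun x => (Ioi (1:ℝ)).indicator id (x/t)) (fun s => (max s 1) ^ (-α))
    (2/3 + 4/3*θ) (K * t ^ (-α)) (by linarith) hA
    (by filter_upwards with x
        exact Set.indicator_nonneg (fun a ha => zero_le_one.trans (le_of_lt ha)) _)
    ((measurable_id.indicator measurableSet_Ioi).comp (by fun_prop))
    (by intro s _; positivity)
    (by intro s hs
        rw [mul_assoc, ← Real.mul_rpow ht.le (by positivity)]
        refine le_trans (measure_mono ?_) (htail _ (by positivity))
        intro x hx
        simp only [mem_ofPred_eq, Set.indicator_apply] at hx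
        split_ifs at hx with hx1
        · have h3 : max s 1 < x / t := max_lt hx hx1
          rw [lt_div_iff₀ ht] at h3
          show t * max s 1 < x
          linarith
        · exact absurd hx (not_lt.2 hs.le))
  have b3 : ∫⁻ x, ENNReal.ofReal (Real.exp (GG θ (Real.log (x / t)))) ∂ρ ≤
      ENNReal.ofReal ((C1 + C2).toReal * K * t ^ (-α)) := by
    have : ∫⁻ x, ENNReal.ofReal (Real.exp (GG θ (Real.log (x / t)))) ∂ρ ≤
      ∫⁻ x, (ENNReal.ofReal ((min (x/t) 1) ^ (4/3 + 2/3*θ)) +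
        ENNReal.ofReal (((Ioi (1:ℝ)).indicator id (x/t)) ^ (2/3 + 4/3*θ))) ∂ρ := by
      refine lintegral_mono_ae ?_
      filter_upwards [hρ] with x hx
      refine le_trans (ENNReal.ofReal_le_ofReal (exp_GG_le θ h1 (x/t) (div_pos (by linarith) ht))) ?_
      exact ENNReal.ofReal_add_le
    refine this.trans ?_
    rw [lintegral_add_left (by fun_prop)]
    refine (add_le_add b1 b2).trans ?_
    rw [← hC1, ← hC2, ← add_mul, mul_assoc, ENNReal.ofReal_mul ENNReal.toReal_nonneg,
      ENNReal.ofReal_toReal (ENNReal.add_ne_top.2 ⟨hC1t, hC2t⟩)]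
  constructor
  · refine ⟨(GG_meas θ t).aestronglyMeasurable, ?_⟩
    rw [hasFiniteIntegral_iff_ofReal (Eventually.of_forall fun x => (Real.exp_pos _).le)]
    exact b3.trans_lt ENNReal.ofReal_lt_top
  · rw [integral_eq_lintegral_of_nonneg_ae (Eventually.of_forall fun x => (Real.exp_pos _).le)
      (GG_meas θ t).aestronglyMeasurable]
    exact ENNReal.toReal_le_of_le_ofReal (by positivity) b3

lemma tail_bound (α : ℝ) (hα : 0 < α) (ν : Measure ℝ) [IsProbabilityMeasure ν]
    (htail : Tendsto (fun x : ℝ => x ^ α * (ν (Set.Ioi x)).toReal) atTop (nhds 1)) :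
    ∃ K : ℝ, 0 ≤ K ∧ ∀ x, 0 < x → ν (Ioi x) ≤ ENNReal.ofReal (K * x ^ (-α)) := by
  obtain ⟨x0, hx0⟩ := eventually_atTop.1 (htail.eventually (ge_mem_nhds (one_lt_two)))
  refine ⟨2 + |x0| ^ α, by positivity, fun x hx => ?_⟩
  have hle : x ^ α * (ν (Ioi x)).toReal ≤ 2 + |x0| ^ α := by
    rcases le_total x0 x with h | h
    · have := hx0 x h
      have : 0 ≤ |x0| ^ α := by positivity
      linarith
    · have h1 : x ^ α ≤ |x0| ^ α := Real.rpow_le_rpow hx.le (h.trans (le_abs_self _)) hα.le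
      have h2 : (ν (Ioi x)).toReal ≤ 1 := measureReal_le_one
      have h3 : x ^ α * (ν (Ioi x)).toReal ≤ x ^ α := mul_le_of_le_one_right (by positivity) h2
      linarith
  rw [← ENNReal.ofReal_toReal (measure_ne_top ν (Ioi x))]
  apply ENNReal.ofReal_le_ofReal
  rw [Real.rpow_neg hx.le, ← div_eq_mul_inv, le_div_iff₀ (by positivity)]
  linarith

/-- for `1 ≤ h ≤ k-3`, `S_B^{(h)}(n) = O(n^{-α(k-h)/2})` uniformly in the
sequences `b_1(n),…,b_h(n)` with values in `[1,∞)`. -/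
theorem stmt5
    (α : ℝ) (hα : α ∈ Set.Ioo (1 : ℝ) 2)
    (ν : Measure ℝ) [IsProbabilityMeasure ν]
    (hsupp : ν (Set.Iio 1) = 0)
    (htail : Tendsto (fun x : ℝ => x ^ α * (ν (Set.Ioi x)).toReal) atTop (nhds 1))
    (hint : Integrable (fun x : ℝ => x) ν)
    (μ : ℝ) (hμ : μ = ∫ x, x ∂ν)
    (k : ℕ) (hk : 3 ≤ k)
    (h : ℕ) (hh1 : 1 ≤ h) (hh2 : h ≤ k - 3) :
    ∃ C : ℝ, ∃ n₀ : ℕ, 0 < C ∧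
      ∀ b : Fin h → ℕ → ℝ, (∀ i m, 1 ≤ b i m) → ∀ n, n₀ ≤ n →
        |SB ν μ k h (fun i => b i n) n| ≤
          C * (n : ℝ) ^ (-(α * ((k : ℝ) - (h : ℝ))) / 2) := by
  obtain ⟨hα1, hα2⟩ := hα
  obtain ⟨K, hK, hKt⟩ := tail_bound α (by linarith) ν htail
  obtain ⟨θ, h0, h1, hβ, hγ⟩ : ∃ θ : ℝ, 0 ≤ θ ∧ θ ≤ 1 ∧ α < 4/3 + 2/3*θ ∧ 2/3 + 4/3*θ < α := by
    obtain ⟨θ, ha, hb⟩ := exists_between (show max 0 ((3*α-4)/2) < (3*α-2)/4 from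
      max_lt (by linarith) (by linarith))
    obtain ⟨hc, hd⟩ := max_lt_iff.1 ha
    exact ⟨θ, hc.le, by linarith, by linarith, by linarith⟩
  set ρ := ν.restrict (Ici (1:ℝ)) with hρdef
  have hρ : ∀ᵐ x ∂ρ, 1 ≤ x := ae_restrict_mem measurableSet_Ici
  obtain ⟨C, hC, hCb⟩ := one_var α K θ hK h0 h1 hβ hγ ρ hρ
    (fun x hx => (Measure.restrict_apply_le _ _).trans (hKt x hx))
  have hμ1 : 1 ≤ μ := by
    have hae : ∀ᵐ x ∂ν, (1:ℝ) ≤ x := by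
      rw [ae_iff]; convert hsupp using 2; ext x; simp
    have := integral_mono_ae (integrable_const (1:ℝ)) hint hae
    rw [hμ]; simpa using this
  refine ⟨C ^ (k - h) + 1, 1, by positivity, fun b hb n hn => ?_⟩
  have hnR : (1:ℝ) ≤ n := by exact_mod_cast hn
  have hMpos : 0 < μ * n := by positivity
  set t := Real.sqrt (μ * n) with ht
  have htpos : 0 < t := Real.sqrt_pos.2 hMpos
  have htt : t * t = μ * n := Real.mul_self_sqrt hMpos.le
  obtain ⟨hI, hIb⟩ := hCb t htpos
  have hpi : (Measure.pi fun _ : Fin (k - h) => ν).restrict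
      (Set.univ.pi (fun _ : Fin (k - h) => Set.Ici (1 : ℝ))) = Measure.pi (fun _ => ρ) :=
    Measure.restrict_pi_pi _ _
  have haepi : ∀ᵐ x ∂(Measure.pi (fun _ : Fin (k-h) => ρ)), ∀ i, 1 ≤ x i := by
    rw [← hpi]
    filter_upwards [ae_restrict_mem (MeasurableSet.univ_pi fun _ => measurableSet_Ici)] with x hx i
    exact hx i (mem_univ i)
  have hnn : 0 ≤ᵐ[Measure.pi (fun _ : Fin (k-h) => ρ)] (fun x => fDef μ n k (fun i =>
      if hlt : i.val < h then b ⟨i.val, hlt⟩ n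
      else x ⟨i.val - h, by have := i.isLt; omega⟩)) := by
    filter_upwards [haepi] with x hx
    have hpos : ∀ i : Fin k, 0 ≤ (if hlt : i.val < h then b ⟨i.val, hlt⟩ n
      else x ⟨i.val - h, by have := i.isLt; omega⟩) := by
      intro i
      split_ifs with hh
      · exact zero_le_one.trans (hb _ _)
      · exact zero_le_one.trans (hx _)
    unfold fDef
    exact Finset.prod_nonneg fun p _ =>
      le_min (div_nonneg (mul_nonneg (hpos _) (hpos _)) hMpos.le) zero_le_one
  have hle : (fun x => fDef μ n k (fun i =>
      if hlt : i.val < h then b ⟨i.val, hlt⟩ n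
      else x ⟨i.val - h, by have := i.isLt; omega⟩)) ≤ᵐ[Measure.pi (fun _ : Fin (k-h) => ρ)]
      (fun x => ∏ i, Real.exp (GG θ (Real.log (x i / t)))) := by
    filter_upwards [haepi] with x hx
    unfold fDef
    exact fDef_bound k h (by omega) θ h0 h1 t (μ * n) htpos htt (fun i => b i n)
      (fun i => hb i n) x hx _ rfl
  have hIprod : Integrable (fun x : Fin (k-h) → ℝ => ∏ i, Real.exp (GG θ (Real.log (x i / t))))
      (Measure.pi (fun _ : Fin (k-h) => ρ)) :=
    Integrable.fintype_prod (f := fun _ (y : ℝ) => Real.exp (GG θ (Real.log (y / t)))) (fun _ => hI)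
  unfold SB
  rw [hpi, abs_of_nonneg (integral_nonneg_of_ae hnn)]
  refine (integral_mono_of_nonneg hnn hIprod hle).trans ?_
  rw [integral_fintype_prod_eq_pow (fun y : ℝ => Real.exp (GG θ (Real.log (y / t)))),
    Fintype.card_fin]
  have hint0 : 0 ≤ ∫ x, Real.exp (GG θ (Real.log (x / t))) ∂ρ :=
    integral_nonneg fun x => (Real.exp_pos _).le
  have htn : t ^ (-α) ≤ (n:ℝ) ^ (-α/2) := by
    rw [ht, Real.sqrt_eq_rpow, ← Real.rpow_mul hMpos.le]
    rw [show 1/2 * -α = -α/2 by ring]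
    refine Real.rpow_le_rpow_of_nonpos (by linarith) ?_ (by linarith)
    nlinarith
  have e1 : ∫ x, Real.exp (GG θ (Real.log (x / t))) ∂ρ ≤ C * (n:ℝ) ^ (-α/2) :=
    hIb.trans (mul_le_mul_of_nonneg_left htn hC)
  refine (pow_le_pow_left₀ hint0 e1 (k-h)).trans ?_
  rw [mul_pow, ← Real.rpow_natCast ((n:ℝ) ^ (-α/2)), ← Real.rpow_mul (by positivity),
    Nat.cast_sub (by omega)]
  rw [show -α/2 * ((k:ℝ) - h) = -(α * ((k:ℝ) - h))/2 by ring]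
  have : 0 ≤ (n:ℝ) ^ (-(α * ((k:ℝ) - h))/2) := by positivity
  linarith
end
end
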